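/- Coifman–Meyer multiplier theorem transferred to the torus: let k ∈ ℕ and let σ : ℝ^{2k} → ℂ be infinitely differentiable with |∂_ξ^β σ(ξ)| ≲_β (1+|ξ|)^{−|β|} for all ξ = (ξ₁,…,ξ_k) ∈ ℝ^{2k} and all multi-indices β ∈ ℕ^{2k}. Define, for smooth f₁,…,f_k on T², Λ̃(f₁,…,f_k)(x) := Σ_{(n₁,…,n_k)∈ℤ^{2k}} σ(n₁,…,n_k) f̂₁(n₁)⋯f̂_k(n_k) e^{2πi(n₁+⋯+n_k)·x}. Then ‖Λ̃(f₁,…,f_k)‖_{L^p(T²)} ≲ ‖f₁‖_{L^{p₁}(T²)}⋯‖f_k‖_{L^{p_k}(T²)} for all (p₁,…,p_k) ∈ (1,∞)^k with 1/p = 1/p₁ + ⋯ + 1/p_k ≤ 1. -/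

import Mathlib

open MeasureTheory Real ENNReal

noncomputable section

/-- The two-dimensional torus `ℝ²/ℤ²`. -/
abbrev T2 := AddCircle (1 : ℝ) × AddCircle (1 : ℝ)

/-- The character `e_n(x) = e^{2πi n·x}` on the torus. -/
def fChar (n : ℤ × ℤ) : T2 → ℂ := fun x => fourier n.1 x.1 * fourier n.2 x.2

/-- The Fourier coefficient `f̂(n) = ∫_{T²} f(x) e^{-2πi n·x} dx`. -/
def fCoeff (f : T2 → ℂ) (n : ℤ × ℤ) : ℂ := ∫ x : T2, fChar (-n) x * f x

/-- Euclidean magnitude `|n|` of a frequency `n ∈ ℤ²`. -/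
def fAbs (n : ℤ × ℤ) : ℝ := Real.sqrt ((n.1 : ℝ) ^ 2 + (n.2 : ℝ) ^ 2)

/-- The Japanese bracket `⟨n⟩ = (1+|n|²)^{1/2}` of a frequency. -/
def jap (n : ℤ × ℤ) : ℝ := Real.sqrt (1 + ((n.1 : ℝ) ^ 2 + (n.2 : ℝ) ^ 2))

/-- The Japanese bracket `⟨x⟩` of a real number. -/
def japR (x : ℝ) : ℝ := Real.sqrt (1 + x ^ 2)

/-- The square of the Sobolev `H^s(T²)` norm: `Σ_n ⟨n⟩^{2s} |f̂(n)|²` (valued in `ℝ≥0∞`). -/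
def sobSq (s : ℝ) (f : T2 → ℂ) : ℝ≥0∞ :=
  ∑' n : ℤ × ℤ, ENNReal.ofReal (jap n ^ (2 * s) * ‖fCoeff f n‖ ^ 2)

/-- Membership in the Sobolev space `H^s(T²)`. -/
def MemHs (s : ℝ) (f : T2 → ℂ) : Prop := sobSq s f < ⊤

/-- The Sobolev `H^s(T²)` norm (valued in `ℝ≥0∞`). -/
def sobNorm (s : ℝ) (f : T2 → ℂ) : ℝ≥0∞ := sobSq s f ^ (1 / 2 : ℝ)

/-- A function is real-valued. -/
def RealData (f : T2 → ℂ) : Prop := ∀ x, (f x).im = 0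

/-- The Fourier multiplier operator with symbol `σ`. -/
def mulOp (σ : ℤ × ℤ → ℂ) (f : T2 → ℂ) : T2 → ℂ :=
  fun x => ∑' n : ℤ × ℤ, σ n * fCoeff f n * fChar n x

/-- The multiplier `⟨D⟩^α` with symbol `⟨n⟩^α`. -/
def DPow (α : ℝ) (f : T2 → ℂ) : T2 → ℂ := mulOp (fun n => ((jap n ^ α : ℝ) : ℂ)) f

/-- A smooth, radial, nonincreasing cut-off `η` with `0 ≤ η ≤ 1`, `η = 1` on `|ξ| ≤ 1` and
`η(ξ) = |ξ|^{-(1-s)}` for `|ξ| ≥ 2`. -/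
structure EtaFun (s : ℝ) where
  eta : ℝ × ℝ → ℝ
  smooth : ContDiff ℝ (⊤ : ℕ∞) eta
  radial : ∀ x y : ℝ × ℝ, Real.sqrt (x.1 ^ 2 + x.2 ^ 2) = Real.sqrt (y.1 ^ 2 + y.2 ^ 2) →
    eta x = eta y
  decreasing : ∀ x y : ℝ × ℝ, Real.sqrt (x.1 ^ 2 + x.2 ^ 2) ≤ Real.sqrt (y.1 ^ 2 + y.2 ^ 2) →
    eta y ≤ eta x
  nonneg : ∀ x, 0 ≤ eta x
  le_one : ∀ x, eta x ≤ 1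
  eq_one : ∀ x : ℝ × ℝ, Real.sqrt (x.1 ^ 2 + x.2 ^ 2) ≤ 1 → eta x = 1
  eq_pow : ∀ x : ℝ × ℝ, 2 ≤ Real.sqrt (x.1 ^ 2 + x.2 ^ 2) →
    eta x = Real.sqrt (x.1 ^ 2 + x.2 ^ 2) ^ (-(1 - s))

/-- The symbol `m(n) = η(n/N)` of the operator `I`. -/
def mSymb {s : ℝ} (θ : EtaFun s) (N : ℝ) (n : ℤ × ℤ) : ℝ :=
  θ.eta ((n.1 : ℝ) / N, (n.2 : ℝ) / N)

/-- The I-operator: Fourier multiplier with symbol `m(n) = η(n/N)`. -/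
def Iop {s : ℝ} (θ : EtaFun s) (N : ℝ) (f : T2 → ℂ) : T2 → ℂ :=
  mulOp (fun n => ((mSymb θ N n : ℝ) : ℂ)) f

/-- The operator `⟨D⟩^α I`, a multiplier with symbol `⟨n⟩^α m(n)`. -/
def IDop {s : ℝ} (θ : EtaFun s) (N α : ℝ) (f : T2 → ℂ) : T2 → ℂ :=
  mulOp (fun n => ((jap n ^ α * mSymb θ N n : ℝ) : ℂ)) f

/-- The operator `P_{≳N} ⟨D⟩^α I`, where `P_{≳N}` projects onto frequencies `|n| > 128N`. -/
def PIDop {s : ℝ} (θ : EtaFun s) (N α : ℝ) (f : T2 → ℂ) : T2 → ℂ :=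
  mulOp (fun n => if 128 * N < fAbs n then ((jap n ^ α * mSymb θ N n : ℝ) : ℂ) else 0) f

/-- `‖∇ I f‖²_{L²}` computed on the Fourier side via Plancherel:
`Σ_n 4π²|n|² m²(n) |f̂(n)|²`. -/
def gradIL2Sq {s : ℝ} (θ : EtaFun s) (N : ℝ) (f : T2 → ℂ) : ℝ≥0∞ :=
  ∑' n : ℤ × ℤ, ENNReal.ofReal
    (4 * π ^ 2 * ((n.1 : ℝ) ^ 2 + (n.2 : ℝ) ^ 2) * mSymb θ N n ^ 2 * ‖fCoeff f n‖ ^ 2)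

/-- `‖I f‖²_{L²}` computed on the Fourier side via Plancherel: `Σ_n m²(n)|f̂(n)|²`. -/
def IL2Sq {s : ℝ} (θ : EtaFun s) (N : ℝ) (f : T2 → ℂ) : ℝ≥0∞ :=
  ∑' n : ℤ × ℤ, ENNReal.ofReal (mSymb θ N n ^ 2 * ‖fCoeff f n‖ ^ 2)

/-- The mollified energy `E(Iu) = ½‖∂_t Iu‖²_{L²} + ½‖∇Iu‖²_{L²} + ¼‖Iu‖⁴_{L⁴}`,
where `f = u(t)` and `g = ∂_t u(t)`. -/
def molE {s : ℝ} (θ : EtaFun s) (N : ℝ) (f g : T2 → ℂ) : ℝ≥0∞ :=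
  (1 / 2 : ℝ≥0∞) * (eLpNorm (Iop θ N g) 2 volume) ^ 2
    + (1 / 2 : ℝ≥0∞) * gradIL2Sq θ N f
    + (1 / 4 : ℝ≥0∞) * (eLpNorm (Iop θ N f) 4 volume) ^ 4

/-- The temporal frequency `2π|n|` of the wave mode `n`. -/
def wfreq (n : ℤ × ℤ) : ℝ := 2 * π * fAbs n

/-- `cos(t D)` at mode `n`. -/
def cosK (n : ℤ × ℤ) (t : ℝ) : ℝ := Real.cos (wfreq n * t)

/-- `sin(t D)/D` at mode `n` (equal to `t` at the zero mode). -/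
def sincK (n : ℤ × ℤ) (t : ℝ) : ℝ :=
  if wfreq n = 0 then t else Real.sin (wfreq n * t) / wfreq n

/-- `u` (with time derivative `v`) solves `∂_tt u - Δ u = G` on `J` with data `(u₀,u₁)` at
time `a`, in the Duhamel (mild/distributional) sense, mode by mode. -/
def DuhamelSol (a : ℝ) (J : Set ℝ) (u v : ℝ → T2 → ℂ) (u₀ u₁ : T2 → ℂ)
    (G : ℝ → T2 → ℂ) : Prop :=
  (∀ n : ℤ × ℤ, fCoeff (u a) n = fCoeff u₀ n ∧ fCoeff (v a) n = fCoeff u₁ n) ∧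
  ∀ t ∈ J, ∀ n : ℤ × ℤ,
    fCoeff (u t) n = (cosK n (t - a) : ℂ) * fCoeff u₀ n + (sincK n (t - a) : ℂ) * fCoeff u₁ n
        + (∫ τ in a..t, (sincK n (t - τ) : ℂ) * fCoeff (G τ) n) ∧
    fCoeff (v t) n
      = ((-(wfreq n) * Real.sin (wfreq n * (t - a)) : ℝ) : ℂ) * fCoeff u₀ n
        + (cosK n (t - a) : ℂ) * fCoeff u₁ n
        + (∫ τ in a..t, (cosK n (t - τ) : ℂ) * fCoeff (G τ) n)

/-- `u` (with time derivative `v`) solves the defocusing cubic wave equation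
`∂_tt u - Δ u = -u³` on `J` with data `(u₀,u₁)` at time `a`. -/
def CubicSol (a : ℝ) (J : Set ℝ) (u v : ℝ → T2 → ℂ) (u₀ u₁ : T2 → ℂ) : Prop :=
  DuhamelSol a J u v u₀ u₁ (fun t x => -(u t x) ^ 3)

/-- The mixed norm `‖w‖_{L_t^q L_x^r(J)}`. -/
def mixNorm (q r : ℝ≥0∞) (J : Set ℝ) (w : ℝ → T2 → ℂ) : ℝ≥0∞ :=
  eLpNorm (fun t => (eLpNorm (w t) r volume).toReal) q (volume.restrict J)

/-- The dispersive norm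
`Z_{m,s}(J,(u,v)) = ‖(⟨D⟩^{1-m} I u, ⟨D⟩^{-m} I v)‖_{L_t^{3/m} L_x^{6/(3-4m)}(J)}`,
where `v = ∂_t u`. -/
def ZNorm {s : ℝ} (θ : EtaFun s) (N m : ℝ) (J : Set ℝ) (u v : ℝ → T2 → ℂ) : ℝ≥0∞ :=
  mixNorm (ENNReal.ofReal (3 / m)) (ENNReal.ofReal (6 / (3 - 4 * m))) J
    (fun t => IDop θ N (1 - m) (u t))
  + mixNorm (ENNReal.ofReal (3 / m)) (ENNReal.ofReal (6 / (3 - 4 * m))) J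
    (fun t => IDop θ N (-m) (v t))

/-- The free evolution (linear part) of the solution starting from time `a` with data
`(f,g)`: `u_l^J(t) = cos((t-a)D) f + (sin((t-a)D)/D) g`. -/
def linPart (a : ℝ) (f g : T2 → ℂ) (t : ℝ) : T2 → ℂ :=
  fun x => ∑' n : ℤ × ℤ,
    ((cosK n (t - a) : ℂ) * fCoeff f n + (sincK n (t - a) : ℂ) * fCoeff g n) * fChar n x

/-- The time derivative of the free evolution starting from time `a` with data `(f,g)`. -/
def linPartDt (a : ℝ) (f g : T2 → ℂ) (t : ℝ) : T2 → ℂ :=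
  fun x => ∑' n : ℤ × ℤ,
    (((-(wfreq n) * Real.sin (wfreq n * (t - a)) : ℝ) : ℂ) * fCoeff f n
      + (cosK n (t - a) : ℂ) * fCoeff g n) * fChar n x

/-- The quantity `X_k` of Proposition `EstLinNonlin`:
the max of four high-frequency mixed space-time norms of `(w, ∂_t w)`. -/
def XNorm {s : ℝ} (θ : EtaFun s) (N : ℝ) (J : Set ℝ) (w dw : ℝ → T2 → ℂ) : ℝ≥0∞ :=
  max
    (max (mixNorm 8 4 J (fun t => PIDop θ N (1 - 3 / 8) (w t)))
      (mixNorm 8 4 J (fun t => PIDop θ N (-(3 / 8)) (dw t))))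
    (max (mixNorm 12 3 J (fun t => PIDop θ N (1 - 1 / 4) (w t)))
      (mixNorm 12 3 J (fun t => PIDop θ N (-(1 / 4)) (dw t))))

/-- The quantity `α` of Section 7.2 (with an arbitrarily small fixed `δ > 0`):
`max(|J|N^{2(1-s)+δ}/N, |J|^{1/2}N^{2(1-s)}/N^{3/2}, |J|^{7/12}N^{3(1-s)/2}/N^{3/4},
|J|^{1/2}N^{2(1-s)}⟨|J|N^{1-s}⟩^{1/8}/N^{3/2})`. -/
def alphaVal (s δ N L : ℝ) : ℝ :=
  max (max (L * N ^ (2 * (1 - s) + δ) / N) (L ^ ((1:ℝ) / 2) * N ^ (2 * (1 - s)) / N ^ ((3:ℝ) / 2)))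
    (max (L ^ ((7:ℝ) / 12) * N ^ (3 * (1 - s) / 2) / N ^ ((3:ℝ) / 4))
      (L ^ ((1:ℝ) / 2) * N ^ (2 * (1 - s)) * japR (L * N ^ (1 - s)) ^ ((1:ℝ) / 8) / N ^ ((3:ℝ) / 2)))

/-- Smoothness of a function on the torus: it lifts to a smooth function on `ℝ²`. -/
def SmoothT2 (f : T2 → ℂ) : Prop :=
  ∃ F : ℝ × ℝ → ℂ, ContDiff ℝ (⊤ : ℕ∞) F ∧ ∀ x y : ℝ, f (↑x, ↑y) = F (x, y)

namespace CoifmanMeyer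

open Metric Set
open scoped NNReal

/-- The polynomially decaying bump `4^j (1 + 2^j ‖y‖)^{-N}` at scale `2^{-j}`. -/
def wt (N j : ℕ) (y : T2) : ℝ := 4 ^ j / (1 + 2 ^ j * ‖y‖) ^ N

/-- The average of a nonnegative function against the weight `wt N j`. -/
def avg (N j : ℕ) (f : T2 → ℝ≥0∞) (x : T2) : ℝ≥0∞ :=
  ∫⁻ y, ENNReal.ofReal (wt N j (x - y)) * f y

/-- The dyadic Hardy–Littlewood maximal function on the torus. -/
def maxFn (f : T2 → ℝ≥0∞) (x : T2) : ℝ≥0∞ :=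
  ⨆ j : ℕ, 4 ^ j * ∫⁻ y in closedBall x ((2 ^ j : ℝ)⁻¹), f y

instance : IsProbabilityMeasure (volume : Measure T2) := by
  constructor
  rw [← univ_prod_univ, Measure.volume_eq_prod, Measure.prod_prod]
  simp

instance : (volume : Measure T2).IsAddHaarMeasure :=
  inferInstanceAs ((volume : Measure (AddCircle (1 : ℝ))).prod volume).IsAddHaarMeasure

lemma norm_le_half (y : T2) : ‖y‖ ≤ 1 / 2 := by
  have h (t : AddCircle (1 : ℝ)) : ‖t‖ ≤ 1 / 2 := by
    simpa using AddCircle.norm_le_half_period (1 : ℝ) (x := t) one_ne_zero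
  exact max_le (h _) (h _)

lemma volume_closedBall_T2 (x : T2) (r : ℝ) :
    volume (closedBall x r) = ENNReal.ofReal (min 1 (2 * r)) ^ 2 := by
  rw [← closedBall_prod_same, Measure.volume_eq_prod, Measure.prod_prod,
    AddCircle.volume_closedBall, AddCircle.volume_closedBall, sq]

lemma volume_closedBall_le (x : T2) (r : ℝ) (hr : 0 ≤ r) :
    volume (closedBall x r) ≤ ENNReal.ofReal (4 * r ^ 2) := by
  rw [volume_closedBall_T2, ← ENNReal.ofReal_pow (by positivity)]
  apply ENNReal.ofReal_le_ofReal
  calc min 1 (2 * r) ^ 2 ≤ (2 * r) ^ 2 := by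
        gcongr
        exact min_le_right _ _
    _ = 4 * r ^ 2 := by ring

lemma le_volume_closedBall (x : T2) (r : ℝ) (hr : 0 ≤ r) (hr1 : r ≤ 1) :
    ENNReal.ofReal (r ^ 2) ≤ volume (closedBall x r) := by
  rw [volume_closedBall_T2, ← ENNReal.ofReal_pow (by positivity)]
  apply ENNReal.ofReal_le_ofReal
  gcongr
  exact le_min hr1 (by linarith)

lemma wt_pos (N j : ℕ) (y : T2) : 0 < wt N j y := by unfold wt; positivity

lemma wt_neg (N j : ℕ) (y : T2) : wt N j (-y) = wt N j y := by simp [wt]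

lemma wt_le (N j : ℕ) (y : T2) : wt N j y ≤ 4 ^ j := by
  unfold wt
  apply div_le_self (by positivity)
  apply one_le_pow₀
  have : 0 ≤ 2 ^ j * ‖y‖ := by positivity
  linarith

lemma continuous_wt (N j : ℕ) : Continuous (wt N j) := by
  unfold wt
  refine Continuous.div (by fun_prop) (by fun_prop) (fun y => ?_)
  positivity

@[fun_prop]
lemma measurable_wt (N j : ℕ) : Measurable (wt N j) := (continuous_wt N j).measurable

lemma wt_le_of_norm_le {N j : ℕ} {K : ℝ} (hK : 0 ≤ K) {x z : T2}
    (h : ‖x - z‖ ≤ K * (2 ^ j)⁻¹) : wt N j x ≤ (1 + K) ^ N * wt N j z := by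
  unfold wt
  rw [← mul_div_assoc, div_le_div_iff₀ (by positivity) (by positivity)]
  have h2 : 2 ^ j * ‖z‖ ≤ 2 ^ j * ‖x‖ + K := by
    have : ‖z‖ ≤ ‖x‖ + K * (2 ^ j)⁻¹ := by
      have := norm_sub_norm_le z x
      rw [norm_sub_rev] at this
      linarith
    calc 2 ^ j * ‖z‖ ≤ 2 ^ j * (‖x‖ + K * (2 ^ j)⁻¹) := by gcongr
      _ = _ := by field_simp
  have h3 : 1 + 2 ^ j * ‖z‖ ≤ (1 + K) * (1 + 2 ^ j * ‖x‖) := by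
    have : 0 ≤ 2 ^ j * ‖x‖ := by positivity
    nlinarith
  calc 4 ^ j * (1 + 2 ^ j * ‖z‖) ^ N ≤ 4 ^ j * ((1 + K) * (1 + 2 ^ j * ‖x‖)) ^ N := by gcongr
    _ = _ := by rw [mul_pow]; ring

lemma wt_succ_le {N j : ℕ} {c : ℝ} (hc : 0 < c) {y : T2} (h : c ≤ 1 + 2 ^ j * ‖y‖) :
    wt (N + 1) j y ≤ c⁻¹ * wt N j y := by
  unfold wt
  rw [inv_mul_eq_div, div_div, pow_succ]
  gcongr

lemma wt_scale_le {N j l m : ℕ} (h₁ : j ≤ l) (h₂ : l ≤ j + m) (y : T2) :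
    wt N l y ≤ 4 ^ m * wt N j y := by
  unfold wt
  rw [← mul_div_assoc, ← pow_add, add_comm m]
  gcongr <;> norm_num

lemma wt_mul_wt_le (N j : ℕ) (x z : T2) :
    wt N j (x - z) * wt N j z ≤ 2 ^ N * wt N j x * (wt N j (x - z) + wt N j z) := by
  unfold wt
  set u := 1 + 2 ^ j * ‖x - z‖
  set v := 1 + 2 ^ j * ‖z‖
  set t := 1 + 2 ^ j * ‖x‖
  have hu : 0 < u := by positivity
  have hv : 0 < v := by positivity
  have ht : 0 < t := by positivity
  have htuv : t ≤ u + v := by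
    have : ‖x‖ ≤ ‖x - z‖ + ‖z‖ := by simpa using norm_add_le (x - z) z
    have := mul_le_mul_of_nonneg_left this (show (0 : ℝ) ≤ 2 ^ j by positivity)
    simp only [u, v, t]; linarith
  have key : t ^ N ≤ 2 ^ N * (u ^ N + v ^ N) := by
    rcases le_total u v with h | h
    · calc t ^ N ≤ (2 * v) ^ N := by gcongr; linarith
        _ = 2 ^ N * v ^ N := mul_pow _ _ _
        _ ≤ _ := by gcongr; linarith [pow_pos hu N]
    · calc t ^ N ≤ (2 * u) ^ N := by gcongr; linarith
        _ = 2 ^ N * u ^ N := mul_pow _ _ _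
        _ ≤ _ := by gcongr; linarith [pow_pos hv N]
  have h4 : (0 : ℝ) < 4 ^ j := by positivity
  have : 2 ^ N * (4 ^ j / t ^ N) * (4 ^ j / u ^ N + 4 ^ j / v ^ N)
      = (4 ^ j * 4 ^ j) * (2 ^ N * (u ^ N + v ^ N)) / (t ^ N * (u ^ N * v ^ N)) := by
    field_simp
    ring
  rw [this, div_mul_div_comm, div_le_div_iff₀ (by positivity) (by positivity)]
  calc 4 ^ j * 4 ^ j * (t ^ N * (u ^ N * v ^ N))
      = (4 ^ j * 4 ^ j * (u ^ N * v ^ N)) * t ^ N := by ring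
    _ ≤ (4 ^ j * 4 ^ j * (u ^ N * v ^ N)) * (2 ^ N * (u ^ N + v ^ N)) := by gcongr
    _ = _ := by ring

lemma measurable_avg_kernel (N j : ℕ) :
    Measurable fun q : T2 × T2 => ENNReal.ofReal (wt N j (q.1 - q.2)) := by
  fun_prop

@[fun_prop]
lemma measurable_avg (N j : ℕ) {f : T2 → ℝ≥0∞} (hf : Measurable f) :
    Measurable (avg N j f) := by
  unfold avg
  apply Measurable.lintegral_prod_right
  exact (measurable_avg_kernel N j).mul (hf.comp measurable_snd)

@[fun_prop]
lemma measurable_maxFn {f : T2 → ℝ≥0∞} (hf : Measurable f) : Measurable (maxFn f) := by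
  unfold maxFn
  refine Measurable.iSup fun j => Measurable.const_mul ?_ _
  have h (x : T2) : ∫⁻ y in closedBall x ((2 ^ j : ℝ)⁻¹), f y
      = ∫⁻ y, {q : T2 × T2 | dist q.2 q.1 ≤ (2 ^ j : ℝ)⁻¹}.indicator (fun q => f q.2) (x, y) := by
    rw [← lintegral_indicator measurableSet_closedBall]
    rfl
  simp_rw [h]
  apply Measurable.lintegral_prod_right
  exact (hf.comp measurable_snd).indicator (measurableSet_le (by fun_prop) (by fun_prop))

lemma avg_mono {N j : ℕ} {f g : T2 → ℝ≥0∞} (h : ∀ x, f x ≤ g x) (x : T2) :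
    avg N j f x ≤ avg N j g x := by
  unfold avg; gcongr; exact h _

lemma maxFn_mono {f g : T2 → ℝ≥0∞} (h : ∀ x, f x ≤ g x) (x : T2) : maxFn f x ≤ maxFn g x := by
  unfold maxFn; gcongr; exact h _

lemma avg_const_mul {N j : ℕ} {f : T2 → ℝ≥0∞} (hf : Measurable f) (c : ℝ≥0∞) (x : T2) :
    avg N j (fun y => c * f y) x = c * avg N j f x := by
  unfold avg
  rw [← lintegral_const_mul _ (by fun_prop)]
  congr with y
  ring

lemma avg_finset_sum {N j : ℕ} {ι : Type*} (s : Finset ι) {f : ι → T2 → ℝ≥0∞}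
    (hf : ∀ i, Measurable (f i)) (x : T2) :
    avg N j (fun y => ∑ i ∈ s, f i y) x = ∑ i ∈ s, avg N j (f i) x := by
  unfold avg
  rw [← lintegral_finsetSum _ (fun i _ => by have := hf i; fun_prop)]
  simp_rw [Finset.mul_sum]

lemma avg_add {N j : ℕ} {f g : T2 → ℝ≥0∞} (hf : Measurable f) (x : T2) :
    avg N j (fun y => f y + g y) x = avg N j f x + avg N j g x := by
  unfold avg
  rw [← lintegral_add_left (by fun_prop)]
  simp_rw [mul_add]

lemma lintegral_avg_mul {N j : ℕ} {f g : T2 → ℝ≥0∞} (hf : Measurable f) (hg : Measurable g) :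
    ∫⁻ x, avg N j f x * g x = ∫⁻ x, f x * avg N j g x := by
  have h1 : ∫⁻ x, avg N j f x * g x
      = ∫⁻ x, ∫⁻ y, ENNReal.ofReal (wt N j (x - y)) * f y * g x := by
    congr with x
    unfold avg
    rw [lintegral_mul_const _ (by fun_prop)]
  have h2 : ∫⁻ y, f y * avg N j g y
      = ∫⁻ y, ∫⁻ x, ENNReal.ofReal (wt N j (x - y)) * f y * g x := by
    congr with y
    unfold avg
    rw [← lintegral_const_mul _ (by fun_prop)]
    congr with x
    rw [← wt_neg, neg_sub]
    ring
  rw [h1, h2, lintegral_lintegral_swap]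
  exact (((measurable_avg_kernel N j).mul (hf.comp measurable_snd)).mul
    (hg.comp measurable_fst)).aemeasurable

/-- The weight is dominated by a superposition of normalized balls. -/
lemma wt_le_sum {N : ℕ} (hN : 3 ≤ N) (j : ℕ) (y : T2) :
    wt N j y ≤ 8 * (2 ^ j)⁻¹ * ∑ m ∈ Finset.range (j + 1),
      8 ^ m * (if ‖y‖ ≤ (2 ^ m)⁻¹ then 1 else 0) := by
  have hex : ∃ m, m ≤ j ∧ ‖y‖ ≤ (2 ^ m)⁻¹ ∧ wt N j y ≤ 8 * (2 ^ j)⁻¹ * 8 ^ m := by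
    by_cases h0 : ‖y‖ ≤ (2 ^ j)⁻¹
    · refine ⟨j, le_rfl, h0, (wt_le N j y).trans ?_⟩
      rw [show (8 : ℝ) ^ j = 2 ^ j * 4 ^ j by rw [← mul_pow]; norm_num]
      have : (0 : ℝ) < 4 ^ j := by positivity
      field_simp
      norm_num
    · have hP : ∃ i, i ≤ j ∧ (2 ^ (j - i) : ℝ)⁻¹ ≥ ‖y‖ :=
        ⟨j, le_rfl, by simpa using (norm_le_half y).trans (by norm_num)⟩
      classical
      obtain ⟨hi, hy⟩ := Nat.find_spec hP
      set i := Nat.find hP with hi_def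
      have hi0 : i ≠ 0 := by
        intro h
        rw [h] at hy
        exact h0 (by simpa using hy)
      have hlt : (2 ^ (j - (i - 1)) : ℝ)⁻¹ < ‖y‖ := by
        have := Nat.find_min hP (m := i - 1) (by omega)
        simp only [not_and, ge_iff_le, not_le] at this
        exact this (by omega)
      refine ⟨j - i, by omega, hy, ?_⟩
      unfold wt
      have hji : (2 : ℝ) ^ j = 2 ^ (j - (i - 1)) * 2 ^ (i - 1) := by
        rw [← pow_add]; congr 1; omega
      have hbase : (2 : ℝ) ^ (i - 1) ≤ 1 + 2 ^ j * ‖y‖ := by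
        have : (2 : ℝ) ^ j * (2 ^ (j - (i - 1)))⁻¹ ≤ 2 ^ j * ‖y‖ := by gcongr
        rw [hji] at this
        have h3 : (2 : ℝ) ^ (j - (i - 1)) * 2 ^ (i - 1) * (2 ^ (j - (i - 1)))⁻¹ = 2 ^ (i - 1) := by
          field_simp
        rw [← hji] at this
        rw [hji, h3] at this
        rw [← hji] at this
        linarith
      have h1 : (1 : ℝ) ≤ 1 + 2 ^ j * ‖y‖ := by
        linarith [show 0 ≤ 2 ^ j * ‖y‖ by positivity]
      have hpow : (8 : ℝ) ^ (i - 1) ≤ (1 + 2 ^ j * ‖y‖) ^ N := by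
        calc (8 : ℝ) ^ (i - 1) = (2 ^ (i - 1)) ^ 3 := by
              rw [← pow_mul, mul_comm, pow_mul]; norm_num
          _ ≤ (1 + 2 ^ j * ‖y‖) ^ 3 := by gcongr
          _ ≤ _ := pow_le_pow_right₀ h1 hN
      rw [div_le_iff₀ (by positivity)]
      calc (4 : ℝ) ^ j = 8 * (2 ^ j)⁻¹ * 8 ^ (j - i) * 8 ^ (i - 1) := by
            have e : (8 : ℝ) * 8 ^ (j - i) * 8 ^ (i - 1) = 2 ^ j * 4 ^ j := by
              rw [← mul_pow, mul_assoc, ← pow_add, ← pow_succ']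
              norm_num
              omega
            have h2 : (2 : ℝ) ^ j ≠ 0 := by positivity
            calc (4 : ℝ) ^ j = (2 ^ j)⁻¹ * (2 ^ j * 4 ^ j) := by field_simp
              _ = _ := by rw [← e]; ring
        _ ≤ _ := by gcongr
  obtain ⟨m, hm, hym, hw⟩ := hex
  refine hw.trans ?_
  gcongr
  have := Finset.single_le_sum (f := fun m => (8 : ℝ) ^ m * (if ‖y‖ ≤ (2 ^ m)⁻¹ then 1 else 0))
    (s := Finset.range (j + 1)) (fun i _ => by positivity) (Finset.mem_range.2 (by omega : m < j + 1))
  simpa [hym] using this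

lemma avg_le_maxFn {N : ℕ} (hN : 3 ≤ N) (j : ℕ) {f : T2 → ℝ≥0∞} (hf : Measurable f) (x : T2) :
    avg N j f x ≤ 16 * maxFn f x := by
  have hk (y : T2) : ENNReal.ofReal (wt N j (x - y)) * f y ≤
      ∑ m ∈ Finset.range (j + 1), ENNReal.ofReal (8 * (2 ^ j)⁻¹ * 8 ^ m) *
        (closedBall x ((2 ^ m : ℝ)⁻¹)).indicator f y := by
    have h1 := ENNReal.ofReal_le_ofReal (wt_le_sum hN j (x - y))
    rw [Finset.mul_sum, ENNReal.ofReal_sum_of_nonneg (fun i _ => by positivity)] at h1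
    refine (mul_le_mul_left h1 _).trans ?_
    rw [Finset.sum_mul]
    refine Finset.sum_le_sum fun m _ => ?_
    by_cases hm : ‖x - y‖ ≤ (2 ^ m)⁻¹
    · have : y ∈ closedBall x ((2 ^ m : ℝ)⁻¹) := by
        rwa [mem_closedBall', dist_eq_norm]
      simp [hm, this]
    · simp [hm]
  calc avg N j f x ≤ ∫⁻ y, ∑ m ∈ Finset.range (j + 1), ENNReal.ofReal (8 * (2 ^ j)⁻¹ * 8 ^ m) *
        (closedBall x ((2 ^ m : ℝ)⁻¹)).indicator f y := lintegral_mono hk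
    _ = ∑ m ∈ Finset.range (j + 1), ENNReal.ofReal (8 * (2 ^ j)⁻¹ * 8 ^ m) *
        ∫⁻ y in closedBall x ((2 ^ m : ℝ)⁻¹), f y := by
        rw [lintegral_finsetSum _ fun m _ =>
          (hf.indicator measurableSet_closedBall).const_mul _]
        refine Finset.sum_congr rfl fun m _ => ?_
        rw [lintegral_const_mul _ (hf.indicator measurableSet_closedBall),
          lintegral_indicator measurableSet_closedBall]
    _ ≤ ∑ m ∈ Finset.range (j + 1), ENNReal.ofReal (8 * (2 ^ j)⁻¹ * 2 ^ m) * maxFn f x := by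
        refine Finset.sum_le_sum fun m _ => ?_
        have h8 : (8 : ℝ) * (2 ^ j)⁻¹ * 8 ^ m = 8 * (2 ^ j)⁻¹ * 2 ^ m * 4 ^ m := by
          rw [mul_assoc _ ((2 : ℝ) ^ m), ← mul_pow]; norm_num
        rw [h8, ENNReal.ofReal_mul (by positivity), mul_assoc]
        gcongr
        refine le_trans (le_of_eq ?_)
          (le_iSup (fun m : ℕ => 4 ^ m * ∫⁻ y in closedBall x ((2 ^ m : ℝ)⁻¹), f y) m)
        rw [ENNReal.ofReal_pow (by norm_num)]
        norm_num
    _ ≤ 16 * maxFn f x := by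
        rw [← Finset.sum_mul, ← ENNReal.ofReal_sum_of_nonneg (fun i _ => by positivity),
          ← Finset.mul_sum]
        gcongr
        rw [show (16 : ℝ≥0∞) = ENNReal.ofReal 16 by norm_num]
        apply ENNReal.ofReal_le_ofReal
        have h2 : (0 : ℝ) < 2 ^ j := by positivity
        rw [geom_sum_eq (by norm_num), pow_succ, mul_assoc]
        calc (8 : ℝ) * ((2 ^ j)⁻¹ * ((2 ^ j * 2 - 1) / (2 - 1)))
            ≤ 8 * ((2 ^ j)⁻¹ * (2 ^ j * 2 / (2 - 1))) := by
              gcongr; linarith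
          _ = 16 := by field_simp; norm_num

lemma maxFn_le_of_le {f : T2 → ℝ≥0∞} {B : ℝ≥0∞} (h : ∀ x, f x ≤ B) (x : T2) :
    maxFn f x ≤ 4 * B := by
  refine iSup_le fun j => ?_
  calc 4 ^ j * ∫⁻ y in closedBall x ((2 ^ j : ℝ)⁻¹), f y
      ≤ 4 ^ j * (B * volume (closedBall x ((2 ^ j : ℝ)⁻¹))) := by
        gcongr
        rw [← setLIntegral_const]
        exact lintegral_mono h
    _ ≤ 4 ^ j * (B * ENNReal.ofReal (4 * ((2 ^ j : ℝ)⁻¹) ^ 2)) := by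
        gcongr
        exact volume_closedBall_le _ _ (by positivity)
    _ = 4 * B := by
        have h4 : ENNReal.ofReal (4 * ((2 ^ j : ℝ)⁻¹) ^ 2) = 4 * (4 ^ j)⁻¹ := by
          rw [inv_pow, ← pow_mul, mul_comm j, pow_mul, ENNReal.ofReal_mul (by norm_num),
            ENNReal.ofReal_inv_of_pos (by positivity), ENNReal.ofReal_pow (by positivity)]
          norm_num
        rw [h4]
        calc (4 : ℝ≥0∞) ^ j * (B * (4 * (4 ^ j)⁻¹)) = (4 ^ j * (4 ^ j)⁻¹) * (4 * B) := by ring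
          _ = 4 * B := by
            rw [ENNReal.mul_inv_cancel (by positivity) (by finiteness), one_mul]

lemma maxFn_add_le {f g : T2 → ℝ≥0∞} (hf : Measurable f) (x : T2) :
    maxFn (fun y => f y + g y) x ≤ maxFn f x + maxFn g x := by
  refine iSup_le fun j => ?_
  rw [lintegral_add_left hf, mul_add]
  exact add_le_add (le_iSup (fun j : ℕ => 4 ^ j * ∫⁻ y in closedBall x ((2 ^ j : ℝ)⁻¹), f y) j)
    (le_iSup (fun j : ℕ => 4 ^ j * ∫⁻ y in closedBall x ((2 ^ j : ℝ)⁻¹), g y) j)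

/-- The weak type (1,1) bound for the maximal function. -/
lemma mul_volume_lt_maxFn_le {f : T2 → ℝ≥0∞} (t : ℝ≥0∞) :
    t * volume {x | t < maxFn f x} ≤ 100 * ∫⁻ x, f x := by
  have hE (x : {x | t < maxFn f x}) :
      ∃ j : ℕ, t < 4 ^ j * ∫⁻ y in closedBall x.1 ((2 ^ j : ℝ)⁻¹), f y := lt_iSup_iff.1 x.2
  choose s hs using hE
  obtain ⟨u, -, hdisj, hcov⟩ := Vitali.exists_disjoint_subfamily_covering_enlargement_closedBall
    univ (fun x : {x | t < maxFn f x} => x.1) (fun x => (2 ^ s x : ℝ)⁻¹) 1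
    (fun x _ => inv_le_one_of_one_le₀ (one_le_pow₀ (by norm_num))) 5 (by norm_num)
  have hu : u.Countable := by
    apply hdisj.countable_of_nonempty_interior
    intro x _
    refine ⟨x.1, interior_mono ball_subset_closedBall ?_⟩
    rw [isOpen_ball.interior_eq]
    exact mem_ball_self (by positivity)
  have hsub : {x | t < maxFn f x} ⊆ ⋃ b ∈ u, closedBall b.1 (5 * (2 ^ s b : ℝ)⁻¹) := by
    intro x hx
    obtain ⟨b, hb, h⟩ := hcov ⟨x, hx⟩ (mem_univ _)
    exact mem_biUnion hb (h (mem_closedBall_self (by positivity)))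
  calc t * volume {x | t < maxFn f x}
      ≤ t * ∑' b : u, volume (closedBall b.1.1 (5 * (2 ^ s b.1 : ℝ)⁻¹)) := by
        gcongr
        exact (measure_mono hsub).trans (measure_biUnion_le _ hu _)
    _ = ∑' b : u, t * volume (closedBall b.1.1 (5 * (2 ^ s b.1 : ℝ)⁻¹)) :=
        ENNReal.tsum_mul_left.symm
    _ ≤ ∑' b : u, 100 * ∫⁻ y in closedBall b.1.1 ((2 ^ s b.1 : ℝ)⁻¹), f y := by
        refine ENNReal.tsum_le_tsum fun b => ?_
        have h4 : ENNReal.ofReal (4 * (5 * (2 ^ s b.1 : ℝ)⁻¹) ^ 2) = 100 * (4 ^ s b.1)⁻¹ := by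
          rw [mul_pow, inv_pow, ← pow_mul, mul_comm (s b.1), pow_mul, ← mul_assoc,
            ENNReal.ofReal_mul (by norm_num),
            ENNReal.ofReal_inv_of_pos (by positivity), ENNReal.ofReal_pow (by positivity)]
          norm_num
        calc t * volume (closedBall b.1.1 (5 * (2 ^ s b.1 : ℝ)⁻¹))
            ≤ (4 ^ s b.1 * ∫⁻ y in closedBall b.1.1 ((2 ^ s b.1 : ℝ)⁻¹), f y)
              * (100 * (4 ^ s b.1)⁻¹) := by
              rw [← h4]
              gcongr
              · exact (hs b.1).le
              · exact volume_closedBall_le _ _ (by positivity)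
          _ = (4 ^ s b.1 * (4 ^ s b.1)⁻¹)
              * (100 * ∫⁻ y in closedBall b.1.1 ((2 ^ s b.1 : ℝ)⁻¹), f y) := by ring
          _ = _ := by rw [ENNReal.mul_inv_cancel (by positivity) (by finiteness), one_mul]
    _ = 100 * ∫⁻ y in ⋃ b ∈ u, closedBall b.1 ((2 ^ s b : ℝ)⁻¹), f y := by
        rw [ENNReal.tsum_mul_left, lintegral_biUnion hu (fun _ _ => measurableSet_closedBall) hdisj]
    _ ≤ 100 * ∫⁻ x, f x := by
        gcongr
        exact Measure.restrict_le_self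

lemma exists_tsum_zpow_lt_le {s : ℝ} (hs : 0 < s) : ∃ C : ℝ≥0, ∀ x : ℝ≥0∞,
    ∑' m : ℤ, (if (2 : ℝ≥0∞) ^ m < x then ((2 : ℝ≥0∞) ^ m) ^ s else 0) ≤ C * x ^ s := by
  set r : ℝ≥0∞ := (2 ^ s)⁻¹ with hr
  have hr1 : r < 1 := by
    rw [hr, ENNReal.inv_lt_one]
    exact ENNReal.one_lt_rpow (by norm_num) hs
  have hC : (1 - r)⁻¹ ≠ ⊤ := by
    rw [Ne, ENNReal.inv_eq_top]
    exact (tsub_pos_of_lt hr1).ne'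
  refine ⟨(1 - r)⁻¹.toNNReal + 1, fun x => ?_⟩
  rcases eq_or_ne x 0 with rfl | h0
  · simp
  rcases eq_or_ne x ⊤ with rfl | ht
  · rw [ENNReal.top_rpow_of_pos hs, ENNReal.mul_top]
    · exact le_top
    · simp
  obtain ⟨M, hM1, hM2⟩ := ENNReal.exists_mem_Ioc_zpow h0 ht (y := 2) (by norm_num) (by norm_num)
  have hinj : Function.Injective (fun i : ℕ => M - i) := fun a b h => by simpa using h
  rw [← hinj.tsum_eq]
  · calc ∑' i : ℕ, (if (2 : ℝ≥0∞) ^ (M - i) < x then ((2 : ℝ≥0∞) ^ (M - i)) ^ s else 0)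
        ≤ ∑' i : ℕ, x ^ s * r ^ i := by
          refine ENNReal.tsum_le_tsum fun i => ?_
          split_ifs
          · have : ((2 : ℝ≥0∞) ^ (M - i)) ^ s = ((2 : ℝ≥0∞) ^ M) ^ s * r ^ i := by
              rw [ENNReal.zpow_sub (by norm_num) (by norm_num),
                ENNReal.mul_rpow_of_nonneg _ _ hs.le, ENNReal.inv_rpow, zpow_natCast, hr,
                ← ENNReal.inv_pow, ← ENNReal.rpow_natCast, ← ENNReal.rpow_natCast,
                ← ENNReal.rpow_mul, ← ENNReal.rpow_mul, mul_comm s]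
            rw [this]
            gcongr
          · exact zero_le
      _ = x ^ s * (1 - r)⁻¹ := by rw [ENNReal.tsum_mul_left, ENNReal.tsum_geometric]
      _ ≤ _ := by
          rw [mul_comm]
          gcongr
          push_cast
          rw [ENNReal.coe_toNNReal hC]
          exact le_self_add
  · intro m hm
    have hlt : (2 : ℝ≥0∞) ^ m < x := by
      by_contra h
      simp [h] at hm
    have : m ≤ M := by
      by_contra! h
      exact absurd (hM2.trans (ENNReal.zpow_le_of_le (by norm_num) (by omega : M + 1 ≤ m)))
        (not_le.2 hlt)
    exact ⟨(M - m).toNat, by simp; omega⟩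

lemma exists_zpow_lt_le {x : ℝ≥0∞} (h0 : x ≠ 0) (hx : x ≠ ⊤) :
    ∃ m : ℤ, (2 : ℝ≥0∞) ^ m < x ∧ x ≤ 2 * 2 ^ m := by
  obtain ⟨m, h1, h2⟩ := ENNReal.exists_mem_Ioc_zpow h0 hx (y := 2) (by norm_num) (by norm_num)
  refine ⟨m, h1, h2.trans_eq ?_⟩
  rw [ENNReal.zpow_add (by norm_num) (by norm_num), zpow_one, mul_comm]

/-- The strong type maximal inequality for bounded functions. -/
lemma exists_lintegral_maxFn_rpow_le {p : ℝ} (hp : 1 < p) : ∃ C : ℝ≥0, ∀ f : T2 → ℝ≥0∞,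
    Measurable f → (∃ B : ℝ≥0, ∀ x, f x ≤ B) →
    ∫⁻ x, maxFn f x ^ p ≤ C * ∫⁻ x, f x ^ p := by
  obtain ⟨C, hC⟩ := exists_tsum_zpow_lt_le (sub_pos.2 hp)
  have h2p : (2 : ℝ≥0∞) ^ p ≠ ⊤ := by simp
  have h8p : (8 : ℝ≥0∞) ^ (p - 1) ≠ ⊤ := by simp
  refine ⟨(2 ^ p * 200 * (C * 8 ^ (p - 1)) : ℝ≥0∞).toNNReal, fun f hf ⟨B, hB⟩ => ?_⟩
  rw [ENNReal.coe_toNNReal (by finiteness)]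
  have hlevel (c : ℝ≥0∞) (hc0 : c ≠ 0) (hct : c ≠ ⊤) :
      (2 * c) ^ p * volume {x | c < maxFn f x}
        ≤ 2 ^ p * 200 * ∫⁻ x, f x * (if c < 8 * f x then c ^ (p - 1) else 0) := by
    set g : T2 → ℝ≥0∞ := {x | c < 8 * f x}.indicator f with hg
    have hset : MeasurableSet {x | c < 8 * f x} := measurableSet_lt (by fun_prop) (by fun_prop)
    have hgm : Measurable g := hf.indicator hset
    have hsub : {x | c < maxFn f x} ⊆ {x | c / 2 < maxFn g x} := by
      intro x hx
      have h1 : maxFn f x ≤ maxFn g x + c / 2 := by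
        calc maxFn f x ≤ maxFn (fun y => g y + c / 8) x := by
              refine maxFn_mono (fun y => ?_) x
              by_cases hy : c < 8 * f y
              · simp [hg, hy]
              · simp only [hg, indicator, mem_ofPred_eq, hy, if_false, zero_add]
                rw [ENNReal.le_div_iff_mul_le (by simp) (by simp), mul_comm]
                exact not_lt.1 hy
          _ ≤ maxFn g x + maxFn (fun _ => c / 8) x := maxFn_add_le hgm x
          _ ≤ maxFn g x + 4 * (c / 8) := by
              gcongr
              exact maxFn_le_of_le (fun _ => le_rfl) x
          _ = maxFn g x + c / 2 := by
              congr 1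
              rw [← mul_div_assoc, show (8 : ℝ≥0∞) = 4 * 2 by norm_num,
                ENNReal.mul_div_mul_left _ _ (by norm_num) (by norm_num)]
      have h2 : c / 2 + c / 2 < maxFn g x + c / 2 := by
        rw [ENNReal.add_halves]
        exact lt_of_lt_of_le hx h1
      exact lt_of_add_lt_add_right h2
    have hcp : c ^ p = c ^ (p - 1) * c := by
      rw [ENNReal.rpow_sub _ _ hc0 hct, ENNReal.rpow_one, ENNReal.div_mul_cancel hc0 hct]
    calc (2 * c) ^ p * volume {x | c < maxFn f x}
        ≤ (2 * c) ^ p * volume {x | c / 2 < maxFn g x} := by gcongr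
      _ = 2 ^ p * 2 * c ^ (p - 1) * (c / 2 * volume {x | c / 2 < maxFn g x}) := by
          rw [ENNReal.mul_rpow_of_nonneg _ _ (by linarith), hcp]
          nth_rewrite 2 [← ENNReal.mul_div_cancel (a := 2) (b := c) (by norm_num) (by norm_num)]
          ring
      _ ≤ 2 ^ p * 2 * c ^ (p - 1) * (100 * ∫⁻ x, g x) := by
          exact mul_le_mul_right (mul_volume_lt_maxFn_le _) _
      _ = 2 ^ p * 200 * ∫⁻ x, c ^ (p - 1) * g x := by
          rw [lintegral_const_mul _ hgm]
          ring
      _ = _ := by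
          congr 2 with x
          by_cases hx : c < 8 * f x
          · simp only [hg, indicator, mem_ofPred_eq, hx, if_true]
            exact mul_comm _ _
          · simp [hg, hx]
  have hpt (x : T2) : maxFn f x ^ p ≤
      ∑' m : ℤ, {x | (2 : ℝ≥0∞) ^ m < maxFn f x}.indicator (fun _ => (2 * 2 ^ m) ^ p) x := by
    rcases eq_or_ne (maxFn f x) 0 with h0 | h0
    · rw [h0, ENNReal.zero_rpow_of_pos (by linarith)]
      exact zero_le
    have ht : maxFn f x ≠ ⊤ := ne_top_of_le_ne_top (by finiteness) (maxFn_le_of_le hB x)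
    obtain ⟨m, h1, h2⟩ := exists_zpow_lt_le h0 ht
    refine le_trans ?_ (ENNReal.le_tsum m)
    simp only [indicator, mem_ofPred_eq, h1, if_true]
    exact ENNReal.rpow_le_rpow h2 (by linarith)
  have hms (m : ℤ) : MeasurableSet {x | (2 : ℝ≥0∞) ^ m < maxFn f x} :=
    measurableSet_lt measurable_const (measurable_maxFn hf)
  calc ∫⁻ x, maxFn f x ^ p
      ≤ ∫⁻ x, ∑' m : ℤ, {x | (2 : ℝ≥0∞) ^ m < maxFn f x}.indicator (fun _ => (2 * 2 ^ m) ^ p) x :=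
        lintegral_mono hpt
    _ = ∑' m : ℤ, (2 * 2 ^ m) ^ p * volume {x | (2 : ℝ≥0∞) ^ m < maxFn f x} := by
        rw [lintegral_tsum fun m => (measurable_const.indicator (hms m)).aemeasurable]
        simp_rw [lintegral_indicator_const (hms _)]
    _ ≤ ∑' m : ℤ, 2 ^ p * 200 *
        ∫⁻ x, f x * (if 2 ^ m < 8 * f x then ((2 : ℝ≥0∞) ^ m) ^ (p - 1) else 0) :=
        ENNReal.tsum_le_tsum fun m =>
          hlevel _ (ENNReal.zpow_pos (by norm_num) (by norm_num) m).ne'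
            (ENNReal.zpow_ne_top (by norm_num) (by norm_num) m)
    _ = 2 ^ p * 200 * ∫⁻ x, f x *
        ∑' m : ℤ, (if 2 ^ m < 8 * f x then ((2 : ℝ≥0∞) ^ m) ^ (p - 1) else 0) := by
        rw [ENNReal.tsum_mul_left, ← lintegral_tsum]
        · simp_rw [ENNReal.tsum_mul_left]
        · intro m
          exact (hf.mul (Measurable.ite (measurableSet_lt (by fun_prop) (by fun_prop))
            measurable_const measurable_const)).aemeasurable
    _ ≤ 2 ^ p * 200 * ∫⁻ x, (C * 8 ^ (p - 1)) * f x ^ p := by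
        gcongr 2 ^ p * 200 * ?_
        refine lintegral_mono fun x => ?_
        calc f x * ∑' m : ℤ, (if 2 ^ m < 8 * f x then ((2 : ℝ≥0∞) ^ m) ^ (p - 1) else 0)
            ≤ f x * (C * (8 * f x) ^ (p - 1)) := by
              gcongr
              exact hC _
          _ = (C * 8 ^ (p - 1)) * (f x ^ (1 : ℝ) * f x ^ (p - 1)) := by
              rw [ENNReal.mul_rpow_of_nonneg _ _ (by linarith), ENNReal.rpow_one]
              ring
          _ = _ := by
              rw [← ENNReal.rpow_add_of_nonneg _ _ (by norm_num) (by linarith), add_sub_cancel]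
    _ = _ := by
        rw [lintegral_const_mul _ (by fun_prop)]
        ring

variable {ι : Type*} [Fintype ι]

/-- The point of `(ℝ²)^ι` given by a tuple of integer frequencies. -/
def lat (n : ι → ℤ × ℤ) : ι → ℝ × ℝ := fun i => (((n i).1 : ℝ), ((n i).2 : ℝ))

/-- The integral kernel of the multilinear multiplier with symbol `s`. -/
def ker (s : (ι → ℝ × ℝ) → ℂ) (y : ι → T2) : ℂ :=
  ∑' n : ι → ℤ × ℤ, s (lat n) * ∏ i, fChar (n i) (y i)

lemma fChar_add (m n : ℤ × ℤ) (x : T2) : fChar (m + n) x = fChar m x * fChar n x := by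
  simp only [fChar, Prod.fst_add, Prod.snd_add, fourier_add]
  ring

@[simp]
lemma fChar_zero (x : T2) : fChar 0 x = 1 := by simp [fChar]

@[simp]
lemma norm_fChar (n : ℤ × ℤ) (x : T2) : ‖fChar n x‖ = 1 := by
  simp [fChar, fourier_apply, Circle.norm_coe]

lemma fChar_neg_mul (n : ℤ × ℤ) (x : T2) : fChar (-n) x * fChar n x = 1 := by
  rw [← fChar_add, neg_add_cancel, fChar_zero]

lemma fChar_sub_arg (n : ℤ × ℤ) (x y : T2) :
    fChar n (x - y) = fChar n x * fChar (-n) y := by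
  have fa (m : ℤ) (a b : AddCircle (1 : ℝ)) : fourier m (a + b) = fourier m a * fourier m b := by
    rw [fourier_apply, smul_add, AddCircle.toCircle_add]
    rfl
  have h : fChar n x = fChar n (x - y) * fChar n y := by
    nth_rewrite 1 [← sub_add_cancel x y]
    simp only [fChar, Prod.fst_add, Prod.snd_add, fa]
    ring
  rw [h, mul_assoc, mul_comm (fChar n y), fChar_neg_mul, mul_one]

@[fun_prop]
lemma continuous_fChar (n : ℤ × ℤ) : Continuous (fChar n) := by
  unfold fChar
  fun_prop

lemma norm_le_norm_fourier_sub_one (t : AddCircle (1 : ℝ)) : ‖t‖ ≤ ‖fourier 1 t - 1‖ := by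
  obtain ⟨x, rfl⟩ := QuotientAddGroup.mk_surjective t
  set r : ℝ := x - round x
  have hr : ((x : ℝ) : AddCircle (1 : ℝ)) = (r : AddCircle (1 : ℝ)) := by
    rw [AddCircle.coe_sub]
    have : ((round x : ℝ) : AddCircle (1 : ℝ)) = 0 := by
      rw [AddCircle.coe_eq_zero_iff]
      exact ⟨round x, by simp⟩
    rw [this, sub_zero]
  have hr2 : |r| ≤ 1 / 2 := abs_sub_round x
  have hn : ‖((x : ℝ) : AddCircle (1 : ℝ))‖ = |r| := UnitAddCircle.norm_eq
  have he : fourier 1 ((x : ℝ) : AddCircle (1 : ℝ))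
      = Complex.exp (Complex.I * ((2 * π * r : ℝ) : ℂ)) := by
    rw [hr, fourier_coe_apply]
    congr 1
    push_cast
    ring
  change ‖((x : ℝ) : AddCircle (1 : ℝ))‖ ≤ ‖fourier 1 ((x : ℝ) : AddCircle (1 : ℝ)) - 1‖
  rw [hn, he, Complex.norm_exp_I_mul_ofReal_sub_one, Real.norm_eq_abs, abs_mul,
    show 2 * π * r / 2 = π * r by ring]
  have h1 : |sin (π * r)| = sin (π * |r|) := by
    rcases abs_cases r with ⟨h, h0⟩ | ⟨h, h0⟩
    · rw [h, abs_of_nonneg]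
      exact sin_nonneg_of_nonneg_of_le_pi (by positivity) (by nlinarith [pi_pos])
    · rw [h, mul_neg, sin_neg, abs_of_nonpos]
      exact sin_nonpos_of_nonpos_of_neg_pi_le (by nlinarith [pi_pos]) (by nlinarith [pi_pos])
  rw [h1, abs_two]
  have h2 := mul_le_sin (x := π * |r|) (by positivity) (by nlinarith [pi_pos])
  have h3 : 2 / π * (π * |r|) = 2 * |r| := by field_simp
  linarith [abs_nonneg r]

lemma norm_iteratedFDeriv_shift_sub_le {E F : Type*} [NormedAddCommGroup E] [NormedSpace ℝ E]
    [NormedAddCommGroup F] [NormedSpace ℝ F] {s : E → F} (hs : ContDiff ℝ (⊤ : ℕ∞) s) (m : ℕ)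
    {A : ℝ} (hA : ∀ ξ, ‖iteratedFDeriv ℝ (m + 1) s ξ‖ ≤ A) (v ξ : E) :
    ‖iteratedFDeriv ℝ m (fun η => s (η - v) - s η) ξ‖ ≤ A * ‖v‖ := by
  have hsm : ContDiff ℝ m s := hs.of_le (by exact_mod_cast le_top)
  have h1 : iteratedFDeriv ℝ m (fun η => s (η - v) - s η) ξ
      = iteratedFDeriv ℝ m s (ξ - v) - iteratedFDeriv ℝ m s ξ := by
    rw [← iteratedFDeriv_comp_sub]
    exact iteratedFDeriv_sub_apply (f := fun η => s (η - v)) (g := s)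
      (hsm.comp (contDiff_id.sub contDiff_const)).contDiffAt hsm.contDiffAt
  have h2 := convex_univ.norm_image_sub_le_of_norm_fderiv_le (𝕜 := ℝ) (f := iteratedFDeriv ℝ m s)
    (C := A) (x := ξ) (y := ξ - v)
    (fun x _ => hs.differentiable_iteratedFDeriv (by exact_mod_cast ENat.natCast_lt_top m) x)
    (fun x _ => by rw [norm_fderiv_iteratedFDeriv]; exact hA x) (mem_univ _) (mem_univ _)
  rw [h1]
  simpa using h2

open Classical in
/-- The tuples of frequencies of size at most `R`. -/
def box (ι : Type*) [Fintype ι] (R : ℝ) : Finset (ι → ℤ × ℤ) :=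
  Fintype.piFinset fun _ => Finset.Icc (-⌊R⌋) ⌊R⌋ ×ˢ Finset.Icc (-⌊R⌋) ⌊R⌋

lemma mem_box {R : ℝ} {n : ι → ℤ × ℤ} (h : ‖lat n‖ ≤ R) : n ∈ box ι R := by
  classical
  rw [box, Fintype.mem_piFinset]
  intro i
  have hi := (norm_le_pi_norm (lat n) i).trans h
  have h1 := (norm_fst_le _).trans hi
  have h2 := (norm_snd_le _).trans hi
  simp only [lat, Real.norm_eq_abs] at h1 h2
  rw [abs_le] at h1 h2
  simp only [Finset.mem_product, Finset.mem_Icc, neg_le, Int.le_floor]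
  push_cast
  exact ⟨⟨by linarith, h1.2⟩, by linarith, h2.2⟩

lemma card_box_le {R : ℝ} (hR : 0 ≤ R) :
    ((box ι R).card : ℝ) ≤ (2 * R + 1) ^ (2 * Fintype.card ι) := by
  have hfl : (0 : ℤ) ≤ ⌊R⌋ := Int.floor_nonneg.2 hR
  classical
  have h1 : (box ι R).card = ((2 * ⌊R⌋ + 1).toNat) ^ (2 * Fintype.card ι) := by
    rw [box, Fintype.card_piFinset, Finset.prod_const, Finset.card_univ,
      Finset.card_product, Int.card_Icc, ← sq, ← pow_mul]
    congr 2
    omega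
  rw [h1, Nat.cast_pow]
  gcongr
  have h2 : (((2 * ⌊R⌋ + 1).toNat : ℤ) : ℝ) = ((2 * ⌊R⌋ + 1 : ℤ) : ℝ) := by
    rw [Int.toNat_of_nonneg (by omega)]
  rw [Int.cast_natCast] at h2
  rw [h2]
  push_cast
  linarith [Int.floor_le R]

lemma hasFiniteSupport_of_large {s : (ι → ℝ × ℝ) → ℂ} {R : ℝ} (hs : ∀ ξ, R ≤ ‖ξ‖ → s ξ = 0)
    (φ : (ι → ℤ × ℤ) → ℂ) : Function.HasFiniteSupport fun n => s (lat n) * φ n := by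
  refine (box ι R).finite_toSet.subset fun n hn => mem_box ?_
  by_contra! h
  exact hn (by simp [hs _ h.le])

lemma norm_ker_le {s : (ι → ℝ × ℝ) → ℂ} {R A : ℝ} (hR : 0 ≤ R) (hs : ∀ ξ, R ≤ ‖ξ‖ → s ξ = 0)
    (hA : ∀ ξ, ‖s ξ‖ ≤ A) (y : ι → T2) :
    ‖ker s y‖ ≤ A * (2 * R + 1) ^ (2 * Fintype.card ι) := by
  have hA0 : 0 ≤ A := (norm_nonneg _).trans (hA 0)
  rw [ker, tsum_eq_sum (s := box ι R)]
  · calc ‖∑ n ∈ box ι R, s (lat n) * ∏ i, fChar (n i) (y i)‖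
        ≤ ∑ n ∈ box ι R, A := by
          refine norm_sum_le_of_le _ fun n _ => ?_
          rw [norm_mul, norm_prod]
          simpa using hA _
      _ = A * (box ι R).card := by rw [Finset.sum_const, nsmul_eq_mul, mul_comm]
      _ ≤ _ := by
          gcongr
          exact card_box_le hR
  · intro n hn
    have : R ≤ ‖lat n‖ := by
      by_contra! h
      exact hn (mem_box h.le)
    simp [hs _ this]

lemma lat_sub {ι : Type*} (m n : ι → ℤ × ℤ) : lat (m - n) = lat m - lat n := by
  ext i <;> simp [lat]

/-- Multiplying the kernel by `e_u - 1` in one variable is a difference operator on the symbol. -/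
lemma sub_one_mul_ker {s : (ι → ℝ × ℝ) → ℂ} {R : ℝ} (hs : ∀ ξ, R ≤ ‖ξ‖ → s ξ = 0) (i : ι)
    [DecidableEq ι] (u : ℤ × ℤ) (y : ι → T2) :
    (fChar u (y i) - 1) * ker s y
      = ker (fun ξ => s (ξ - lat (Pi.single i u)) - s ξ) y := by
  have hsum (n : ι → ℤ × ℤ) : ∏ m, fChar ((n + (Pi.single i u : ι → ℤ × ℤ)) m) (y m)
      = fChar u (y i) * ∏ m, fChar (n m) (y m) := by
    have h1 : ∏ m, fChar ((Pi.single i u : ι → ℤ × ℤ) m) (y m) = fChar u (y i) := by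
      rw [Fintype.prod_eq_single i]
      · simp
      · intro m hm
        simp [hm]
    simp_rw [Pi.add_apply, fChar_add, Finset.prod_mul_distrib, h1, mul_comm]
  have h1 : fChar u (y i) * ker s y
      = ∑' n : ι → ℤ × ℤ, s (lat n - lat (Pi.single i u)) * ∏ m, fChar (n m) (y m) := by
    rw [← (Equiv.addRight (Pi.single i u : ι → ℤ × ℤ)).tsum_eq, ker, ← tsum_mul_left]
    congr with n
    rw [Equiv.coe_addRight, hsum, ← lat_sub, add_sub_cancel_right]
    ring
  have hs' : ∀ ξ, R + ‖lat (Pi.single i u)‖ ≤ ‖ξ‖ → s (ξ - lat (Pi.single i u)) = 0 := by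
    intro ξ hξ
    exact hs _ (by linarith [norm_sub_norm_le ξ (lat (Pi.single i u))])
  rw [sub_mul, h1, one_mul, ker, ker, ← Summable.tsum_sub]
  · simp_rw [sub_mul]
  · exact summable_of_hasFiniteSupport
      (hasFiniteSupport_of_large (s := fun ξ => s (ξ - lat (Pi.single i u))) hs' _)
  · exact summable_of_hasFiniteSupport (hasFiniteSupport_of_large hs _)

lemma norm_sub_one_pow_mul_ker_le (i : ι) {u : ℤ × ℤ} (hu : ‖((u.1 : ℝ), (u.2 : ℝ))‖ ≤ 1)
    (y : ι → T2) (M : ℕ) : ∀ {s : (ι → ℝ × ℝ) → ℂ}, ContDiff ℝ (⊤ : ℕ∞) s → ∀ {R A : ℝ}, 0 ≤ R →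
    (∀ ξ, R ≤ ‖ξ‖ → s ξ = 0) → (∀ ξ, ‖iteratedFDeriv ℝ M s ξ‖ ≤ A) →
    ‖fChar u (y i) - 1‖ ^ M * ‖ker s y‖ ≤ A * (2 * (R + M) + 1) ^ (2 * Fintype.card ι) := by
  classical
  induction M with
  | zero =>
    intro s _ R A hR hs hA
    simpa using norm_ker_le hR hs (by simpa using hA) y
  | succ M ih =>
    intro s hsm R A hR hs hA
    set v : ι → ℝ × ℝ := lat (Pi.single i u) with hv
    have hv1 : ‖v‖ ≤ 1 := by
      rw [pi_norm_le_iff_of_nonneg zero_le_one]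
      intro m
      by_cases hm : m = i
      · subst hm
        simpa [hv, lat] using hu
      · simp [hv, lat, hm]
    have hA0 : 0 ≤ A := (norm_nonneg _).trans (hA 0)
    have h := ih (s := fun ξ => s (ξ - v) - s ξ)
      ((hsm.comp (contDiff_id.sub contDiff_const)).sub hsm) (R := R + 1) (A := A) (by linarith)
      (fun ξ hξ => by
        rw [hs ξ (by linarith), hs (ξ - v) (by linarith [norm_sub_norm_le ξ v]), sub_zero])
      (fun ξ => (norm_iteratedFDeriv_shift_sub_le hsm M hA v ξ).trans
        (mul_le_of_le_one_right hA0 hv1))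
    rw [← sub_one_mul_ker hs i u y, norm_mul] at h
    calc ‖fChar u (y i) - 1‖ ^ (M + 1) * ‖ker s y‖
        = ‖fChar u (y i) - 1‖ ^ M * (‖fChar u (y i) - 1‖ * ‖ker s y‖) := by ring
      _ ≤ _ := h
      _ = _ := by push_cast; ring_nf

lemma norm_pow_mul_ker_le {s : (ι → ℝ × ℝ) → ℂ} (hsm : ContDiff ℝ (⊤ : ℕ∞) s) {R A : ℝ}
    (hR : 0 ≤ R) (hs : ∀ ξ, R ≤ ‖ξ‖ → s ξ = 0) (i : ι) (y : ι → T2) {M : ℕ}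
    (hA : ∀ ξ, ‖iteratedFDeriv ℝ M s ξ‖ ≤ A) :
    ‖y i‖ ^ M * ‖ker s y‖ ≤ A * (2 * (R + M) + 1) ^ (2 * Fintype.card ι) := by
  have h : ∃ u : ℤ × ℤ, ‖((u.1 : ℝ), (u.2 : ℝ))‖ ≤ 1 ∧ ‖y i‖ ≤ ‖fChar u (y i) - 1‖ := by
    rcases le_total ‖(y i).1‖ ‖(y i).2‖ with h | h
    · refine ⟨(0, 1), by simp [Prod.norm_def], ?_⟩
      rw [Prod.norm_def, max_eq_right h]
      simpa [fChar] using norm_le_norm_fourier_sub_one (y i).2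
    · refine ⟨(1, 0), by simp [Prod.norm_def], ?_⟩
      rw [Prod.norm_def, max_eq_left h]
      simpa [fChar] using norm_le_norm_fourier_sub_one (y i).1
  obtain ⟨u, hu, hy⟩ := h
  refine le_trans ?_ (norm_sub_one_pow_mul_ker_le i hu y M hsm hR hs hA)
  gcongr

/-- Kernels of smooth symbols adapted to the frequency scale `2^j` decay at the scale `2^{-j}`. -/
lemma exists_norm_ker_le_prod_wt (ι : Type*) [Fintype ι] (N : ℕ) {C : ℝ} (hC : 0 ≤ C)
    (B : ℕ → ℝ) :
    ∃ C' : ℝ, 0 ≤ C' ∧ ∀ (j : ℕ) (s : (ι → ℝ × ℝ) → ℂ), ContDiff ℝ (⊤ : ℕ∞) s →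
      (∀ ξ, C * 2 ^ j ≤ ‖ξ‖ → s ξ = 0) →
      (∀ m ξ, ‖iteratedFDeriv ℝ m s ξ‖ ≤ B m * ((2 ^ j)⁻¹) ^ m) →
      ∀ y, ‖ker s y‖ ≤ C' * ∏ i, wt N j (y i) := by
  set K := Fintype.card ι with hK
  set M := N * K with hM
  set D := 2 * (C + M) + 1 with hD
  have hD0 : 0 ≤ D := by positivity
  refine ⟨2 ^ M * ((|B 0| + |B M|) * D ^ (2 * K)), by positivity, fun j s hsm hs hder y => ?_⟩
  have h2j : (1 : ℝ) ≤ 2 ^ j := one_le_pow₀ (by norm_num)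
  have hX {L : ℕ} (hL : L ≤ M) : (2 * (C * 2 ^ j + L) + 1) ^ (2 * K) ≤ D ^ (2 * K) * (4 ^ j) ^ K := by
    have h1 : 2 * (C * 2 ^ j + L) + 1 ≤ D * 2 ^ j := by
      have : (L : ℝ) ≤ M := by exact_mod_cast hL
      have hM0 : (0 : ℝ) ≤ M := by positivity
      nlinarith
    calc (2 * (C * 2 ^ j + L) + 1) ^ (2 * K) ≤ (D * 2 ^ j) ^ (2 * K) := by gcongr
      _ = _ := by
        rw [mul_pow, pow_mul (2 ^ j : ℝ), ← pow_mul 2, mul_comm j, pow_mul 2]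
        norm_num
  have h0 : ‖ker s y‖ ≤ |B 0| * (D ^ (2 * K) * (4 ^ j) ^ K) := by
    refine (norm_ker_le (by positivity) hs (A := |B 0|)
      (fun ξ => by simpa using (hder 0 ξ).trans (by simpa using le_abs_self (B 0))) y).trans ?_
    have := hX (Nat.zero_le M)
    rw [Nat.cast_zero, add_zero] at this
    gcongr
  have hMle : (2 ^ j * ‖y‖) ^ M * ‖ker s y‖
      ≤ (|B 0| + |B M|) * (D ^ (2 * K) * (4 ^ j) ^ K) - |B 0| * (D ^ (2 * K) * (4 ^ j) ^ K)
        ∨ M = 0 := by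
    rcases isEmpty_or_nonempty ι with hι | hι
    · right
      simp [hM, hK]
    left
    obtain ⟨i, hi⟩ := Finite.exists_max fun i => ‖y i‖
    have hyi : ‖y‖ ≤ ‖y i‖ := (pi_norm_le_iff_of_nonneg (norm_nonneg _)).2 hi
    have h1 := norm_pow_mul_ker_le hsm (by positivity) hs i y (M := M)
      (A := |B M| * ((2 ^ j)⁻¹) ^ M) (fun ξ => (hder M ξ).trans (by
        gcongr
        exact le_abs_self _))
    rw [← sub_mul, add_sub_cancel_left]
    calc (2 ^ j * ‖y‖) ^ M * ‖ker s y‖ ≤ (2 ^ j) ^ M * (‖y i‖ ^ M * ‖ker s y‖) := by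
          rw [mul_pow, mul_assoc]
          gcongr
      _ ≤ (2 ^ j) ^ M * (|B M| * ((2 ^ j)⁻¹) ^ M * (2 * (C * 2 ^ j + M) + 1) ^ (2 * K)) := by
          gcongr
      _ = |B M| * (2 * (C * 2 ^ j + M) + 1) ^ (2 * K) := by
          rw [inv_pow]
          field_simp
      _ ≤ _ := by
          gcongr
          exact hX le_rfl
  have hu0 : 0 ≤ 2 ^ j * ‖y‖ := by positivity
  have hB0 : 0 ≤ |B M| * (D ^ (2 * K) * (4 ^ j) ^ K) := by positivity
  have hmain : (1 + 2 ^ j * ‖y‖) ^ M * ‖ker s y‖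
      ≤ 2 ^ M * ((|B 0| + |B M|) * (D ^ (2 * K) * (4 ^ j) ^ K)) := by
    rcases le_total (2 ^ j * ‖y‖) 1 with hle | hle
    · calc (1 + 2 ^ j * ‖y‖) ^ M * ‖ker s y‖
          ≤ 2 ^ M * (|B 0| * (D ^ (2 * K) * (4 ^ j) ^ K)) := by
            gcongr
            linarith
        _ ≤ _ := by
            gcongr
            linarith [abs_nonneg (B M)]
    · have hh : (2 ^ j * ‖y‖) ^ M * ‖ker s y‖
          ≤ (|B 0| + |B M|) * (D ^ (2 * K) * (4 ^ j) ^ K) := by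
        rcases hMle with h | h
        · have : 0 ≤ |B 0| * (D ^ (2 * K) * (4 ^ j) ^ K) := by positivity
          linarith
        · rw [h, pow_zero, one_mul, add_mul]
          rw [h] at hB0
          linarith
      calc (1 + 2 ^ j * ‖y‖) ^ M * ‖ker s y‖
          ≤ (2 * (2 ^ j * ‖y‖)) ^ M * ‖ker s y‖ := by
            gcongr
            linarith
        _ = 2 ^ M * ((2 ^ j * ‖y‖) ^ M * ‖ker s y‖) := by rw [mul_pow, mul_assoc]
        _ ≤ _ := by gcongr
  have hprod : ∏ i, wt N j (y i) = (4 ^ j) ^ K / ∏ i, (1 + 2 ^ j * ‖y i‖) ^ N := by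
    simp only [wt, Finset.prod_div_distrib, Finset.prod_const, Finset.card_univ, hK]
  have hprod2 : ∏ i, (1 + 2 ^ j * ‖y i‖) ^ N ≤ (1 + 2 ^ j * ‖y‖) ^ M := by
    calc ∏ i, (1 + 2 ^ j * ‖y i‖) ^ N ≤ ∏ _i : ι, (1 + 2 ^ j * ‖y‖) ^ N := by
          refine Finset.prod_le_prod (fun i _ => by positivity) fun i _ => ?_
          gcongr
          exact norm_le_pi_norm y i
      _ = _ := by rw [Finset.prod_const, Finset.card_univ, ← pow_mul]
  have hpos : 0 < ∏ i, (1 + 2 ^ j * ‖y i‖) ^ N := Finset.prod_pos fun i _ => by positivity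
  rw [hprod, ← mul_div_assoc, le_div_iff₀ hpos, mul_comm]
  calc (∏ i, (1 + 2 ^ j * ‖y i‖) ^ N) * ‖ker s y‖ ≤ (1 + 2 ^ j * ‖y‖) ^ M * ‖ker s y‖ := by
        gcongr
    _ ≤ _ := hmain
    _ = _ := by ring

variable {ι : Type*} [Fintype ι]

/-- Bounded measurable functions on the torus. -/
def BddMeas (f : T2 → ℂ) : Prop := Measurable f ∧ ∃ B : ℝ≥0, ∀ x, ‖f x‖ ≤ B

/-- The multilinear Fourier multiplier with symbol `s`. -/
def multOp (s : (ι → ℝ × ℝ) → ℂ) (g : ι → T2 → ℂ) (x : T2) : ℂ :=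
  ∑' n : ι → ℤ × ℤ, s (lat n) * (∏ i, fCoeff (g i) (n i)) * fChar (∑ i, n i) x

lemma integral_fChar (n : ℤ × ℤ) : ∫ x, fChar n x = if n = 0 then 1 else 0 := by
  split_ifs with h
  · simp [h]
  · have h' : n.1 ≠ 0 ∨ n.2 ≠ 0 := by
      by_contra! h0
      exact h (Prod.ext h0.1 h0.2)
    rcases h' with h1 | h1
    · refine integral_eq_zero_of_add_right_eq_neg (g := (((1 / 2 / n.1 : ℝ) : AddCircle (1 : ℝ)), 0))
        fun x => ?_
      simp only [fChar, Prod.fst_add, Prod.snd_add, add_zero,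
        fourier_add_half_inv_index h1 one_pos, neg_mul]
    · refine integral_eq_zero_of_add_right_eq_neg (g := (0, ((1 / 2 / n.2 : ℝ) : AddCircle (1 : ℝ))))
        fun x => ?_
      simp only [fChar, Prod.fst_add, Prod.snd_add, add_zero,
        fourier_add_half_inv_index h1 one_pos, mul_neg]

lemma BddMeas.integrable {f : T2 → ℂ} (hf : BddMeas f) : Integrable f := by
  obtain ⟨hm, B, hB⟩ := hf
  exact Integrable.of_bound hm.aestronglyMeasurable B (ae_of_all _ hB)

lemma BddMeas.mul {f g : T2 → ℂ} (hf : BddMeas f) (hg : BddMeas g) :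
    BddMeas fun x => f x * g x := by
  obtain ⟨hm, B, hB⟩ := hf
  obtain ⟨hm', B', hB'⟩ := hg
  refine ⟨hm.mul hm', B * B', fun x => ?_⟩
  rw [norm_mul]
  push_cast
  gcongr
  exacts [hB x, hB' x]

lemma BddMeas.add {f g : T2 → ℂ} (hf : BddMeas f) (hg : BddMeas g) :
    BddMeas fun x => f x + g x := by
  obtain ⟨hm, B, hB⟩ := hf
  obtain ⟨hm', B', hB'⟩ := hg
  exact ⟨hm.add hm', B + B', fun x => (norm_add_le _ _).trans (add_le_add (hB x) (hB' x))⟩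

lemma BddMeas.const_mul {f : T2 → ℂ} (hf : BddMeas f) (c : ℂ) : BddMeas fun x => c * f x :=
  BddMeas.mul ⟨measurable_const, ‖c‖₊, fun _ => le_rfl⟩ hf

lemma bddMeas_fChar (n : ℤ × ℤ) : BddMeas (fChar n) :=
  ⟨(continuous_fChar n).measurable, 1, fun x => by simp⟩

lemma bddMeas_sum {κ : Type*} (S : Finset κ) {f : κ → T2 → ℂ} (hf : ∀ i, BddMeas (f i)) :
    BddMeas fun x => ∑ i ∈ S, f i x := by
  classical
  induction S using Finset.induction_on with
  | empty => exact ⟨by simp, 0, by simp⟩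
  | insert a S ha ih =>
    simp_rw [Finset.sum_insert ha]
    exact (hf a).add ih

lemma BddMeas.of_continuous {f : T2 → ℂ} (hf : Continuous f) : BddMeas f := by
  obtain ⟨C, hC⟩ := isCompact_univ.exists_bound_of_continuousOn hf.continuousOn
  refine ⟨hf.measurable, C.toNNReal, fun x => ?_⟩
  rw [Real.coe_toNNReal']
  exact (hC x (mem_univ x)).trans (le_max_left _ _)

lemma BddMeas.indicator {f : T2 → ℂ} (hf : BddMeas f) {s : Set T2} (hs : MeasurableSet s) :
    BddMeas (s.indicator f) := by
  obtain ⟨hm, B, hB⟩ := hf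
  exact ⟨hm.indicator hs, B, fun x => (norm_indicator_le_norm_self f x).trans (hB x)⟩

lemma fChar_sum {κ : Type*} (S : Finset κ) (n : κ → ℤ × ℤ) (x : T2) :
    fChar (∑ i ∈ S, n i) x = ∏ i ∈ S, fChar (n i) x := by
  classical
  induction S using Finset.induction_on with
  | empty => simp
  | insert a S ha ih => rw [Finset.sum_insert ha, Finset.prod_insert ha, fChar_add, ih]

lemma integrable_prod_comp {h : ι → T2 → ℂ} (hh : ∀ i, BddMeas (h i)) :
    Integrable fun y : ι → T2 => ∏ i, h i (y i) := by
  choose hm B hB using hh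
  refine Integrable.of_bound (C := ∏ i, (B i : ℝ)) ?_ (ae_of_all _ fun y => ?_)
  · exact (Finset.measurable_prod _ fun i _ =>
      (hm i).comp (measurable_pi_apply i)).aestronglyMeasurable
  · rw [norm_prod]
    exact Finset.prod_le_prod (fun _ _ => norm_nonneg _) fun i _ => hB i _

lemma multOp_eq_integral {s : (ι → ℝ × ℝ) → ℂ} {R : ℝ} (hs : ∀ ξ, R ≤ ‖ξ‖ → s ξ = 0)
    {g : ι → T2 → ℂ} (hg : ∀ i, BddMeas (g i)) (x : T2) :
    multOp s g x = ∫ y : ι → T2, ker s (fun i => x - y i) * ∏ i, g i (y i) := by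
  have h0 (n) (hn : n ∉ box ι R) : s (lat n) = 0 := by
    refine hs _ ?_
    by_contra! h
    exact hn (mem_box h.le)
  have hker (z : ι → T2) : ker s z = ∑ n ∈ box ι R, s (lat n) * ∏ i, fChar (n i) (z i) :=
    tsum_eq_sum fun n hn => by rw [h0 n hn, zero_mul]
  rw [multOp, tsum_eq_sum (s := box ι R) (fun n hn => by rw [h0 n hn, zero_mul, zero_mul])]
  have hterm (n : ι → ℤ × ℤ) (y : ι → T2) :
      s (lat n) * (∏ i, fChar (n i) (x - y i)) * ∏ i, g i (y i)
        = s (lat n) * fChar (∑ i, n i) x * ∏ i, fChar (-n i) (y i) * g i (y i) := by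
    simp_rw [fChar_sub_arg, Finset.prod_mul_distrib, fChar_sum]
    ring
  have hcoeff (n : ι → ℤ × ℤ) :
      ∫ y : ι → T2, ∏ i, fChar (-n i) (y i) * g i (y i) = ∏ i, fCoeff (g i) (n i) :=
    integral_fintype_prod_volume_eq_prod (fun i y => fChar (-n i) y * g i y)
  have hint (n : ι → ℤ × ℤ) :
      Integrable fun y : ι → T2 => ∏ i, fChar (-n i) (y i) * g i (y i) :=
    integrable_prod_comp fun i => (bddMeas_fChar (-n i)).mul (hg i)
  calc ∑ n ∈ box ι R, s (lat n) * (∏ i, fCoeff (g i) (n i)) * fChar (∑ i, n i) x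
    _ = ∑ n ∈ box ι R, ∫ y : ι → T2, s (lat n) * fChar (∑ i, n i) x *
        ∏ i, fChar (-n i) (y i) * g i (y i) := by
      refine Finset.sum_congr rfl fun n _ => ?_
      rw [integral_const_mul, hcoeff]
      ring
    _ = ∫ y : ι → T2, ∑ n ∈ box ι R, s (lat n) * fChar (∑ i, n i) x *
        ∏ i, fChar (-n i) (y i) * g i (y i) :=
      (integral_finsetSum _ fun n _ => (hint n).const_mul _).symm
    _ = _ := by
      congr with y
      rw [hker, Finset.sum_mul]
      exact Finset.sum_congr rfl fun n _ => (hterm n y).symm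

lemma enorm_multOp_le {s : (ι → ℝ × ℝ) → ℂ} {R : ℝ} (hs : ∀ ξ, R ≤ ‖ξ‖ → s ξ = 0)
    {g : ι → T2 → ℂ} (hg : ∀ i, BddMeas (g i)) {N j : ℕ} {C : ℝ} (hC : 0 ≤ C)
    (hker : ∀ y, ‖ker s y‖ ≤ C * ∏ i, wt N j (y i)) (x : T2) :
    ‖multOp s g x‖ₑ ≤ ENNReal.ofReal C * ∏ i, avg N j (fun y => ‖g i y‖ₑ) x := by
  choose hm B hB using hg
  have hw (i : ι) : BddMeas fun y => ((wt N j (x - y) * ‖g i y‖ : ℝ) : ℂ) := by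
    refine ⟨?_, 4 ^ j * B i, fun y => ?_⟩
    · have := hm i
      fun_prop
    · rw [Complex.norm_real, Real.norm_eq_abs, abs_mul, abs_norm, abs_of_pos (wt_pos _ _ _)]
      push_cast
      gcongr
      exacts [wt_le _ _ _, hB i y]
  have hwi (i : ι) : Integrable fun y => wt N j (x - y) * ‖g i y‖ := (hw i).integrable.re
  have h1 : ‖multOp s g x‖ ≤ C * ∏ i, ∫ y, wt N j (x - y) * ‖g i y‖ := by
    rw [multOp_eq_integral hs fun i => ⟨hm i, B i, hB i⟩,
      ← integral_fintype_prod_volume_eq_prod (fun i y => wt N j (x - y) * ‖g i y‖),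
      ← integral_const_mul]
    refine norm_integral_le_of_norm_le ?_ (ae_of_all _ fun y => ?_)
    · have := (integrable_prod_comp hw).re
      refine Integrable.const_mul (this.congr (ae_of_all _ fun y => ?_)) C
      simp only [← Complex.ofReal_prod]
      exact Complex.ofReal_re _
    · rw [norm_mul, norm_prod, Finset.prod_mul_distrib, ← mul_assoc]
      gcongr
      exact hker _
  rw [← ofReal_norm]
  refine (ENNReal.ofReal_le_ofReal h1).trans_eq ?_
  rw [ENNReal.ofReal_mul hC, ENNReal.ofReal_prod_of_nonneg]
  · congr 2 with i
    rw [ofReal_integral_eq_lintegral_ofReal (hwi i)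
      (ae_of_all _ fun y => mul_nonneg (wt_pos _ _ _).le (norm_nonneg _)), avg]
    congr with y
    rw [ENNReal.ofReal_mul (wt_pos _ _ _).le, ofReal_norm]
  · exact fun i _ => integral_nonneg fun y => mul_nonneg (wt_pos _ _ _).le (norm_nonneg _)

lemma maxFn_one_le (x : T2) : maxFn (fun _ => 1) x ≤ 4 := by
  simpa using maxFn_le_of_le (f := fun _ => 1) (B := 1) (fun _ => le_rfl) x

lemma avg_one_le {N : ℕ} (hN : 3 ≤ N) (j : ℕ) (x : T2) : avg N j (fun _ => 1) x ≤ 64 := by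
  refine (avg_le_maxFn hN j measurable_const x).trans ?_
  calc 16 * maxFn (fun _ => 1) x ≤ 16 * 4 := mul_le_mul_right (maxFn_one_le x) _
    _ = 64 := by norm_num

lemma avg_le_of_le {N : ℕ} (hN : 3 ≤ N) (j : ℕ) {f : T2 → ℝ≥0∞} {B : ℝ≥0∞} (h : ∀ x, f x ≤ B)
    (x : T2) : avg N j f x ≤ 64 * B := by
  calc avg N j f x ≤ avg N j (fun _ => B * 1) x := avg_mono (by simpa using h) x
    _ = B * avg N j (fun _ => 1) x := avg_const_mul measurable_const _ _
    _ ≤ B * 64 := mul_le_mul_right (avg_one_le hN j x) _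
    _ = 64 * B := mul_comm _ _

lemma avg_avg_le {N : ℕ} (hN : 3 ≤ N) (j : ℕ) {f : T2 → ℝ≥0∞} (hf : Measurable f) (x : T2) :
    avg N j (avg N j f) x ≤ 2 ^ N * 128 * avg N j f x := by
  have h1 : avg N j (avg N j f) x = ∫⁻ z, ∫⁻ y, ENNReal.ofReal (wt N j (x - y)) *
      (ENNReal.ofReal (wt N j (y - z)) * f z) := by
    rw [lintegral_lintegral_swap (by fun_prop)]
    unfold avg
    congr with y
    rw [lintegral_const_mul _ (by fun_prop)]
  rw [h1, avg, ← lintegral_const_mul _ (by fun_prop)]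
  refine lintegral_mono fun z => ?_
  have h2 (y : T2) : ENNReal.ofReal (wt N j (x - y)) * (ENNReal.ofReal (wt N j (y - z)) * f z) ≤
      2 ^ N * ENNReal.ofReal (wt N j (x - z)) * f z *
        (ENNReal.ofReal (wt N j (x - y)) * 1 + ENNReal.ofReal (wt N j (z - y)) * 1) := by
    have h := wt_mul_wt_le N j (x - z) (y - z)
    rw [sub_sub_sub_cancel_right] at h
    have h' := ENNReal.ofReal_le_ofReal h
    have hp := fun a => (wt_pos N j a).le
    rw [ENNReal.ofReal_mul (hp _), ENNReal.ofReal_mul (mul_nonneg (by positivity) (hp _)),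
      ENNReal.ofReal_mul (by positivity), ENNReal.ofReal_add (hp _) (hp _),
      ENNReal.ofReal_pow zero_le_two, ENNReal.ofReal_ofNat] at h'
    rw [← neg_sub y z, wt_neg, mul_one, mul_one, ← mul_assoc]
    refine (mul_le_mul_left h' _).trans_eq (by ring)
  refine (lintegral_mono h2).trans ?_
  rw [lintegral_const_mul _ (by fun_prop), lintegral_add_left (by fun_prop)]
  calc 2 ^ N * ENNReal.ofReal (wt N j (x - z)) * f z *
        (avg N j (fun _ => 1) x + avg N j (fun _ => 1) z)
      ≤ 2 ^ N * ENNReal.ofReal (wt N j (x - z)) * f z * (64 + 64) :=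
        mul_le_mul_right (add_le_add (avg_one_le hN j x) (avg_one_le hN j z)) _
    _ = _ := by ring

lemma avg_le_of_dist_le {N j : ℕ} {K : ℝ} (hK : 0 ≤ K) {x z : T2}
    (h : dist x z ≤ K * (2 ^ j)⁻¹) {f : T2 → ℝ≥0∞} (hf : Measurable f) :
    avg N j f x ≤ ENNReal.ofReal ((1 + K) ^ N) * avg N j f z := by
  unfold avg
  rw [← lintegral_const_mul _ (by fun_prop)]
  refine lintegral_mono fun y => ?_
  rw [← mul_assoc, ← ENNReal.ofReal_mul (by positivity)]
  refine mul_le_mul_left (ENNReal.ofReal_le_ofReal (wt_le_of_norm_le hK ?_)) _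
  rwa [sub_sub_sub_cancel_right, ← dist_eq_norm]

lemma le_avg_one (N j : ℕ) (x : T2) : ENNReal.ofReal ((2 ^ N)⁻¹) ≤ avg N j (fun _ => 1) x := by
  have h (y) (hy : y ∈ closedBall x ((2 ^ j : ℝ)⁻¹)) :
      ENNReal.ofReal ((2 ^ N)⁻¹ * 4 ^ j) ≤ ENNReal.ofReal (wt N j (x - y)) * 1 := by
    rw [mul_one]
    apply ENNReal.ofReal_le_ofReal
    rw [wt, inv_mul_eq_div]
    have h1 : 2 ^ j * ‖x - y‖ ≤ 1 := by
      rw [mem_closedBall, dist_comm, dist_eq_norm] at hy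
      calc (2 : ℝ) ^ j * ‖x - y‖ ≤ 2 ^ j * (2 ^ j)⁻¹ := by gcongr
        _ = 1 := mul_inv_cancel₀ (by positivity)
    gcongr
    linarith
  calc ENNReal.ofReal ((2 ^ N)⁻¹)
      = ENNReal.ofReal ((2 ^ N)⁻¹ * 4 ^ j) * ENNReal.ofReal (((2 ^ j : ℝ)⁻¹) ^ 2) := by
        rw [← ENNReal.ofReal_mul (by positivity)]
        congr 1
        rw [show (4 : ℝ) ^ j = (2 ^ j) ^ 2 by rw [← pow_mul, mul_comm, pow_mul]; norm_num]
        field_simp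
    _ ≤ ENNReal.ofReal ((2 ^ N)⁻¹ * 4 ^ j) * volume (closedBall x ((2 ^ j : ℝ)⁻¹)) :=
        mul_le_mul_right (le_volume_closedBall x _ (by positivity)
          (inv_le_one_of_one_le₀ (one_le_pow₀ one_le_two))) _
    _ = ∫⁻ _ in closedBall x ((2 ^ j : ℝ)⁻¹), ENNReal.ofReal ((2 ^ N)⁻¹ * 4 ^ j) := by
        rw [setLIntegral_const]
    _ ≤ ∫⁻ y in closedBall x ((2 ^ j : ℝ)⁻¹), ENNReal.ofReal (wt N j (x - y)) * 1 :=
        setLIntegral_mono' measurableSet_closedBall h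
    _ ≤ _ := setLIntegral_le_lintegral _ _

lemma le_maxFn {f : T2 → ℝ≥0∞} (hf : Continuous f) (x : T2) : f x ≤ maxFn f x := by
  refine le_of_forall_lt fun a ha => ?_
  obtain ⟨b, hab, hb⟩ := exists_between ha
  refine hab.trans_le ?_
  obtain ⟨ε, hε, h⟩ := Metric.eventually_nhds_iff.1 (hf.continuousAt.eventually (lt_mem_nhds hb))
  obtain ⟨j, hj⟩ := exists_pow_lt_of_lt_one hε (show (2⁻¹ : ℝ) < 1 by norm_num)
  rw [inv_pow] at hj
  refine le_trans ?_ (le_iSup _ j)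
  have h1 : (4 : ℝ≥0∞) ^ j * ENNReal.ofReal (((2 ^ j : ℝ)⁻¹) ^ 2) = 1 := by
    rw [show (4 : ℝ≥0∞) ^ j = ENNReal.ofReal (4 ^ j) by
      rw [ENNReal.ofReal_pow (by norm_num), ENNReal.ofReal_ofNat],
      ← ENNReal.ofReal_mul (by positivity),
      show (4 : ℝ) ^ j = (2 ^ j) ^ 2 by rw [← pow_mul, mul_comm, pow_mul]; norm_num,
      ← mul_pow, mul_inv_cancel₀ (by positivity), one_pow, ENNReal.ofReal_one]
  calc b = 4 ^ j * (b * ENNReal.ofReal (((2 ^ j : ℝ)⁻¹) ^ 2)) := by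
        rw [mul_left_comm, h1, mul_one]
    _ ≤ 4 ^ j * (b * volume (closedBall x ((2 ^ j : ℝ)⁻¹))) :=
        mul_le_mul_right (mul_le_mul_right (le_volume_closedBall x _ (by positivity)
          (inv_le_one_of_one_le₀ (one_le_pow₀ one_le_two))) _) _
    _ ≤ _ := by
        rw [← setLIntegral_const]
        exact mul_le_mul_right (setLIntegral_mono' measurableSet_closedBall fun y hy =>
          (h ((mem_closedBall.1 hy).trans_lt hj)).le) _

section Cutoff

variable (ι : Type*) [Fintype ι]

/-- A smooth cutoff equal to one on the unit ball and supported in the ball of radius two. -/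
def cut (ξ : ι → ℝ × ℝ) : ℂ :=
  ((⟨1, 2, one_pos, one_lt_two⟩ : ContDiffBump (0 : ι → ℝ × ℝ)) ξ : ℝ)

lemma contDiff_cut : ContDiff ℝ (⊤ : ℕ∞) (cut ι) :=
  Complex.ofRealCLM.contDiff.comp (ContDiffBump.contDiff _)

lemma hasCompactSupport_cut : HasCompactSupport (cut ι) :=
  (ContDiffBump.hasCompactSupport _).comp_left (g := fun r : ℝ => (r : ℂ)) Complex.ofReal_zero

variable {ι}

lemma norm_cut_le (ξ : ι → ℝ × ℝ) : ‖cut ι ξ‖ ≤ 1 := by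
  rw [cut, Complex.norm_real, Real.norm_of_nonneg (ContDiffBump.nonneg _)]
  exact ContDiffBump.le_one _

lemma cut_eq_one {ξ : ι → ℝ × ℝ} (h : ‖ξ‖ ≤ 1) : cut ι ξ = 1 := by
  rw [cut, ContDiffBump.one_of_mem_closedBall, Complex.ofReal_one]
  simpa using h

lemma cut_eq_zero {ξ : ι → ℝ × ℝ} (h : 2 ≤ ‖ξ‖) : cut ι ξ = 0 := by
  rw [cut, ContDiffBump.zero_of_le_dist, Complex.ofReal_zero]
  simpa using h

lemma norm_cut_sub_cut_le (ξ η : ι → ℝ × ℝ) : ‖cut ι ξ - cut ι η‖ ≤ 1 := by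
  rw [cut, cut, ← Complex.ofReal_sub, Complex.norm_real, Real.norm_eq_abs]
  exact abs_sub_le_of_le_of_le (ContDiffBump.nonneg _) (ContDiffBump.le_one _)
    (ContDiffBump.nonneg _) (ContDiffBump.le_one _) |>.trans (by norm_num)

lemma exists_norm_iteratedFDeriv_cut_le (ι : Type*) [Fintype ι] :
    ∃ B : ℕ → ℝ, (∀ m, 0 ≤ B m) ∧ ∀ (m : ℕ) (c : ℝ) (ξ : ι → ℝ × ℝ),
      ‖iteratedFDeriv ℝ m (fun η => cut ι (c • η)) ξ‖ ≤ B m * |c| ^ m := by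
  have h (m : ℕ) := ((contDiff_cut ι).continuous_iteratedFDeriv (m := m)
    (by exact_mod_cast le_top)).bounded_above_of_compact_support
      ((hasCompactSupport_cut ι).iteratedFDeriv m)
  choose B hB using h
  refine ⟨B, fun m => (norm_nonneg _).trans (hB m 0), fun m c ξ => ?_⟩
  rw [iteratedFDeriv_comp_const_smul c ((contDiff_cut ι).of_le (by exact_mod_cast le_top)),
    norm_smul, norm_pow, Real.norm_eq_abs, mul_comm]
  gcongr
  exact hB _ _

lemma norm_lat (n : ι → ℤ × ℤ) : ‖lat n‖ = ‖n‖ := by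
  simp only [Pi.norm_def, lat]
  rfl

end Cutoff

/-! ### Fourier multipliers with finitely supported symbols -/

lemma mulOp_eq_sum {a : ℤ × ℤ → ℂ} {S : Finset (ℤ × ℤ)} (ha : ∀ n ∉ S, a n = 0) (f : T2 → ℂ)
    (x : T2) : mulOp a f x = ∑ n ∈ S, a n * fCoeff f n * fChar n x :=
  tsum_eq_sum fun n hn => by rw [ha n hn, zero_mul, zero_mul]

lemma exists_finset_of_norm {a : ℤ × ℤ → ℂ} {R : ℝ} (ha : ∀ n, R ≤ ‖n‖ → a n = 0) :
    ∃ S : Finset (ℤ × ℤ), ∀ n ∉ S, a n = 0 := by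
  refine ⟨(isCompact_closedBall (0 : ℤ × ℤ) R).finite_of_discrete.toFinset, fun n hn => ha n ?_⟩
  rw [Finite.mem_toFinset, mem_closedBall_zero_iff, not_le] at hn
  exact hn.le

lemma continuous_mulOp {a : ℤ × ℤ → ℂ} {S : Finset (ℤ × ℤ)} (ha : ∀ n ∉ S, a n = 0)
    (f : T2 → ℂ) : Continuous (mulOp a f) := by
  rw [show mulOp a f = fun x => ∑ n ∈ S, a n * fCoeff f n * fChar n x from
    funext (mulOp_eq_sum ha f)]
  exact continuous_finsetSum _ fun n _ => (continuous_fChar n).const_mul _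

lemma fCoeff_add {f g : T2 → ℂ} (hf : BddMeas f) (hg : BddMeas g) (n : ℤ × ℤ) :
    fCoeff (fun x => f x + g x) n = fCoeff f n + fCoeff g n := by
  unfold fCoeff
  rw [← integral_add ((bddMeas_fChar _).mul hf).integrable ((bddMeas_fChar _).mul hg).integrable]
  simp_rw [mul_add]

lemma fCoeff_const_mul (f : T2 → ℂ) (c : ℂ) (n : ℤ × ℤ) :
    fCoeff (fun x => c * f x) n = c * fCoeff f n := by
  unfold fCoeff
  rw [← integral_const_mul]
  congr with x
  ring

lemma fCoeff_sum {κ : Type*} (S : Finset κ) {f : κ → T2 → ℂ} (hf : ∀ i, BddMeas (f i))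
    (n : ℤ × ℤ) : fCoeff (fun x => ∑ i ∈ S, f i x) n = ∑ i ∈ S, fCoeff (f i) n := by
  unfold fCoeff
  rw [← integral_finsetSum _ fun i _ => ((bddMeas_fChar _).mul (hf i)).integrable]
  simp_rw [Finset.mul_sum]

lemma fCoeff_fChar (m n : ℤ × ℤ) : fCoeff (fChar m) n = if m = n then 1 else 0 := by
  unfold fCoeff
  simp_rw [← fChar_add]
  rw [integral_fChar]
  simp [neg_add_eq_zero, eq_comm]

lemma fCoeff_mulOp {a : ℤ × ℤ → ℂ} {S : Finset (ℤ × ℤ)} (ha : ∀ n ∉ S, a n = 0) (f : T2 → ℂ)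
    (n : ℤ × ℤ) : fCoeff (mulOp a f) n = a n * fCoeff f n := by
  rw [show mulOp a f = fun x => ∑ n ∈ S, a n * fCoeff f n * fChar n x from
    funext (mulOp_eq_sum ha f), fCoeff_sum S fun n => (bddMeas_fChar n).const_mul _]
  simp_rw [fCoeff_const_mul, fCoeff_fChar]
  simp only [mul_ite, mul_one, mul_zero, Finset.sum_ite_eq']
  split_ifs with h
  · rfl
  · rw [ha n h, zero_mul]

lemma mulOp_mulOp {b : ℤ × ℤ → ℂ} {S : Finset (ℤ × ℤ)} (hb : ∀ n ∉ S, b n = 0)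
    (a : ℤ × ℤ → ℂ) (f : T2 → ℂ) : mulOp a (mulOp b f) = mulOp (fun n => a n * b n) f := by
  funext x
  simp only [mulOp]
  congr with n
  rw [fCoeff_mulOp hb]
  ring

lemma mulOp_fun_add {a : ℤ × ℤ → ℂ} {S : Finset (ℤ × ℤ)} (ha : ∀ n ∉ S, a n = 0)
    {f g : T2 → ℂ} (hf : BddMeas f) (hg : BddMeas g) (x : T2) :
    mulOp a (fun x => f x + g x) x = mulOp a f x + mulOp a g x := by
  simp_rw [mulOp_eq_sum ha, fCoeff_add hf hg, ← Finset.sum_add_distrib]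
  exact Finset.sum_congr rfl fun n _ => by ring

lemma mulOp_fun_sum {a : ℤ × ℤ → ℂ} {S : Finset (ℤ × ℤ)} (ha : ∀ n ∉ S, a n = 0) {κ : Type*}
    (T : Finset κ) {f : κ → T2 → ℂ} (hf : ∀ i, BddMeas (f i)) (x : T2) :
    mulOp a (fun x => ∑ i ∈ T, f i x) x = ∑ i ∈ T, mulOp a (f i) x := by
  simp_rw [mulOp_eq_sum ha, fCoeff_sum T hf]
  rw [Finset.sum_comm]
  refine Finset.sum_congr rfl fun n _ => ?_
  rw [Finset.mul_sum, Finset.sum_mul]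

lemma conj_fChar (n : ℤ × ℤ) (x : T2) : (starRingEnd ℂ) (fChar n x) = fChar (-n) x := by
  simp [fChar]

lemma bddMeas_conj {f : T2 → ℂ} (hf : BddMeas f) : BddMeas fun x => (starRingEnd ℂ) (f x) := by
  obtain ⟨hm, B, hB⟩ := hf
  exact ⟨Complex.continuous_conj.measurable.comp hm, B, by simpa using hB⟩

lemma integral_mul_conj_mulOp {a : ℤ × ℤ → ℂ} {S : Finset (ℤ × ℤ)} (ha : ∀ n ∉ S, a n = 0)
    {g : T2 → ℂ} (hg : BddMeas g) (f : T2 → ℂ) :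
    ∫ x, g x * (starRingEnd ℂ) (mulOp a f x)
      = ∑ n ∈ S, fCoeff g n * (starRingEnd ℂ) (a n * fCoeff f n) := by
  have h (x : T2) : g x * (starRingEnd ℂ) (mulOp a f x)
      = ∑ n ∈ S, (starRingEnd ℂ) (a n * fCoeff f n) * (fChar (-n) x * g x) := by
    rw [mulOp_eq_sum ha, map_sum, Finset.mul_sum]
    refine Finset.sum_congr rfl fun n _ => ?_
    rw [map_mul _ (a n * fCoeff f n), conj_fChar]
    ring
  simp_rw [h]
  rw [integral_finsetSum _ fun n _ => (((bddMeas_fChar (-n)).mul hg).const_mul _).integrable]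
  refine Finset.sum_congr rfl fun n _ => ?_
  rw [integral_const_mul, mul_comm, ← fCoeff]

lemma integral_normSq_mulOp {a : ℤ × ℤ → ℂ} {S : Finset (ℤ × ℤ)} (ha : ∀ n ∉ S, a n = 0)
    (f : T2 → ℂ) : ∫ x, ‖mulOp a f x‖ ^ 2 = ∑ n ∈ S, ‖a n * fCoeff f n‖ ^ 2 := by
  have h := integral_mul_conj_mulOp ha (BddMeas.of_continuous (continuous_mulOp ha f)) f
  simp_rw [fCoeff_mulOp ha, Complex.mul_conj', ← Complex.ofReal_pow] at h
  rw [integral_complex_ofReal, ← Complex.ofReal_sum] at h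
  exact_mod_cast h

lemma sum_norm_sq_fCoeff_le (S : Finset (ℤ × ℤ)) {f : T2 → ℂ} (hf : BddMeas f) :
    ∑ n ∈ S, ‖fCoeff f n‖ ^ 2 ≤ ∫ x, ‖f x‖ ^ 2 := by
  classical
  set a : ℤ × ℤ → ℂ := fun n => if n ∈ S then 1 else 0 with ha'
  have ha : ∀ n ∉ S, a n = 0 := fun n hn => if_neg hn
  have hS : ∀ n ∈ S, a n = 1 := fun n hn => if_pos hn
  have hg := BddMeas.of_continuous (continuous_mulOp ha f)
  have h1 := integral_normSq_mulOp ha f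
  rw [Finset.sum_congr rfl fun n hn => by rw [hS n hn, one_mul]] at h1
  have h2 : (∫ x, (f x * (starRingEnd ℂ) (mulOp a f x))).re = ∑ n ∈ S, ‖fCoeff f n‖ ^ 2 := by
    rw [integral_mul_conj_mulOp ha hf f,
      Finset.sum_congr rfl fun n hn => by rw [hS n hn, one_mul, Complex.mul_conj'], Complex.re_sum]
    exact Finset.sum_congr rfl fun n _ => by rw [← Complex.ofReal_pow, Complex.ofReal_re]
  have hfg := (hf.mul (bddMeas_conj hg)).integrable
  have hsq {u : T2 → ℂ} (hu : BddMeas u) : Integrable fun x => ‖u x‖ ^ 2 := by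
    have := (hu.mul (bddMeas_conj hu)).integrable.re
    refine this.congr (ae_of_all _ fun x => ?_)
    simp [Complex.mul_conj', ← Complex.ofReal_pow]
  have h3 : (∫ x, (f x * (starRingEnd ℂ) (mulOp a f x)).re) = ∑ n ∈ S, ‖fCoeff f n‖ ^ 2 :=
    (integral_re hfg).trans h2
  have h4 : ∫ x, 2 * (f x * (starRingEnd ℂ) (mulOp a f x)).re
      ≤ ∫ x, (‖f x‖ ^ 2 + ‖mulOp a f x‖ ^ 2) := by
    refine integral_mono (hfg.re.const_mul 2) ((hsq hf).add (hsq hg)) fun x => ?_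
    have := Complex.normSq_sub (f x) (mulOp a f x)
    simp only [← Complex.sq_norm] at this
    nlinarith [sq_nonneg ‖f x - mulOp a f x‖]
  rw [integral_add (hsq hf) (hsq hg), integral_const_mul, h1, h3] at h4
  linarith

/-! ### Littlewood–Paley operators -/

/-- Symbol of the projection to frequencies of size at most about `2^l`. -/
def lowSym (l : ℕ) (n : ℤ × ℤ) : ℂ := cut Unit (((2 : ℝ) ^ l)⁻¹ • lat fun _ : Unit => n)

/-- Symbol of the projection to frequencies between `2^j` and `2^(j+d+1)`. -/
def bandSym (d j : ℕ) (n : ℤ × ℤ) : ℂ := lowSym (j + d) n - lowSym j n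

lemma norm_inv_pow_smul_lat (l : ℕ) (n : ℤ × ℤ) :
    ‖((2 : ℝ) ^ l)⁻¹ • lat fun _ : Unit => n‖ = (2 ^ l)⁻¹ * ‖n‖ := by
  rw [norm_smul, norm_lat, pi_norm_const, Real.norm_of_nonneg (by positivity)]

lemma lowSym_eq_one {l : ℕ} {n : ℤ × ℤ} (h : ‖n‖ ≤ 2 ^ l) : lowSym l n = 1 := by
  apply cut_eq_one
  rw [norm_inv_pow_smul_lat, inv_mul_eq_div]
  exact div_le_one_of_le₀ h (by positivity)

lemma lowSym_eq_zero {l : ℕ} {n : ℤ × ℤ} (h : 2 ^ (l + 1) ≤ ‖n‖) : lowSym l n = 0 := by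
  apply cut_eq_zero
  rw [norm_inv_pow_smul_lat, inv_mul_eq_div, le_div_iff₀ (by positivity), ← pow_succ']
  exact h

lemma bandSym_eq_zero_of_le {d j : ℕ} {n : ℤ × ℤ} (h : ‖n‖ ≤ 2 ^ j) : bandSym d j n = 0 := by
  rw [bandSym, lowSym_eq_one h, lowSym_eq_one (h.trans _), sub_self]
  exact pow_le_pow_right₀ one_le_two (Nat.le_add_right _ _)

lemma bandSym_eq_zero_of_ge {d j : ℕ} {n : ℤ × ℤ} (h : 2 ^ (j + d + 1) ≤ ‖n‖) :
    bandSym d j n = 0 := by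
  rw [bandSym, lowSym_eq_zero h, lowSym_eq_zero (le_trans _ h), sub_self]
  exact pow_le_pow_right₀ one_le_two (by omega)

lemma norm_bandSym_le (d j : ℕ) (n : ℤ × ℤ) : ‖bandSym d j n‖ ≤ 1 := norm_cut_sub_cut_le _ _

lemma exists_finset_lowSym (l : ℕ) : ∃ S : Finset (ℤ × ℤ), ∀ n ∉ S, lowSym l n = 0 :=
  exists_finset_of_norm fun _ => lowSym_eq_zero

lemma exists_finset_bandSym (d j : ℕ) : ∃ S : Finset (ℤ × ℤ), ∀ n ∉ S, bandSym d j n = 0 :=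
  exists_finset_of_norm fun _ => bandSym_eq_zero_of_ge

lemma continuous_low (l : ℕ) (f : T2 → ℂ) : Continuous (mulOp (lowSym l) f) :=
  let ⟨_, hS⟩ := exists_finset_lowSym l
  continuous_mulOp hS f

lemma continuous_band (d j : ℕ) (f : T2 → ℂ) : Continuous (mulOp (bandSym d j) f) :=
  let ⟨_, hS⟩ := exists_finset_bandSym d j
  continuous_mulOp hS f

lemma mulOp_bandSym (d j : ℕ) (f : T2 → ℂ) (x : T2) :
    mulOp (bandSym d j) f x = mulOp (lowSym (j + d)) f x - mulOp (lowSym j) f x := by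
  classical
  obtain ⟨S, hS⟩ := exists_finset_lowSym (j + d)
  obtain ⟨S', hS'⟩ := exists_finset_lowSym j
  have h1 : ∀ n ∉ S ∪ S', lowSym (j + d) n = 0 := fun n hn => hS n (by simp_all)
  have h2 : ∀ n ∉ S ∪ S', lowSym j n = 0 := fun n hn => hS' n (by simp_all)
  rw [mulOp_eq_sum h1, mulOp_eq_sum h2, mulOp_eq_sum (S := S ∪ S') fun n hn => by
    rw [bandSym, h1 n hn, h2 n hn, sub_zero], ← Finset.sum_sub_distrib]
  exact Finset.sum_congr rfl fun n _ => by rw [bandSym]; ring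

lemma exists_enorm_low_le : ∃ C : ℝ≥0, ∀ (l : ℕ) (f : T2 → ℂ), BddMeas f → ∀ x,
    ‖mulOp (lowSym l) f x‖ₑ ≤ C * avg 4 l (fun y => ‖f y‖ₑ) x := by
  obtain ⟨B, -, hB⟩ := exists_norm_iteratedFDeriv_cut_le Unit
  obtain ⟨C, hC, h⟩ := exists_norm_ker_le_prod_wt Unit 4 zero_le_two B
  refine ⟨C.toNNReal, fun l f hf x => ?_⟩
  set s : (Unit → ℝ × ℝ) → ℂ := fun ξ => cut Unit (((2 : ℝ) ^ l)⁻¹ • ξ) with hs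
  have hs0 (ξ : Unit → ℝ × ℝ) (hξ : 2 * 2 ^ l ≤ ‖ξ‖) : s ξ = 0 := by
    apply cut_eq_zero
    rwa [norm_smul, norm_inv, norm_pow, Real.norm_ofNat, inv_mul_eq_div,
      le_div_iff₀ (by positivity)]
  have hk := h l s ((contDiff_cut Unit).comp (contDiff_const_smul _)) hs0 fun m ξ =>
    (hB m _ ξ).trans_eq (by rw [abs_of_pos (by positivity)])
  have := enorm_multOp_le hs0 (g := fun _ => f) (fun _ => hf) hC hk x
  rw [Finset.univ_unique, Finset.prod_singleton] at this
  refine (le_of_eq ?_).trans this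
  congr 1
  rw [multOp, mulOp, ← (Equiv.funUnique Unit (ℤ × ℤ)).symm.tsum_eq]
  simp [hs, lowSym]
  rfl

lemma exists_enorm_low_shift_le (d : ℕ) : ∃ C : ℝ≥0, ∀ (j l : ℕ), j ≤ l → l ≤ j + d →
    ∀ f : T2 → ℂ, BddMeas f → ∀ x,
    ‖mulOp (lowSym l) f x‖ₑ ≤ C * avg 4 j (fun y => ‖f y‖ₑ) x := by
  obtain ⟨C, hC⟩ := exists_enorm_low_le
  refine ⟨C * 4 ^ d, fun j l h1 h2 f hf x => (hC l f hf x).trans ?_⟩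
  push_cast
  rw [mul_assoc]
  refine mul_le_mul_right ?_ _
  unfold avg
  rw [← lintegral_const_mul' _ _ (by finiteness)]
  refine lintegral_mono fun y => ?_
  rw [← mul_assoc]
  refine mul_le_mul_left ?_ _
  refine (ENNReal.ofReal_le_ofReal (wt_scale_le h1 h2 _)).trans_eq ?_
  rw [ENNReal.ofReal_mul (by positivity), ENNReal.ofReal_pow (by positivity), ENNReal.ofReal_ofNat]

lemma exists_enorm_band_le (d : ℕ) : ∃ C : ℝ≥0, ∀ (j : ℕ) (f : T2 → ℂ), BddMeas f → ∀ x,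
    ‖mulOp (bandSym d j) f x‖ₑ ≤ C * avg 4 j (fun y => ‖f y‖ₑ) x := by
  obtain ⟨C, hC⟩ := exists_enorm_low_shift_le d
  refine ⟨C + C, fun j f hf x => ?_⟩
  rw [mulOp_bandSym]
  refine (enorm_sub_le ..).trans ?_
  push_cast
  rw [add_mul]
  exact add_le_add (hC j _ (by omega) le_rfl f hf x) (hC j _ le_rfl (by omega) f hf x)

/-- Functions with frequencies at most `2^(j+d+1)` are controlled by their averages at
scale `2^{-j}`. -/
lemma exists_enorm_mulOp_le_avg (d : ℕ) : ∃ C : ℝ≥0, ∀ (j : ℕ) (a : ℤ × ℤ → ℂ),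
    (∀ n, 2 ^ (j + d) ≤ ‖n‖ → a n = 0) → ∀ (f : T2 → ℂ) x,
    ‖mulOp a f x‖ₑ ≤ C * avg 4 j (fun y => ‖mulOp a f y‖ₑ) x := by
  obtain ⟨C, hC⟩ := exists_enorm_low_shift_le d
  refine ⟨C, fun j a ha f x => ?_⟩
  obtain ⟨S, hS⟩ := exists_finset_of_norm ha
  have h := hC j (j + d) (by omega) le_rfl (mulOp a f)
    (BddMeas.of_continuous (continuous_mulOp hS f)) x
  rw [mulOp_mulOp hS] at h
  have h2 : (fun n => lowSym (j + d) n * a n) = a := by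
    funext n
    rcases le_total (2 ^ (j + d)) ‖n‖ with hn | hn
    · rw [ha n hn, mul_zero]
    · rw [lowSym_eq_one hn, one_mul]
  rwa [h2] at h

lemma sum_norm_bandSym_sq_le (d J : ℕ) (n : ℤ × ℤ) :
    ∑ j ∈ Finset.range J, ‖bandSym d j n‖ ^ 2 ≤ d + 1 := by
  classical
  have h1 (j : ℕ) : ‖bandSym d j n‖ ^ 2
      ≤ if (2 : ℝ) ^ j < ‖n‖ ∧ ‖n‖ < 2 ^ (j + d + 1) then 1 else 0 := by
    split_ifs with h
    · exact pow_le_one₀ (norm_nonneg _) (norm_bandSym_le d j n)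
    · rw [not_and_or, not_lt, not_lt] at h
      rcases h with h | h
      · simp [bandSym_eq_zero_of_le h]
      · simp [bandSym_eq_zero_of_ge h]
  refine (Finset.sum_le_sum fun j _ => h1 j).trans ?_
  rw [← Finset.sum_filter, Finset.sum_const, nsmul_one]
  set T := {j ∈ Finset.range J | (2 : ℝ) ^ j < ‖n‖ ∧ ‖n‖ < 2 ^ (j + d + 1)} with hT
  rcases T.eq_empty_or_nonempty with h0 | h0
  · rw [h0, Finset.card_empty, Nat.cast_zero]
    positivity
  · have hsub : T ⊆ Finset.Ico (T.min' h0) (T.min' h0 + (d + 1)) := by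
      intro j hj
      rw [Finset.mem_Ico]
      refine ⟨Finset.min'_le _ _ hj, ?_⟩
      have h2 := (Finset.mem_filter.1 (T.min'_mem h0)).2.2
      have h3 := (Finset.mem_filter.1 hj).2.1
      exact (pow_lt_pow_iff_right₀ (one_lt_two (α := ℝ))).1 (h3.trans h2)
    have := Finset.card_le_card hsub
    rw [Nat.card_Ico] at this
    exact_mod_cast this.trans (by omega)

lemma sum_lintegral_band_sq_le (d J : ℕ) {f : T2 → ℂ} (hf : BddMeas f) :
    ∑ j ∈ Finset.range J, ∫⁻ x, ‖mulOp (bandSym d j) f x‖ₑ ^ 2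
      ≤ (d + 1) * ∫⁻ x, ‖f x‖ₑ ^ 2 := by
  have hint {u : T2 → ℂ} (hu : BddMeas u) :
      ∫⁻ x, ‖u x‖ₑ ^ 2 = ENNReal.ofReal (∫ x, ‖u x‖ ^ 2) := by
    have hi : Integrable fun x => ‖u x‖ ^ 2 := by
      refine (hu.mul (bddMeas_conj hu)).integrable.re.congr (ae_of_all _ fun x => ?_)
      simp [Complex.mul_conj', ← Complex.ofReal_pow]
    rw [ofReal_integral_eq_lintegral_ofReal hi (ae_of_all _ fun x => by positivity)]
    congr with x
    rw [ENNReal.ofReal_pow (norm_nonneg _), ofReal_norm]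
  choose S hS using fun j => exists_finset_bandSym d j
  classical
  set U := (Finset.range J).biUnion S with hU
  have hSU (j) (hj : j ∈ Finset.range J) (n) (hn : n ∉ U) : bandSym d j n = 0 :=
    hS j n fun h => hn (Finset.mem_biUnion.2 ⟨j, hj, h⟩)
  have key : ∑ j ∈ Finset.range J, ∫ x, ‖mulOp (bandSym d j) f x‖ ^ 2
      ≤ (d + 1) * ∫ x, ‖f x‖ ^ 2 := by
    rw [Finset.sum_congr rfl fun j hj => integral_normSq_mulOp (hSU j hj) f, Finset.sum_comm]
    refine le_trans ?_ (mul_le_mul_of_nonneg_left (sum_norm_sq_fCoeff_le U hf) (by positivity))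
    rw [Finset.mul_sum]
    refine Finset.sum_le_sum fun n _ => ?_
    simp_rw [norm_mul, mul_pow, ← Finset.sum_mul]
    exact mul_le_mul_of_nonneg_right (sum_norm_bandSym_sq_le d J n) (by positivity)
  have h := ENNReal.ofReal_le_ofReal key
  rw [ENNReal.ofReal_sum_of_nonneg fun j _ => integral_nonneg fun x => by positivity,
    ENNReal.ofReal_mul (by positivity), ← hint hf] at h
  rw [Finset.sum_congr rfl fun j _ => hint (BddMeas.of_continuous (continuous_band d j f))]
  refine h.trans_eq ?_
  congr 1
  rw [ENNReal.ofReal_add (by positivity) zero_le_one, ENNReal.ofReal_natCast, ENNReal.ofReal_one]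

lemma band_low_eq_zero {d j l : ℕ} (h : l + 1 ≤ j) (f : T2 → ℂ) (x : T2) :
    mulOp (bandSym d j) (mulOp (lowSym l) f) x = 0 := by
  obtain ⟨S, hS⟩ := exists_finset_lowSym l
  rw [mulOp_mulOp hS]
  have h0 (n : ℤ × ℤ) : bandSym d j n * lowSym l n = 0 := by
    rcases le_total ‖n‖ (2 ^ j) with hn | hn
    · rw [bandSym_eq_zero_of_le hn, zero_mul]
    · rw [lowSym_eq_zero ((pow_le_pow_right₀ one_le_two h).trans hn), mul_zero]
  simp [mulOp, h0]

lemma band_low_eq_self {d j l : ℕ} (h : j + d + 1 ≤ l) (f : T2 → ℂ) (x : T2) :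
    mulOp (bandSym d j) (mulOp (lowSym l) f) x = mulOp (bandSym d j) f x := by
  obtain ⟨S, hS⟩ := exists_finset_lowSym l
  rw [mulOp_mulOp hS]
  congr 1
  funext n
  rcases le_total ‖n‖ (2 ^ (j + d + 1)) with hn | hn
  · rw [lowSym_eq_one (hn.trans (pow_le_pow_right₀ one_le_two h)), mul_one]
  · rw [bandSym_eq_zero_of_ge hn, zero_mul]

/-! ### The local square function estimate -/

lemma avg_succ_le {N j : ℕ} {c : ℝ} (hc : 0 < c) {u : T2 → ℝ≥0∞} (hu : Measurable u) {x : T2}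
    (h : ∀ y, u y ≠ 0 → c ≤ 1 + 2 ^ j * dist x y) :
    avg (N + 1) j u x ≤ ENNReal.ofReal c⁻¹ * avg N j u x := by
  unfold avg
  rw [← lintegral_const_mul _ (by fun_prop)]
  refine lintegral_mono fun y => ?_
  rw [← mul_assoc, ← ENNReal.ofReal_mul (by positivity)]
  by_cases hy : u y = 0
  · simp [hy]
  · refine mul_le_mul_left (ENNReal.ofReal_le_ofReal (wt_succ_le hc ?_)) _
    rw [← dist_eq_norm]
    exact h y hy

lemma sum_inv_two_pow_le (S : Finset ℕ) (d : ℕ) {a : ℕ} (h : ∀ j ∈ S, a ≤ j + d) :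
    ∑ j ∈ S, (2⁻¹ : ℝ≥0∞) ^ (j + d - a) ≤ 2 := by
  classical
  have hinj : Set.InjOn (fun j => j + d - a) S := fun i hi j hj hij => by
    have := h i hi
    have := h j hj
    simp only at hij
    omega
  rw [← Finset.sum_image (f := fun i => (2⁻¹ : ℝ≥0∞) ^ i) hinj]
  refine (ENNReal.sum_le_tsum _).trans_eq ?_
  rw [ENNReal.tsum_geometric, ENNReal.one_sub_inv_two, inv_inv]

lemma avg_le_of_near {N : ℕ} (hN : 3 ≤ N) {j : ℕ} {F : T2 → ℝ≥0∞} (hF : Measurable F)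
    {x z : T2} (h : dist x z ≤ 2 * (2 ^ j)⁻¹) {lam : ℝ≥0∞} (hz : maxFn F z ≤ lam) :
    avg N j F x ≤ 3 ^ N * 16 * lam := by
  calc avg N j F x ≤ ENNReal.ofReal ((1 + 2) ^ N) * avg N j F z :=
        avg_le_of_dist_le zero_le_two h hF
    _ ≤ ENNReal.ofReal ((1 + 2) ^ N) * (16 * lam) :=
        mul_le_mul_right ((avg_le_maxFn hN j hF z).trans (mul_le_mul_right hz _)) _
    _ = 3 ^ N * 16 * lam := by
        rw [ENNReal.ofReal_pow (by norm_num), show (1 + 2 : ℝ) = 3 by norm_num,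
          ENNReal.ofReal_ofNat, mul_assoc]

lemma lintegral_mul_avg_le {l : ℕ} {u Φ : T2 → ℝ≥0∞} (hu : Measurable u) (hΦ : Measurable Φ)
    {V : Set T2} (hV : MeasurableSet V) {B : ℝ≥0∞}
    (h₁ : ∀ y, u y ≠ 0 → closedBall y ((2 ^ (l + 3))⁻¹) ⊆ V) (h₂ : ∀ z ∈ V, avg 4 l u z ≤ B) :
    ∫⁻ y, u y * avg 4 l Φ y ≤ 2 ^ 18 * B * ∫⁻ z in V, maxFn Φ z := by
  set r : ℝ := (2 ^ (l + 3))⁻¹ with hr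
  have hr0 : 0 ≤ r := by positivity
  have hrl : r ≤ 1 * (2 ^ l)⁻¹ := by
    rw [one_mul, hr, inv_le_inv₀ (by positivity) (by positivity)]
    exact pow_le_pow_right₀ one_le_two (by omega)
  have hpt (y : T2) : u y * avg 4 l Φ y ≤ ∫⁻ z,
      2 ^ 18 * (V.indicator (maxFn Φ) z * (ENNReal.ofReal (wt 4 l (z - y)) * u y)) := by
    by_cases hy : u y = 0
    · simp [hy]
    calc u y * avg 4 l Φ y
        = 64 * 4 ^ l * (u y * avg 4 l Φ y) * ENNReal.ofReal (r ^ 2) := by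
          have : 64 * 4 ^ l * ENNReal.ofReal (r ^ 2) = 1 := by
            rw [show (64 * 4 ^ l : ℝ≥0∞) = ENNReal.ofReal (64 * 4 ^ l) by
              rw [ENNReal.ofReal_mul (by norm_num), ENNReal.ofReal_pow (by norm_num),
                ENNReal.ofReal_ofNat, ENNReal.ofReal_ofNat],
              ← ENNReal.ofReal_mul (by positivity), hr, pow_add,
              show (4 : ℝ) ^ l = (2 ^ l) ^ 2 by rw [← pow_mul, mul_comm, pow_mul]; norm_num]
            rw [← ENNReal.ofReal_one]
            congr 1
            field_simp
            norm_num
          rw [mul_right_comm, this, one_mul]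
      _ ≤ 64 * 4 ^ l * (u y * avg 4 l Φ y) * volume (closedBall y r) :=
          mul_le_mul_right (le_volume_closedBall y r hr0
            (inv_le_one_of_one_le₀ (one_le_pow₀ one_le_two))) _
      _ = ∫⁻ _ in closedBall y r, 64 * 4 ^ l * (u y * avg 4 l Φ y) := (setLIntegral_const _ _).symm
      _ ≤ ∫⁻ z in closedBall y r,
            2 ^ 18 * (V.indicator (maxFn Φ) z * (ENNReal.ofReal (wt 4 l (z - y)) * u y)) := by
          refine setLIntegral_mono' measurableSet_closedBall fun z hz => ?_
          have hyz : dist y z ≤ 1 * (2 ^ l)⁻¹ := by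
            rw [dist_comm]
            exact (mem_closedBall.1 hz).trans hrl
          have hw : (4 : ℝ≥0∞) ^ l ≤ 2 ^ 4 * ENNReal.ofReal (wt 4 l (z - y)) := by
            have := wt_le_of_norm_le (N := 4) (j := l) zero_le_one (x := 0) (z := z - y) (by
              rwa [zero_sub, neg_sub, ← dist_eq_norm])
            have h4 := ENNReal.ofReal_le_ofReal this
            rw [ENNReal.ofReal_mul (by positivity), wt, norm_zero, mul_zero, add_zero, one_pow,
              div_one, one_add_one_eq_two, ENNReal.ofReal_pow (by norm_num),
              ENNReal.ofReal_pow (by norm_num), ENNReal.ofReal_ofNat, ENNReal.ofReal_ofNat] at h4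
            exact h4
          have hA : avg 4 l Φ y ≤ 2 ^ 4 * (16 * maxFn Φ z) := by
            refine (avg_le_of_dist_le zero_le_one hyz hΦ).trans ?_
            rw [one_add_one_eq_two, ENNReal.ofReal_pow (by norm_num), ENNReal.ofReal_ofNat]
            exact mul_le_mul_right (avg_le_maxFn (by norm_num) l hΦ z) _
          rw [indicator_of_mem (h₁ y hy hz)]
          calc 64 * 4 ^ l * (u y * avg 4 l Φ y)
              ≤ 64 * (2 ^ 4 * ENNReal.ofReal (wt 4 l (z - y))) *
                (u y * (2 ^ 4 * (16 * maxFn Φ z))) :=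
                mul_le_mul' (mul_le_mul_right hw _) (mul_le_mul_right hA _)
            _ = (64 * 2 ^ 4 * 2 ^ 4 * 16) *
                (maxFn Φ z * (ENNReal.ofReal (wt 4 l (z - y)) * u y)) := by ring
            _ = _ := by norm_num
      _ ≤ _ := setLIntegral_le_lintegral _ _
  have hind : Measurable (V.indicator (maxFn Φ)) := (measurable_maxFn hΦ).indicator hV
  refine (lintegral_mono hpt).trans ?_
  rw [lintegral_lintegral_swap (by fun_prop), mul_assoc]
  have hz (z : T2) : ∫⁻ y, 2 ^ 18 * (V.indicator (maxFn Φ) z *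
      (ENNReal.ofReal (wt 4 l (z - y)) * u y)) ≤ 2 ^ 18 * (B * V.indicator (maxFn Φ) z) := by
    rw [lintegral_const_mul _ (by fun_prop), lintegral_const_mul _ (by fun_prop)]
    refine mul_le_mul_right ?_ _
    by_cases hzV : z ∈ V
    · rw [mul_comm]
      exact mul_le_mul_left (h₂ z hzV) _
    · simp [hzV]
  refine (lintegral_mono hz).trans_eq ?_
  rw [lintegral_const_mul _ (by fun_prop), lintegral_const_mul _ hind, lintegral_indicator hV]

/-- The set of points whose distance to `Z` is about `2^{-l}`. -/
def shell (Z : Set T2) (l : ℕ) : Set T2 :=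
  {y | (2 ^ (l + 1))⁻¹ < infDist y Z ∧ infDist y Z ≤ (2 ^ l)⁻¹}

lemma measurableSet_shell (Z : Set T2) (l : ℕ) : MeasurableSet (shell Z l) :=
  (measurableSet_lt measurable_const measurable_infDist).inter
    (measurableSet_le measurable_infDist measurable_const)

lemma sum_indicator_shell_le (Z : Set T2) (F : T2 → ℝ≥0∞) (S : Finset ℕ) (y : T2) :
    ∑ l ∈ S, (shell Z l).indicator F y ≤ F y := by
  by_cases h : ∃ l ∈ S, y ∈ shell Z l
  · obtain ⟨l, hl, hy⟩ := h
    rw [Finset.sum_eq_single_of_mem l hl]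
    · exact indicator_le_self _ _ _
    · intro m _ hm
      refine indicator_of_notMem (fun hym => hm ?_) _
      have h1 : (2 ^ (l + 1) : ℝ)⁻¹ < (2 ^ m)⁻¹ := hy.1.trans_le hym.2
      have h2 : (2 ^ (m + 1) : ℝ)⁻¹ < (2 ^ l)⁻¹ := hym.1.trans_le hy.2
      rw [inv_lt_inv₀ (by positivity) (by positivity),
        pow_lt_pow_iff_right₀ (one_lt_two (α := ℝ))] at h1 h2
      omega
  · push Not at h
    rw [Finset.sum_eq_zero fun l hl => indicator_of_notMem (h l hl) _]
    exact zero_le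

/-- Whitney-type packing: integrals over shells are controlled by the maximal function on `W`. -/
lemma sum_lintegral_shell_le {F : T2 → ℝ≥0∞} (hF : Measurable F) {lam : ℝ≥0∞} {Z : Set T2}
    (hZ : Z.Nonempty) (hFZ : ∀ z ∈ Z, maxFn F z ≤ lam) {W E : Set T2} (hW : MeasurableSet W)
    (hE : MeasurableSet E) (hEW : ∀ y ∈ E, closedBall y (infDist y Z / 4) ⊆ W) (L : ℕ)
    {Φ : T2 → ℝ≥0∞} (hΦ : Measurable Φ) :
    ∑ l ∈ Finset.range L, ∫⁻ y, (shell Z l).indicator (E.indicator F) y * avg 4 l Φ y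
      ≤ 2 ^ 30 * lam * ∫⁻ z in W, maxFn Φ z := by
  set V : ℕ → Set T2 := fun l => W ∩ {z | 3 * (2 ^ (l + 3))⁻¹ < infDist z Z ∧
    infDist z Z < 10 * (2 ^ (l + 3))⁻¹} with hVdef
  have hVm (l : ℕ) : MeasurableSet (V l) := hW.inter
    ((measurableSet_lt measurable_const measurable_infDist).inter
      (measurableSet_lt measurable_infDist measurable_const))
  have hone (l : ℕ) : ∫⁻ y, (shell Z l).indicator (E.indicator F) y * avg 4 l Φ y
      ≤ 2 ^ 29 * lam * ∫⁻ z, (V l).indicator (maxFn Φ) z := by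
    have h8 : (2 ^ l : ℝ)⁻¹ = 8 * (2 ^ (l + 3))⁻¹ := by rw [pow_add]; field_simp; norm_num
    have h4 : (2 ^ (l + 1) : ℝ)⁻¹ = 4 * (2 ^ (l + 3))⁻¹ := by
      rw [pow_add, pow_add]; field_simp; norm_num
    have hpos : (0 : ℝ) < (2 ^ (l + 3))⁻¹ := by positivity
    refine (lintegral_mul_avg_le ((hF.indicator hE).indicator (measurableSet_shell Z l)) hΦ
      (hVm l) (B := 2 ^ 11 * lam) (fun y hy z hz => ?_) fun z hz => ?_).trans_eq ?_
    · have hy1 : y ∈ shell Z l := by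
        by_contra h
        exact hy (indicator_of_notMem h _)
      have hy2 : y ∈ E := by
        by_contra h
        exact hy (by rw [indicator_of_mem hy1, indicator_of_notMem h])
      have h1 := hy1.1
      have h2 := hy1.2
      rw [h8] at h2
      rw [h4] at h1
      have hd := mem_closedBall.1 hz
      have h3 := infDist_le_infDist_add_dist (s := Z) (x := z) (y := y)
      have h5 := infDist_le_infDist_add_dist (s := Z) (x := y) (y := z)
      rw [dist_comm] at h5
      exact ⟨hEW y hy2 (mem_closedBall.2 (by linarith)), by linarith, by linarith⟩
    · obtain ⟨x₀, hx₀, hd⟩ := (infDist_lt_iff hZ).1 hz.2.2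
      calc avg 4 l _ z ≤ avg 4 l F z :=
            avg_mono (fun y => (indicator_le_self _ _ y).trans (indicator_le_self _ _ y)) z
        _ ≤ 3 ^ 4 * 16 * lam :=
            avg_le_of_near (by norm_num) hF (by rw [h8]; linarith) (hFZ x₀ hx₀)
        _ ≤ 2 ^ 11 * lam := mul_le_mul_left (by norm_num) _
    · rw [lintegral_indicator (hVm l)]
      ring
  refine (Finset.sum_le_sum fun l _ => hone l).trans ?_
  have hm : Measurable (maxFn Φ) := measurable_maxFn hΦ
  rw [← Finset.mul_sum, ← lintegral_finsetSum _ fun l _ => hm.indicator (hVm l),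
    show (2 ^ 30 : ℝ≥0∞) * lam = 2 ^ 29 * lam * 2 by ring, mul_assoc _ 2]
  refine mul_le_mul_right ?_ _
  rw [← lintegral_indicator hW, ← lintegral_const_mul _ (hm.indicator hW)]
  refine lintegral_mono fun z => ?_
  classical
  simp only [indicator_apply]
  rw [← Finset.sum_filter, Finset.sum_const]
  set T := {l ∈ Finset.range L | z ∈ V l} with hT
  rcases T.eq_empty_or_nonempty with h0 | h0
  · simp [h0]
  have hmin := (Finset.mem_filter.1 (T.min'_mem h0)).2
  rw [if_pos hmin.1, nsmul_eq_mul]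
  refine mul_le_mul_left ?_ _
  have hsub : T ⊆ Finset.Ico (T.min' h0) (T.min' h0 + 2) := by
    intro l hl
    rw [Finset.mem_Ico]
    refine ⟨Finset.min'_le _ _ hl, ?_⟩
    have h1 := hmin.2.1.trans (Finset.mem_filter.1 hl).2.2.2
    by_contra! h2
    have h3 : (2 : ℝ) ^ (T.min' h0 + 2 + 3) ≤ 2 ^ (l + 3) :=
      pow_le_pow_right₀ one_le_two (by omega)
    rw [show T.min' h0 + 2 + 3 = T.min' h0 + 3 + 2 by ring, pow_add _ _ 2] at h3
    rw [← div_eq_mul_inv, ← div_eq_mul_inv, div_lt_div_iff₀ (by positivity) (by positivity)] at h1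
    have : (0 : ℝ) < 2 ^ (T.min' h0 + 3) := by positivity
    linarith
  have := Finset.card_le_card hsub
  rw [Nat.card_Ico, add_tsub_cancel_left] at this
  exact_mod_cast this

lemma exists_lintegral_maxFn_sq_le : ∃ C : ℝ≥0, 1 ≤ C ∧ ∀ f : T2 → ℝ≥0∞, Measurable f →
    (∃ B : ℝ≥0, ∀ x, f x ≤ B) → ∫⁻ x, maxFn f x ^ 2 ≤ C * ∫⁻ x, f x ^ 2 := by
  obtain ⟨C, hC⟩ := exists_lintegral_maxFn_rpow_le (p := 2) one_lt_two
  refine ⟨max 1 C, le_max_left _ _, fun f hf hB => ?_⟩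
  have h := hC f hf hB
  simp only [ENNReal.rpow_two] at h
  exact h.trans (mul_le_mul_left (by exact_mod_cast le_max_right _ _) _)

lemma two_mul_mul_le_sq (a b : ℝ≥0∞) : 2 * a * b ≤ a ^ 2 + b ^ 2 := by
  induction a with
  | top => simp
  | coe a =>
    induction b with
    | top => simp
    | coe b => exact_mod_cast two_mul_le_add_sq a b

lemma add_sq_le (a b : ℝ≥0∞) : (a + b) ^ 2 ≤ 2 * (a ^ 2 + b ^ 2) := by
  calc (a + b) ^ 2 = a ^ 2 + b ^ 2 + 2 * a * b := by ring
    _ ≤ a ^ 2 + b ^ 2 + (a ^ 2 + b ^ 2) := add_le_add_right (two_mul_mul_le_sq a b) _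
    _ = _ := by ring

lemma lintegral_avg_le {N : ℕ} (hN : 3 ≤ N) (j : ℕ) {f : T2 → ℝ≥0∞} (hf : Measurable f) :
    ∫⁻ x, avg N j f x ≤ 64 * ∫⁻ x, f x := by
  have h := lintegral_avg_mul (N := N) (j := j) hf (measurable_const (a := (1 : ℝ≥0∞)))
  simp only [mul_one] at h
  rw [h, ← lintegral_const_mul _ hf]
  refine lintegral_mono fun x => ?_
  rw [mul_comm]
  exact mul_le_mul_left (avg_one_le hN j x) _

section Shells

variable {F : T2 → ℝ≥0∞} (hF : Measurable F) {lam : ℝ≥0∞} {Z : Set T2}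
    (hZ : Z.Nonempty) (hFZ : ∀ z ∈ Z, maxFn F z ≤ lam) {W E : Set T2} (hW : MeasurableSet W)
    (hE : MeasurableSet E) (hEW : ∀ y ∈ E, closedBall y (infDist y Z / 4) ⊆ W) (L : ℕ)
include hF hZ hFZ hW hE hEW

lemma sum_lintegral_shell_le_volume :
    ∑ l ∈ Finset.range L, ∫⁻ y, (shell Z l).indicator (E.indicator F) y
      ≤ 2 ^ 36 * lam * volume W := by
  have h := sum_lintegral_shell_le hF hZ hFZ hW hE hEW L (measurable_const (a := (1 : ℝ≥0∞)))
  have h1 : ∫⁻ z in W, maxFn (fun _ => 1) z ≤ 4 * volume W := by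
    rw [← setLIntegral_const]
    exact lintegral_mono fun z => maxFn_one_le z
  have h2 (l : ℕ) : ∫⁻ y, (shell Z l).indicator (E.indicator F) y ≤
      2 ^ 4 * ∫⁻ y, (shell Z l).indicator (E.indicator F) y * avg 4 l (fun _ => 1) y := by
    rw [← lintegral_const_mul' _ _ (by finiteness)]
    refine lintegral_mono fun y => ?_
    have h3 : 1 ≤ 2 ^ 4 * avg 4 l (fun _ => 1) y := by
      refine le_trans ?_ (mul_le_mul_right (le_avg_one 4 l y) _)
      rw [ENNReal.ofReal_inv_of_pos (by positivity), ENNReal.ofReal_pow (by norm_num),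
        ENNReal.ofReal_ofNat, ENNReal.mul_inv_cancel (by norm_num) (by finiteness)]
    calc _ = (shell Z l).indicator (E.indicator F) y * 1 := (mul_one _).symm
      _ ≤ (shell Z l).indicator (E.indicator F) y * (2 ^ 4 * avg 4 l (fun _ => 1) y) :=
        mul_le_mul_right h3 _
      _ = _ := by ring
  calc _ ≤ 2 ^ 4 * ∑ l ∈ Finset.range L,
        ∫⁻ y, (shell Z l).indicator (E.indicator F) y * avg 4 l (fun _ => 1) y := by
        rw [Finset.mul_sum]
        exact Finset.sum_le_sum fun l _ => h2 l
    _ ≤ 2 ^ 4 * (2 ^ 30 * lam * (4 * volume W)) :=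
        mul_le_mul_right (h.trans (mul_le_mul_right h1 _)) _
    _ = _ := by ring

lemma lintegral_sum_avg_shell_sq_le {C : ℝ≥0} (hC1 : 1 ≤ C)
    (hC : ∀ f : T2 → ℝ≥0∞, Measurable f → (∃ B : ℝ≥0, ∀ x, f x ≤ B) →
      ∫⁻ x, maxFn f x ^ 2 ≤ C * ∫⁻ x, f x ^ 2) (hB : ∃ B : ℝ≥0, ∀ x, F x ≤ B) :
    ∫⁻ x, (∑ l ∈ Finset.range L, avg 4 l ((shell Z l).indicator (E.indicator F)) x) ^ 2
      ≤ (C * (2 ^ 30 * lam)) ^ 2 * volume W := by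
  set u : ℕ → T2 → ℝ≥0∞ := fun l => (shell Z l).indicator (E.indicator F) with hu
  have hum (l : ℕ) : Measurable (u l) := (hF.indicator hE).indicator (measurableSet_shell Z l)
  set G : T2 → ℝ≥0∞ := fun x => ∑ l ∈ Finset.range L, avg 4 l (u l) x with hG
  have hGm : Measurable G := Finset.measurable_sum _ fun l _ => measurable_avg 4 l (hum l)
  obtain ⟨B, hB⟩ := hB
  have hGB (x : T2) : G x ≤ (L * (64 * B) : ℝ≥0) := by
    calc G x ≤ ∑ _l ∈ Finset.range L, (64 * B : ℝ≥0∞) :=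
          Finset.sum_le_sum fun l _ => avg_le_of_le (by norm_num) l (fun y =>
            ((indicator_le_self _ _ y).trans (indicator_le_self _ _ y)).trans (hB y)) x
      _ = _ := by simp [Finset.sum_const]
  set I := ∫⁻ x, G x ^ 2 with hI
  have hIfin : I ≠ ⊤ := by
    refine ne_top_of_le_ne_top (b := ∫⁻ _ : T2, ((L * (64 * B) : ℝ≥0) : ℝ≥0∞) ^ 2) ?_
      (lintegral_mono fun x => pow_le_pow_left' (hGB x) 2)
    rw [lintegral_const]
    finiteness
  have h1 : I ≤ 2 ^ 30 * lam * ∫⁻ z in W, maxFn G z := by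
    refine le_trans (le_of_eq ?_) (sum_lintegral_shell_le hF hZ hFZ hW hE hEW L hGm)
    calc I = ∫⁻ x, ∑ l ∈ Finset.range L, avg 4 l (u l) x * G x := by
          refine lintegral_congr fun x => ?_
          rw [sq, ← Finset.sum_mul]
      _ = ∑ l ∈ Finset.range L, ∫⁻ x, avg 4 l (u l) x * G x :=
          lintegral_finsetSum _ fun l _ => (measurable_avg 4 l (hum l)).mul hGm
      _ = _ := Finset.sum_congr rfl fun l _ => lintegral_avg_mul (hum l) hGm
  set t : ℝ≥0∞ := C * (2 ^ 30 * lam) with ht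
  have h2 : 2 * (C * I) ≤ C * I + t ^ 2 * volume W := by
    calc 2 * (C * I) ≤ 2 * (C * (2 ^ 30 * lam * ∫⁻ z in W, maxFn G z)) :=
          mul_le_mul_right (mul_le_mul_right h1 _) _
      _ = ∫⁻ z in W, 2 * t * maxFn G z := by
          rw [lintegral_const_mul _ (measurable_maxFn hGm)]
          ring
      _ ≤ ∫⁻ z in W, (maxFn G z ^ 2 + t ^ 2) := by
          refine lintegral_mono fun z => ?_
          have := two_mul_mul_le_sq (maxFn G z) t
          rwa [mul_right_comm] at this
      _ ≤ (∫⁻ z, maxFn G z ^ 2) + t ^ 2 * volume W := by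
          rw [lintegral_add_right _ measurable_const, setLIntegral_const]
          exact add_le_add_left (setLIntegral_le_lintegral _ _) _
      _ ≤ _ := add_le_add_left (hC G hGm ⟨_, hGB⟩) _
  rw [two_mul] at h2
  have h3 := (ENNReal.add_le_add_iff_left (by finiteness)).1 h2
  refine le_trans ?_ h3
  calc I = 1 * I := (one_mul _).symm
    _ ≤ C * I := mul_le_mul_left (by exact_mod_cast hC1) _

end Shells

/-- The points which are close to `Z` and well inside `W` at scale `2^{-j}`. -/
def reg (Z W : Set T2) (j : ℕ) : Set T2 :=
  {x | ball x (2 * (2 ^ j)⁻¹) ⊆ W ∧ infDist x Z < 2 * (2 ^ j)⁻¹}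

lemma measurableSet_reg (Z W : Set T2) (j : ℕ) : MeasurableSet (reg Z W j) := by
  have h : {x : T2 | ball x (2 * (2 ^ j)⁻¹) ⊆ W} = (thickening (2 * (2 ^ j)⁻¹) Wᶜ)ᶜ := by
    ext x
    simp only [mem_ofPred_eq, mem_compl_iff, mem_thickening_iff, not_exists, not_and, not_lt]
    refine ⟨fun h z hz => ?_, fun h z hz => ?_⟩
    · by_contra! hlt
      exact hz (h (by rwa [mem_ball']))
    · by_contra hzW
      exact (h z hzW).not_gt (by rwa [mem_ball'] at hz)
  refine MeasurableSet.inter (s₁ := {x : T2 | ball x (2 * (2 ^ j)⁻¹) ⊆ W}) ?_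
    (measurableSet_lt measurable_infDist measurable_const)
  rw [h]
  exact isOpen_thickening.measurableSet.compl

/-- The union of the neighbourhoods of `reg Z W j` of radius `2^{-j}`, `j < J`. -/
def regNhd (Z W : Set T2) (J : ℕ) : Set T2 :=
  ⋃ j ∈ Finset.range J, thickening (2 ^ j)⁻¹ (reg Z W j)

lemma measurableSet_regNhd (Z W : Set T2) (J : ℕ) : MeasurableSet (regNhd Z W J) :=
  (isOpen_biUnion fun _ _ => isOpen_thickening).measurableSet

lemma mem_of_mem_reg {Z W : Set T2} {j : ℕ} {x : T2} (h : x ∈ reg Z W j) : x ∈ W :=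
  h.1 (mem_ball_self (by positivity))

lemma closedBall_subset_of_mem_regNhd {Z W : Set T2} {J : ℕ} {y : T2} (hy : y ∈ regNhd Z W J) :
    closedBall y (infDist y Z / 4) ⊆ W := by
  simp only [regNhd, mem_iUnion, mem_thickening_iff] at hy
  obtain ⟨j, -, x, hx, hd⟩ := hy
  refine Subset.trans (closedBall_subset_ball' ?_) hx.1
  have h1 : infDist y Z ≤ infDist x Z + dist y x := infDist_le_infDist_add_dist
  have h2 := hx.2
  have h3 : (0 : ℝ) < (2 ^ j)⁻¹ := by positivity
  linarith

lemma regNhd_subset (Z W : Set T2) (J : ℕ) : regNhd Z W J ⊆ W := fun _ hy =>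
  closedBall_subset_of_mem_regNhd hy
    (mem_closedBall_self (div_nonneg infDist_nonneg (by norm_num)))

section Reg

variable {F : T2 → ℝ≥0∞} (hF : Measurable F) {lam : ℝ≥0∞} {Z W : Set T2}
    (hZ : Z.Nonempty) (hFZ : ∀ z ∈ Z, maxFn F z ≤ lam)
include hF hZ hFZ

lemma avg_le_of_mem_reg {j : ℕ} {x : T2} (hx : x ∈ reg Z W j) :
    avg 3 j F x ≤ 432 * lam := by
  obtain ⟨z, hz, hd⟩ := (infDist_lt_iff hZ).1 hx.2
  exact (avg_le_of_near (by norm_num) hF hd.le (hFZ z hz)).trans (le_of_eq (by norm_num))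

lemma sum_indicator_avg_compl_sq_le (J : ℕ) (x : T2) :
    ∑ j ∈ Finset.range J, (reg Z W j).indicator
        (fun x => avg 4 j ((regNhd Z W J)ᶜ.indicator F) x ^ 2) x
      ≤ 2 * (432 * lam) ^ 2 * W.indicator 1 x := by
  classical
  simp only [indicator_apply (reg Z W _)]
  rw [← Finset.sum_filter]
  set S := (Finset.range J).filter fun j => x ∈ reg Z W j with hS
  rcases S.eq_empty_or_nonempty with h0 | hne
  · rw [h0, Finset.sum_empty]
    exact zero_le
  have hmem := Finset.mem_filter.1 (S.min'_mem hne)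
  rw [indicator_of_mem (mem_of_mem_reg hmem.2)]
  set a := S.min' hne
  calc ∑ j ∈ S, avg 4 j ((regNhd Z W J)ᶜ.indicator F) x ^ 2
      ≤ ∑ j ∈ S, (432 * lam) ^ 2 * (2⁻¹ : ℝ≥0∞) ^ (j + 0 - a) := by
        refine Finset.sum_le_sum fun j hj => ?_
        have haj : a ≤ j := S.min'_le j hj
        have h1 := avg_succ_le (N := 3) (j := j) (c := 2 ^ (j - a)) (by positivity)
          (hF.indicator (measurableSet_regNhd Z W J).compl) (x := x) (fun y hy => by
            have hy' := mem_of_indicator_ne_zero hy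
            have hd : (2 ^ a : ℝ)⁻¹ ≤ dist x y := by
              by_contra! hlt
              refine hy' ?_
              simp only [regNhd, mem_iUnion, mem_thickening_iff]
              exact ⟨a, hmem.1, x, hmem.2, by rwa [dist_comm]⟩
            rw [pow_sub₀ _ two_ne_zero haj]
            have := mul_le_mul_of_nonneg_left hd (by positivity : (0 : ℝ) ≤ 2 ^ j)
            linarith)
        have h2 : avg 3 j ((regNhd Z W J)ᶜ.indicator F) x ≤ 432 * lam :=
          (avg_mono (fun y => indicator_le_self _ _ y) x).trans
            (avg_le_of_mem_reg hF hZ hFZ (Finset.mem_filter.1 hj).2)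
        have h3 : ENNReal.ofReal (2 ^ (j - a))⁻¹ = (2⁻¹ : ℝ≥0∞) ^ (j - a) := by
          rw [ENNReal.ofReal_inv_of_pos (by positivity), ENNReal.ofReal_pow (by norm_num),
            ENNReal.ofReal_ofNat, ENNReal.inv_pow]
        rw [h3] at h1
        calc _ ≤ ((2⁻¹ : ℝ≥0∞) ^ (j - a) * (432 * lam)) ^ 2 :=
              pow_le_pow_left' (h1.trans (mul_le_mul_right h2 _)) 2
          _ = (432 * lam) ^ 2 * ((2⁻¹ : ℝ≥0∞) ^ (j - a) * (2⁻¹ : ℝ≥0∞) ^ (j - a)) := by ring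
          _ ≤ (432 * lam) ^ 2 * ((2⁻¹ : ℝ≥0∞) ^ (j - a) * 1) :=
              mul_le_mul_right (mul_le_mul_right (pow_le_one' (by simp) _) _) _
          _ = _ := by rw [mul_one, add_zero]
    _ ≤ (432 * lam) ^ 2 * 2 := by
        rw [← Finset.mul_sum]
        exact mul_le_mul_right (sum_inv_two_pow_le S 0 fun j hj => S.min'_le j hj) _
    _ = _ := by rw [Pi.one_apply]; ring

omit hF hZ hFZ in
lemma avg_shell_le {d j l : ℕ} (hl : l ≤ j + d) {u : T2 → ℝ≥0∞} (hu : Measurable u)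
    (hsupp : ∀ y, u y ≠ 0 → y ∈ shell Z l) {x : T2} (hx : x ∈ reg Z W j) :
    avg 4 j u x ≤ 8 * 2 ^ d * ((2⁻¹ : ℝ≥0∞) ^ (j + d - l) * avg 3 j u x) := by
  have h1 := avg_succ_le (N := 3) (j := j) (c := 2 ^ (j + d - l) / (8 * 2 ^ d)) (by positivity)
    hu (x := x) (fun y hy => by
      have hs := (hsupp y hy).1
      have h1 : infDist y Z ≤ infDist x Z + dist y x := infDist_le_infDist_add_dist
      have h2 := hx.2
      have e1 : (2 : ℝ) ^ (j + d - l) / (8 * 2 ^ d) = 2 ^ j * (2 ^ (l + 1))⁻¹ / 4 := by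
        rw [pow_sub₀ _ two_ne_zero hl, pow_add, pow_succ]
        field_simp
        norm_num
      have e2 : (2 : ℝ) ^ j * (2 * (2 ^ j)⁻¹) = 2 := by field_simp
      have h3 := mul_le_mul_of_nonneg_left (show (2 ^ (l + 1) : ℝ)⁻¹ - 2 * (2 ^ j)⁻¹ ≤ dist x y by
        rw [dist_comm]; linarith) (by positivity : (0 : ℝ) ≤ 2 ^ j)
      have h4 : (0 : ℝ) ≤ 2 ^ j * dist x y := by positivity
      rw [mul_sub, e2] at h3
      rw [e1]
      linarith)
  refine h1.trans (le_of_eq ?_)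
  rw [inv_div, ENNReal.ofReal_div_of_pos (by positivity), ENNReal.ofReal_mul (by norm_num),
    ENNReal.ofReal_pow (by norm_num), ENNReal.ofReal_pow (by norm_num), ENNReal.ofReal_ofNat,
    ENNReal.ofReal_ofNat, div_eq_mul_inv, ENNReal.inv_pow, mul_assoc]

lemma sum_lintegral_reg_sq_le (d J L : ℕ) {u : ℕ → T2 → ℝ≥0∞} (hu : ∀ l, Measurable (u l))
    (hsupp : ∀ l y, u l y ≠ 0 → y ∈ shell Z l)
    (hsum : ∀ (S : Finset ℕ) y, ∑ l ∈ S, u l y ≤ F y) :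
    ∑ j ∈ Finset.range J, ∫⁻ x in reg Z W j,
        (∑ l ∈ Finset.range L with l ≤ j + d, avg 4 j (u l) x) ^ 2
      ≤ (8 * 2 ^ d) ^ 2 * (432 * lam) * (128 * ∑ l ∈ Finset.range L, ∫⁻ y, u l y) := by
  have hone (j : ℕ) : ∫⁻ x in reg Z W j,
        (∑ l ∈ Finset.range L with l ≤ j + d, avg 4 j (u l) x) ^ 2
      ≤ (8 * 2 ^ d) ^ 2 * (432 * lam) * ∑ l ∈ Finset.range L with l ≤ j + d,
        (2⁻¹ : ℝ≥0∞) ^ (j + d - l) * (64 * ∫⁻ y, u l y) := by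
    set v : T2 → ℝ≥0∞ := fun x => ∑ l ∈ Finset.range L with l ≤ j + d,
      (2⁻¹ : ℝ≥0∞) ^ (j + d - l) * avg 3 j (u l) x with hv
    have hvm : Measurable v := Finset.measurable_sum _ fun l _ =>
      (measurable_avg 3 j (hu l)).const_mul _
    calc _ ≤ ∫⁻ x in reg Z W j, (8 * 2 ^ d) ^ 2 * (432 * lam) * v x := by
          refine setLIntegral_mono (hvm.const_mul _) fun x hx => ?_
          have h1 : ∑ l ∈ Finset.range L with l ≤ j + d, avg 4 j (u l) x ≤ 8 * 2 ^ d * v x := by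
            rw [hv, Finset.mul_sum]
            exact Finset.sum_le_sum fun l hl =>
              avg_shell_le (Finset.mem_filter.1 hl).2 (hu l) (hsupp l) hx
          have h2 : v x ≤ 432 * lam := by
            refine le_trans ?_ (avg_le_of_mem_reg hF hZ hFZ hx)
            calc v x ≤ ∑ l ∈ Finset.range L with l ≤ j + d, avg 3 j (u l) x :=
                  Finset.sum_le_sum fun l _ => mul_le_of_le_one_left' (pow_le_one' (by simp) _)
              _ = avg 3 j (fun y => ∑ l ∈ Finset.range L with l ≤ j + d, u l y) x :=
                  (avg_finset_sum _ hu x).symm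
              _ ≤ _ := avg_mono (fun y => hsum _ y) x
          calc _ ≤ (8 * 2 ^ d * v x) ^ 2 := pow_le_pow_left' h1 2
            _ = (8 * 2 ^ d) ^ 2 * v x * v x := by ring
            _ ≤ (8 * 2 ^ d) ^ 2 * (432 * lam) * v x :=
              mul_le_mul_left (mul_le_mul_right h2 _) _
      _ ≤ ∫⁻ x, (8 * 2 ^ d) ^ 2 * (432 * lam) * v x := setLIntegral_le_lintegral _ _
      _ = (8 * 2 ^ d) ^ 2 * (432 * lam) * ∫⁻ x, v x := lintegral_const_mul _ hvm
      _ ≤ _ := by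
          refine mul_le_mul_right ?_ _
          rw [hv, lintegral_finsetSum _ fun l _ => (measurable_avg 3 j (hu l)).const_mul _]
          refine Finset.sum_le_sum fun l _ => ?_
          rw [lintegral_const_mul _ (measurable_avg 3 j (hu l))]
          exact mul_le_mul_right (lintegral_avg_le le_rfl j (hu l)) _
  refine (Finset.sum_le_sum fun j _ => hone j).trans ?_
  rw [← Finset.mul_sum]
  refine mul_le_mul_right ?_ _
  simp only [Finset.sum_filter]
  rw [Finset.sum_comm, Finset.mul_sum]
  refine Finset.sum_le_sum fun l _ => ?_
  rw [← Finset.sum_filter, ← Finset.sum_mul]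
  calc _ ≤ 2 * (64 * ∫⁻ y, u l y) := mul_le_mul_left
        (sum_inv_two_pow_le _ d fun j hj => (Finset.mem_filter.1 hj).2) _
    _ = _ := by rw [← mul_assoc]; norm_num

end Reg

lemma exists_lintegral_avg_sq_le : ∃ C : ℝ≥0, ∀ (j : ℕ) (v : T2 → ℝ≥0∞), Measurable v →
    (∃ B : ℝ≥0, ∀ x, v x ≤ B) → ∫⁻ x, avg 4 j v x ^ 2 ≤ C * ∫⁻ x, v x ^ 2 := by
  obtain ⟨C, -, hC⟩ := exists_lintegral_maxFn_sq_le
  refine ⟨16 ^ 2 * C, fun j v hv hB => ?_⟩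
  calc ∫⁻ x, avg 4 j v x ^ 2 ≤ ∫⁻ x, 16 ^ 2 * maxFn v x ^ 2 := by
        refine lintegral_mono fun x => ?_
        rw [← mul_pow]
        exact pow_le_pow_left' (avg_le_maxFn (by norm_num) j hv x) 2
    _ = 16 ^ 2 * ∫⁻ x, maxFn v x ^ 2 := lintegral_const_mul _ ((measurable_maxFn hv).pow_const 2)
    _ ≤ 16 ^ 2 * (C * ∫⁻ x, v x ^ 2) := mul_le_mul_right (hC v hv hB) _
    _ = _ := by push_cast; ring

lemma BddMeas.exists_enorm_le {f : T2 → ℂ} (hf : BddMeas f) : ∃ B : ℝ≥0, ∀ x, ‖f x‖ₑ ≤ B := by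
  obtain ⟨-, B, hB⟩ := hf
  exact ⟨B, fun x => by rw [enorm_eq_nnnorm]; exact_mod_cast hB x⟩

lemma BddMeas.measurable_enorm {f : T2 → ℂ} (hf : BddMeas f) : Measurable fun x => ‖f x‖ₑ :=
  hf.1.enorm

lemma exists_enorm_band_sub_le (d : ℕ) : ∃ C : ℝ≥0, ∀ (j l : ℕ) (h : T2 → ℂ), BddMeas h → ∀ x,
    ‖mulOp (bandSym d j) h x - mulOp (bandSym d j) (mulOp (lowSym l) h) x‖ₑ
      ≤ if l ≤ j + d then C * avg 4 j (fun y => ‖h y‖ₑ) x else 0 := by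
  obtain ⟨C₁, h₁⟩ := exists_enorm_band_le d
  obtain ⟨C₂, h₂⟩ := exists_enorm_low_shift_le d
  refine ⟨C₁ + C₁ * (C₂ * (2 ^ 4 * 128)), fun j l h hh x => ?_⟩
  split_ifs with hl
  · refine (enorm_sub_le (E := ℂ)).trans ?_
    push_cast
    rw [add_mul]
    refine add_le_add (h₁ j h hh x) ?_
    rcases le_or_gt j l with hjl | hjl
    · refine (h₁ j _ (.of_continuous (continuous_low l h)) x).trans ?_
      rw [mul_assoc, mul_assoc]
      refine mul_le_mul_right ?_ _
      refine (avg_mono (h₂ j l hjl hl h hh) x).trans ?_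
      rw [avg_const_mul (measurable_avg 4 j hh.measurable_enorm)]
      exact mul_le_mul_right (avg_avg_le (by norm_num) j hh.measurable_enorm x) _
    · rw [band_low_eq_zero hjl, enorm_zero]
      exact zero_le
  · rw [band_low_eq_self (by omega), sub_self, enorm_zero]

lemma exists_avg_band_le (d : ℕ) : ∃ C : ℝ≥0, ∀ (j L : ℕ) (f₀ f₁ f : T2 → ℂ) (h : ℕ → T2 → ℂ),
    BddMeas f₀ → BddMeas f₁ → (∀ l, BddMeas (h l)) →
    (∀ y, f y = f₀ y + (f₁ y + ∑ l ∈ Finset.range L, h l y)) → ∀ x,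
    avg 4 j (fun y => ‖mulOp (bandSym d j) f y‖ₑ) x ≤ C * avg 4 j (fun y => ‖f₀ y‖ₑ) x
      + (avg 4 j (fun y => ‖mulOp (bandSym d j)
          (fun z => f₁ z + ∑ l ∈ Finset.range L, mulOp (lowSym l) (h l) z) y‖ₑ) x
        + C * ∑ l ∈ Finset.range L with l ≤ j + d, avg 4 j (fun y => ‖h l y‖ₑ) x) := by
  obtain ⟨C₁, h₁⟩ := exists_enorm_band_le d
  obtain ⟨C₂, h₂⟩ := exists_enorm_band_sub_le d
  refine ⟨(C₁ + C₂) * (2 ^ 4 * 128), fun j L f₀ f₁ f h hf₀ hf₁ hh hf x => ?_⟩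
  obtain ⟨S, hS⟩ := exists_finset_bandSym d j
  set Q := mulOp (bandSym d j) with hQd
  have hlow (l : ℕ) : BddMeas (mulOp (lowSym l) (h l)) := .of_continuous (continuous_low l _)
  set g : T2 → ℂ := fun z => f₁ z + ∑ l ∈ Finset.range L, mulOp (lowSym l) (h l) z with hg
  have hQ (y : T2) : Q f y = Q f₀ y + (Q g y
      + ∑ l ∈ Finset.range L, (Q (h l) y - Q (mulOp (lowSym l) (h l)) y)) := by
    rw [hQd, funext hf, mulOp_fun_add hS hf₀ (hf₁.add (bddMeas_sum _ hh)),
      mulOp_fun_add hS hf₁ (bddMeas_sum _ hh), mulOp_fun_sum hS _ hh, hg,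
      mulOp_fun_add hS hf₁ (bddMeas_sum _ hlow), mulOp_fun_sum hS _ hlow,
      Finset.sum_sub_distrib]
    ring
  have hm₀ := measurable_avg 4 j hf₀.measurable_enorm
  have hm (l : ℕ) := measurable_avg 4 j (hh l).measurable_enorm
  have hQg : Measurable fun y => ‖Q g y‖ₑ := (continuous_band d j g).measurable.enorm
  set K : ℝ≥0∞ := C₁ + C₂ with hK
  have hK₁ : (C₁ : ℝ≥0∞) ≤ K := le_self_add
  have hK₂ : (C₂ : ℝ≥0∞) ≤ K := le_add_self
  have hpt (y : T2) : ‖Q f y‖ₑ ≤ K * avg 4 j (fun y => ‖f₀ y‖ₑ) y + (‖Q g y‖ₑ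
      + K * ∑ l ∈ Finset.range L with l ≤ j + d, avg 4 j (fun y => ‖h l y‖ₑ) y) := by
    rw [hQ]
    refine (enorm_add_le _ _).trans (add_le_add ((h₁ j f₀ hf₀ y).trans
      (mul_le_mul_left hK₁ _)) ((enorm_add_le _ _).trans (add_le_add le_rfl ?_)))
    refine (enorm_sum_le _ _).trans ?_
    rw [Finset.mul_sum, Finset.sum_filter]
    refine Finset.sum_le_sum fun l _ => (h₂ j l (h l) (hh l) y).trans ?_
    split_ifs
    · exact mul_le_mul_left hK₂ _
    · exact le_rfl
  refine (avg_mono hpt x).trans ?_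
  rw [avg_add (hm₀.const_mul _), avg_add hQg, avg_const_mul hm₀,
    avg_const_mul (Finset.measurable_sum _ fun l _ => hm l), avg_finset_sum _ hm]
  have hKK : (((C₁ + C₂) * (2 ^ 4 * 128) : ℝ≥0) : ℝ≥0∞) = K * (2 ^ 4 * 128) := by
    rw [hK]; push_cast; rfl
  rw [hKK, mul_assoc K, mul_assoc K]
  refine add_le_add (mul_le_mul_right (avg_avg_le (by norm_num) j hf₀.measurable_enorm x) _)
    (add_le_add le_rfl (mul_le_mul_right ?_ _))
  rw [Finset.mul_sum]
  exact Finset.sum_le_sum fun l _ => avg_avg_le (by norm_num) j (hh l).measurable_enorm x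

lemma eq_indicator_add_sum_shell {Z : Set T2} (hZ : Z.Nonempty) (b : T2 → ℂ) (L : ℕ) (y : T2) :
    b y = {y | infDist y Z ≤ (2 ^ L)⁻¹}.indicator b y
      + ∑ l ∈ Finset.range L, (shell Z l).indicator b y := by
  classical
  induction L with
  | zero =>
    obtain ⟨z, hz⟩ := hZ
    have h : infDist y Z ≤ (2 ^ 0)⁻¹ := by
      refine (infDist_le_dist_of_mem hz).trans ?_
      rw [dist_eq_norm]
      exact (norm_le_half _).trans (by norm_num)
    simp only [Finset.range_zero, Finset.sum_empty, add_zero]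
    rw [indicator_of_mem (show y ∈ {y | infDist y Z ≤ (2 ^ 0)⁻¹} from h)]
  | succ L ih =>
    rw [ih, Finset.sum_range_succ]
    have hpow : (2 ^ (L + 1) : ℝ)⁻¹ ≤ (2 ^ L)⁻¹ :=
      inv_anti₀ (by positivity) (pow_le_pow_right₀ one_le_two L.le_succ)
    have : {y | infDist y Z ≤ (2 ^ L)⁻¹}.indicator b y
        = {y | infDist y Z ≤ (2 ^ (L + 1))⁻¹}.indicator b y + (shell Z L).indicator b y := by
      simp only [indicator_apply, shell, mem_ofPred_eq]
      by_cases h1 : infDist y Z ≤ (2 ^ (L + 1))⁻¹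
      · rw [if_pos (h1.trans hpow), if_pos h1, if_neg (fun h => h.1.not_ge h1), add_zero]
      · rw [if_neg h1, zero_add]
        simp [not_le.1 h1]
    rw [this]
    ring

lemma exists_enorm_le_of_infDist_le {f : T2 → ℂ} (hf : Continuous f) {lam : ℝ≥0} (h0 : lam ≠ 0)
    {Z : Set T2} (hZ : Z.Nonempty) (hFZ : ∀ z ∈ Z, maxFn (fun y => ‖f y‖ₑ) z ≤ lam) :
    ∃ L : ℕ, ∀ y, infDist y Z ≤ (2 ^ L)⁻¹ → ‖f y‖ₑ ≤ 2 * lam := by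
  obtain ⟨δ, hδ, h⟩ := Metric.uniformContinuous_iff.1
    (CompactSpace.uniformContinuous_of_continuous hf) lam (by positivity)
  obtain ⟨L, hL⟩ := exists_pow_lt_of_lt_one hδ (show (2⁻¹ : ℝ) < 1 by norm_num)
  refine ⟨L, fun y hy => ?_⟩
  rw [inv_pow] at hL
  obtain ⟨z, hz, hd⟩ := (infDist_lt_iff hZ).1 (hy.trans_lt hL)
  have h1 : ‖f y - f z‖ₑ ≤ lam := by
    have := (h hd).le
    rw [dist_eq_norm] at this
    rw [enorm_eq_nnnorm]
    exact_mod_cast this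
  calc ‖f y‖ₑ = ‖(f y - f z) + f z‖ₑ := by rw [sub_add_cancel]
    _ ≤ ‖f y - f z‖ₑ + ‖f z‖ₑ := enorm_add_le _ _
    _ ≤ lam + lam := add_le_add h1 ((le_maxFn hf.enorm z).trans (hFZ z hz))
    _ = _ := (two_mul _).symm

lemma add_add_sq_le (a b c : ℝ≥0∞) : (a + (b + c)) ^ 2 ≤ 2 * a ^ 2 + (4 * b ^ 2 + 4 * c ^ 2) := by
  calc (a + (b + c)) ^ 2 ≤ 2 * (a ^ 2 + (b + c) ^ 2) := add_sq_le _ _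
    _ ≤ 2 * (a ^ 2 + 2 * (b ^ 2 + c ^ 2)) := mul_le_mul_right (add_le_add le_rfl (add_sq_le _ _)) _
    _ = _ := by ring

lemma exists_sum_lintegral_reg_le (d : ℕ) : ∃ C : ℝ≥0, ∀ f : T2 → ℂ, Continuous f →
    ∀ lam : ℝ≥0, lam ≠ 0 → ∀ Z : Set T2, Z.Nonempty →
    (∀ z ∈ Z, maxFn (fun y => ‖f y‖ₑ) z ≤ lam) → ∀ W : Set T2, MeasurableSet W → ∀ J : ℕ,
    ∑ j ∈ Finset.range J, ∫⁻ x in reg Z W j,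
        avg 4 j (fun y => ‖mulOp (bandSym d j) f y‖ₑ) x ^ 2 ≤ C * lam ^ 2 * volume W := by
  obtain ⟨C₁, h₁⟩ := exists_avg_band_le d
  obtain ⟨C₂, hC₂, h₂⟩ := exists_lintegral_maxFn_sq_le
  obtain ⟨C₃, h₃⟩ := exists_enorm_low_le
  obtain ⟨C₄, h₄⟩ := exists_lintegral_avg_sq_le
  refine ⟨2 * C₁ ^ 2 * (2 * 432 ^ 2)
    + (4 * (C₄ * ((d + 1) * (2 * (4 + C₃ ^ 2 * (C₂ * 2 ^ 30) ^ 2))))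
      + 4 * C₁ ^ 2 * ((8 * 2 ^ d) ^ 2 * 432 * (128 * 2 ^ 36))), fun f hf lam h0 Z hZ hFZ W hW J => ?_⟩
  set F : T2 → ℝ≥0∞ := fun y => ‖f y‖ₑ with hFdef
  have hF : Measurable F := hf.enorm.measurable
  have hfb := BddMeas.of_continuous hf
  set E := regNhd Z W J
  have hE : MeasurableSet E := measurableSet_regNhd Z W J
  have hEW : ∀ y ∈ E, closedBall y (infDist y Z / 4) ⊆ W := fun y =>
    closedBall_subset_of_mem_regNhd
  obtain ⟨L, hL⟩ := exists_enorm_le_of_infDist_le hf h0 hZ hFZ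
  set b := E.indicator f with hb
  have hbb : BddMeas b := hfb.indicator hE
  set N : Set T2 := {y | infDist y Z ≤ (2 ^ L)⁻¹}
  have hN : MeasurableSet N := measurableSet_le measurable_infDist measurable_const
  set h : ℕ → T2 → ℂ := fun l => (shell Z l).indicator b with hh
  have hhb (l : ℕ) : BddMeas (h l) := hbb.indicator (measurableSet_shell Z l)
  set u : ℕ → T2 → ℝ≥0∞ := fun l => (shell Z l).indicator (E.indicator F) with hu
  have hhu (l : ℕ) : (fun y => ‖h l y‖ₑ) = u l := by
    ext y
    simp only [hh, hu, hb, hFdef, enorm_indicator_eq_indicator_enorm]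
  have hum (l : ℕ) : Measurable (u l) := (hF.indicator hE).indicator (measurableSet_shell Z l)
  have husum (S : Finset ℕ) (y : T2) : ∑ l ∈ S, u l y ≤ F y :=
    (sum_indicator_shell_le Z _ S y).trans (indicator_le_self _ _ y)
  have hdec (y : T2) : f y = Eᶜ.indicator f y
      + (N.indicator b y + ∑ l ∈ Finset.range L, h l y) := by
    rw [← eq_indicator_add_sum_shell hZ b L y, hb, add_comm, ← Pi.add_apply,
      indicator_self_add_compl]
  set g : T2 → ℂ := fun z => N.indicator b z + ∑ l ∈ Finset.range L, mulOp (lowSym l) (h l) z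
    with hg
  have hgb : BddMeas g := (hbb.indicator hN).add
    (bddMeas_sum _ fun l => .of_continuous (continuous_low l _))
  set G : T2 → ℝ≥0∞ := fun y => ∑ l ∈ Finset.range L, avg 4 l (u l) y
  have hGm : Measurable G := Finset.measurable_sum _ fun l _ => measurable_avg 4 l (hum l)
  have hW1 : ∫⁻ x, W.indicator (1 : T2 → ℝ≥0∞) x = volume W := lintegral_indicator_one hW
  have hWm : Measurable (W.indicator (1 : T2 → ℝ≥0∞)) := measurable_one.indicator hW
  have hgsq : ∫⁻ x, ‖g x‖ₑ ^ 2
      ≤ 2 * (4 + C₃ ^ 2 * (C₂ * 2 ^ 30) ^ 2) * (lam ^ 2 * volume W) := by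
    have hpt (y : T2) : ‖g y‖ₑ ^ 2
        ≤ 2 * (4 * lam ^ 2) * W.indicator 1 y + 2 * C₃ ^ 2 * G y ^ 2 := by
      have e1 : ‖N.indicator b y‖ₑ ≤ 2 * lam * W.indicator 1 y := by
        rw [enorm_indicator_eq_indicator_enorm]
        refine indicator_apply_le' (fun hy => ?_) (fun _ => zero_le)
        rw [hb, enorm_indicator_eq_indicator_enorm]
        refine indicator_apply_le' (fun hyE => ?_) (fun _ => zero_le)
        rw [indicator_of_mem (regNhd_subset Z W J hyE), Pi.one_apply, mul_one]
        exact hL y hy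
      have e2 : ‖∑ l ∈ Finset.range L, mulOp (lowSym l) (h l) y‖ₑ ≤ C₃ * G y := by
        refine (enorm_sum_le _ _).trans ?_
        rw [Finset.mul_sum]
        refine Finset.sum_le_sum fun l _ => ?_
        rw [← hhu l]
        exact h₃ l (h l) (hhb l) y
      calc ‖g y‖ₑ ^ 2 ≤ (2 * lam * W.indicator 1 y + C₃ * G y) ^ 2 :=
            pow_le_pow_left' ((enorm_add_le _ _).trans (add_le_add e1 e2)) 2
        _ ≤ 2 * ((2 * lam * W.indicator 1 y) ^ 2 + (C₃ * G y) ^ 2) := add_sq_le _ _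
        _ = 2 * (4 * lam ^ 2) * W.indicator 1 y ^ 2 + 2 * C₃ ^ 2 * G y ^ 2 := by ring
        _ = _ := by
          congr 2
          by_cases hy : y ∈ W <;> simp [hy]
    refine (lintegral_mono hpt).trans ?_
    rw [lintegral_add_left (hWm.const_mul _), lintegral_const_mul _ hWm, hW1,
      lintegral_const_mul _ (hGm.pow_const 2)]
    have hGsq := lintegral_sum_avg_shell_sq_le hF hZ hFZ hW hE hEW L hC₂ h₂ hfb.exists_enorm_le
    refine (add_le_add le_rfl (mul_le_mul_right hGsq _)).trans (le_of_eq ?_)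
    ring
  have hfar : ∑ j ∈ Finset.range J, ∫⁻ x in reg Z W j, avg 4 j (Eᶜ.indicator F) x ^ 2
      ≤ 2 * (432 * lam) ^ 2 * volume W := by
    have hm (j : ℕ) : Measurable fun x => avg 4 j (Eᶜ.indicator F) x ^ 2 :=
      (measurable_avg 4 j (hF.indicator hE.compl)).pow_const 2
    simp_rw [← lintegral_indicator (measurableSet_reg Z W _)]
    rw [← lintegral_finsetSum _ fun j _ => (hm j).indicator (measurableSet_reg Z W j), ← hW1,
      ← lintegral_const_mul _ hWm]
    exact lintegral_mono fun x => sum_indicator_avg_compl_sq_le hF hZ hFZ J x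
  have hbad := sum_lintegral_reg_sq_le (W := W) hF hZ hFZ d J L hum
    (fun l y hy => mem_of_indicator_ne_zero hy) husum
  have hvol := sum_lintegral_shell_le_volume hF hZ hFZ hW hE hEW L
  have hgood : ∑ j ∈ Finset.range J, ∫⁻ x in reg Z W j,
      avg 4 j (fun y => ‖mulOp (bandSym d j) g y‖ₑ) x ^ 2
      ≤ C₄ * ((d + 1) * (2 * (4 + C₃ ^ 2 * (C₂ * 2 ^ 30) ^ 2) * (lam ^ 2 * volume W))) := by
    calc _ ≤ ∑ j ∈ Finset.range J, C₄ * ∫⁻ x, ‖mulOp (bandSym d j) g x‖ₑ ^ 2 := by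
          refine Finset.sum_le_sum fun j _ => (setLIntegral_le_lintegral _ _).trans ?_
          have := BddMeas.of_continuous (continuous_band d j g)
          exact h₄ j _ this.measurable_enorm this.exists_enorm_le
      _ ≤ C₄ * ((d + 1) * ∫⁻ x, ‖g x‖ₑ ^ 2) := by
          rw [← Finset.mul_sum]
          exact mul_le_mul_right (sum_lintegral_band_sq_le d J hgb) _
      _ ≤ _ := mul_le_mul_right (mul_le_mul_right hgsq _) _
  have hone (j : ℕ) : ∫⁻ x in reg Z W j, avg 4 j (fun y => ‖mulOp (bandSym d j) f y‖ₑ) x ^ 2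
      ≤ 2 * C₁ ^ 2 * (∫⁻ x in reg Z W j, avg 4 j (Eᶜ.indicator F) x ^ 2)
        + (4 * (∫⁻ x in reg Z W j, avg 4 j (fun y => ‖mulOp (bandSym d j) g y‖ₑ) x ^ 2)
        + 4 * C₁ ^ 2 * ∫⁻ x in reg Z W j,
          (∑ l ∈ Finset.range L with l ≤ j + d, avg 4 j (u l) x) ^ 2) := by
    have m1 : Measurable fun x => avg 4 j (Eᶜ.indicator F) x ^ 2 :=
      (measurable_avg 4 j (hF.indicator hE.compl)).pow_const 2
    have m2 : Measurable fun x => avg 4 j (fun y => ‖mulOp (bandSym d j) g y‖ₑ) x ^ 2 :=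
      (measurable_avg 4 j (continuous_band d j g).enorm.measurable).pow_const 2
    have m3 : Measurable fun x =>
        (∑ l ∈ Finset.range L with l ≤ j + d, avg 4 j (u l) x) ^ 2 :=
      (Finset.measurable_sum _ fun l _ => measurable_avg 4 j (hum l)).pow_const 2
    rw [← lintegral_const_mul _ m1, ← lintegral_const_mul _ m2, ← lintegral_const_mul _ m3,
      ← lintegral_add_left (m2.const_mul _), ← lintegral_add_left (m1.const_mul _)]
    refine lintegral_mono fun x => ?_
    have := h₁ j L (Eᶜ.indicator f) (N.indicator b) f h (hfb.indicator hE.compl)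
      (hbb.indicator hN) hhb hdec x
    simp only [hhu, enorm_indicator_eq_indicator_enorm] at this
    refine (pow_le_pow_left' this 2).trans ((add_add_sq_le _ _ _).trans (le_of_eq ?_))
    rw [mul_pow, mul_pow, mul_assoc, mul_assoc]
  refine (Finset.sum_le_sum fun j _ => hone j).trans ?_
  rw [Finset.sum_add_distrib, Finset.sum_add_distrib, ← Finset.mul_sum, ← Finset.mul_sum,
    ← Finset.mul_sum]
  refine (add_le_add (mul_le_mul_right hfar _) (add_le_add (mul_le_mul_right hgood _)
    (mul_le_mul_right (hbad.trans (mul_le_mul_right (mul_le_mul_right hvol _) _)) _))).trans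
    (le_of_eq ?_)
  push_cast
  ring

/-- The infimum over the ball of radius `2^{1-j}`. -/
def locInf (j : ℕ) (H : T2 → ℝ≥0∞) (x : T2) : ℝ≥0∞ := ⨅ z ∈ ball x (2 * (2 ^ j)⁻¹), H z

lemma locInf_le (j : ℕ) (H : T2 → ℝ≥0∞) {x z : T2} (hz : z ∈ ball x (2 * (2 ^ j)⁻¹)) :
    locInf j H x ≤ H z := iInf₂_le z hz

lemma locInf_le_self (j : ℕ) (H : T2 → ℝ≥0∞) (x : T2) : locInf j H x ≤ H x :=
  locInf_le j H (mem_ball_self (by positivity))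

lemma measurable_locInf (j : ℕ) (H : T2 → ℝ≥0∞) : Measurable (locInf j H) := by
  refine measurable_of_Iio fun t => ?_
  have : locInf j H ⁻¹' Iio t = thickening (2 * (2 ^ j)⁻¹) {z | H z < t} := by
    ext x
    simp only [mem_preimage, mem_Iio, locInf, iInf_lt_iff, mem_thickening_iff, mem_ball',
      mem_ofPred_eq]
    exact ⟨fun ⟨z, h1, h2⟩ => ⟨z, h2, h1⟩, fun ⟨z, h1, h2⟩ => ⟨z, h2, h1⟩⟩
  rw [this]
  exact isOpen_thickening.measurableSet

lemma prod_locInf_le {κ : Type*} (S : Finset κ) (j : ℕ) (H : κ → T2 → ℝ≥0∞) (x : T2) :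
    ∏ m ∈ S, locInf j (H m) x ≤ locInf j (fun z => ∏ m ∈ S, H m z) x :=
  le_iInf₂ fun _ hz => Finset.prod_le_prod' fun m _ => locInf_le j (H m) hz

lemma avg_le_locInf {N : ℕ} (hN : 3 ≤ N) (j : ℕ) {f : T2 → ℝ≥0∞} (hf : Measurable f) (x : T2) :
    avg N j f x ≤ 3 ^ N * 16 * locInf j (maxFn f) x := by
  simp only [locInf, ENNReal.mul_iInf_of_ne (show (3 ^ N * 16 : ℝ≥0∞) ≠ 0 by positivity)
    (by finiteness)]
  exact le_iInf₂ fun z hz => avg_le_of_near hN hf (mem_ball'.1 hz).le le_rfl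

lemma lintegral_le_maxFn (f : T2 → ℝ≥0∞) (x : T2) : ∫⁻ y, f y ≤ maxFn f x := by
  refine le_trans (le_of_eq ?_) (le_iSup _ 0)
  have : closedBall x ((2 ^ 0 : ℝ)⁻¹) = univ := by
    refine eq_univ_of_forall fun y => ?_
    rw [mem_closedBall, dist_eq_norm]
    exact (norm_le_half _).trans (by norm_num)
  rw [this, Measure.restrict_univ, pow_zero, one_mul]

lemma div_mul_le_tsum {F μ v : ℝ≥0∞} {c : ℤ → ℝ≥0∞} {t : ℤ → ℤ → ℝ≥0∞} (h0 : μ ≠ 0) (hμ : μ ≠ ⊤)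
    (hv : v ≠ ⊤) (ht : ∀ m n : ℤ, (2 : ℝ≥0∞) ^ m < μ → μ ≤ 2 * 2 ^ m → (2 : ℝ≥0∞) ^ n < v →
      F ≤ t m n ∧ (2 ^ m : ℝ≥0∞)⁻¹ ≤ c m) :
    F / μ * v ≤ ∑' m : ℤ, ∑' n : ℤ, 2 * (c m * 2 ^ n * t m n) := by
  rcases eq_or_ne v 0 with rfl | hv0
  · simp
  obtain ⟨m, hm1, hm2⟩ := exists_zpow_lt_le h0 hμ
  obtain ⟨n, hn1, hn2⟩ := exists_zpow_lt_le hv0 hv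
  obtain ⟨h1, h2⟩ := ht m n hm1 hm2 hn1
  calc F / μ * v ≤ t m n * c m * (2 * 2 ^ n) := by
        rw [div_eq_mul_inv]
        exact mul_le_mul' (mul_le_mul' h1 ((ENNReal.inv_le_inv.2 hm1.le).trans h2)) hn2
    _ = 2 * (c m * 2 ^ n * t m n) := by ring
    _ ≤ ∑' n : ℤ, 2 * (c m * 2 ^ n * t m n) :=
        ENNReal.le_tsum (f := fun n : ℤ => 2 * (c m * 2 ^ n * t m n)) n
    _ ≤ _ := ENNReal.le_tsum (f := fun m : ℤ => ∑' n : ℤ, 2 * (c m * 2 ^ n * t m n)) m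

lemma mul_mul_indicator_inter (a b : ℝ≥0∞) (P Q : T2 → Prop) [DecidablePred P] [DecidablePred Q]
    (x : T2) : a * b * ({x | P x} ∩ {x | Q x}).indicator 1 x
      = (if P x then a else 0) * (if Q x then b else 0) := by
  by_cases hP : P x <;> by_cases hQ : Q x <;> simp [hP, hQ]

lemma exists_sum_lintegral_carleson_le (d : ℕ) : ∃ C : ℝ≥0, ∀ f : T2 → ℂ, Continuous f →
    ∫⁻ y, ‖f y‖ₑ ≠ 0 → ∀ V : T2 → ℝ≥0∞, Measurable V → (∀ x, V x ≠ ⊤) → ∀ J : ℕ,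
    ∑ j ∈ Finset.range J, ∫⁻ x, avg 4 j (fun y => ‖mulOp (bandSym d j) f y‖ₑ) x ^ 2
        / locInf j (maxFn fun y => ‖f y‖ₑ) x * locInf j V x
      ≤ C * ∫⁻ x, maxFn (fun y => ‖f y‖ₑ) x * V x := by
  classical
  obtain ⟨C, hC⟩ := exists_sum_lintegral_reg_le d
  obtain ⟨K, hK⟩ := exists_tsum_zpow_lt_le one_pos
  simp only [ENNReal.rpow_one] at hK
  refine ⟨2 * (16 * C) * K ^ 2, fun f hf hf0 V hV hVfin J => ?_⟩
  set M : T2 → ℝ≥0∞ := maxFn fun y => ‖f y‖ₑ with hM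
  have hMm : Measurable M := measurable_maxFn hf.enorm.measurable
  have hfb := BddMeas.of_continuous hf
  have hMfin (x : T2) : M x ≠ ⊤ := by
    obtain ⟨B, hB⟩ := hfb.exists_enorm_le
    exact ne_top_of_le_ne_top (by finiteness) (maxFn_le_of_le hB x)
  set Z : ℤ → Set T2 := fun m => {z | M z ≤ 4 * 2 ^ m} with hZ
  set W : ℤ → ℤ → Set T2 := fun m n => {x | 2 ^ m < M x} ∩ {x | 2 ^ n < V x} with hW
  have hWm (m n : ℤ) : MeasurableSet (W m n) :=
    (measurableSet_lt measurable_const hMm).inter (measurableSet_lt measurable_const hV)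
  set c : ℤ → ℝ≥0∞ := fun m => if (Z m).Nonempty then (2 ^ m)⁻¹ else 0 with hc
  set A : ℕ → T2 → ℝ≥0∞ := fun j x => avg 4 j (fun y => ‖mulOp (bandSym d j) f y‖ₑ) x ^ 2
    with hA
  have hAm (j : ℕ) : Measurable (A j) :=
    (measurable_avg 4 j (continuous_band d j f).enorm.measurable).pow_const 2
  have hRm (m n : ℤ) (j : ℕ) : MeasurableSet (reg (Z m) (W m n) j) := measurableSet_reg _ _ _
  have h2 (m : ℤ) : (2 : ℝ≥0∞) ^ m ≠ 0 := (ENNReal.zpow_pos (by norm_num) (by norm_num) m).ne'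
  have h2' (m : ℤ) : (2 : ℝ≥0∞) ^ m ≠ ⊤ := ENNReal.zpow_ne_top (by norm_num) (by norm_num) m
  have hpt (j : ℕ) (x : T2) : A j x / locInf j M x * locInf j V x
      ≤ ∑' m : ℤ, ∑' n : ℤ, 2 * (c m * 2 ^ n * (reg (Z m) (W m n) j).indicator (A j) x) := by
    refine div_mul_le_tsum ?_ ?_ ?_ fun m n hm1 hm2 hn => ?_
    · refine fun h => hf0 (le_antisymm ?_ zero_le)
      rw [← h]
      exact le_iInf₂ fun z _ => lintegral_le_maxFn _ z
    · exact ne_top_of_le_ne_top (hMfin x) (locInf_le_self j M x)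
    · exact ne_top_of_le_ne_top (hVfin x) (locInf_le_self j V x)
    · have hlt : locInf j M x < 4 * 2 ^ m := hm2.trans_lt (by
        rw [show (4 : ℝ≥0∞) = 2 * 2 by norm_num, mul_assoc]
        have h3 : (2 : ℝ≥0∞) * 2 ^ m ≠ 0 := mul_ne_zero (by norm_num) (h2 m)
        have h4 : (2 : ℝ≥0∞) * 2 ^ m ≠ ⊤ := ENNReal.mul_ne_top (by norm_num) (h2' m)
        calc 2 * 2 ^ m < 2 * 2 ^ m + 2 * 2 ^ m := ENNReal.lt_add_right h4 h3
          _ = _ := (two_mul _).symm)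
      simp only [locInf, iInf_lt_iff] at hlt
      obtain ⟨z, hz, hzlt⟩ := hlt
      have hne : (Z m).Nonempty := ⟨z, hzlt.le⟩
      refine ⟨?_, by simp only [hc, if_pos hne, le_refl]⟩
      rw [indicator_of_mem]
      refine ⟨fun y hy => ⟨hm1.trans_le (locInf_le j M hy), hn.trans_le (locInf_le j V hy)⟩, ?_⟩
      exact (infDist_lt_iff hne).2 ⟨z, hzlt.le, mem_ball'.1 hz⟩
  have hkey (m n : ℤ) : c m * 2 ^ n * ∑ j ∈ Finset.range J, ∫⁻ x in reg (Z m) (W m n) j, A j x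
      ≤ 16 * C * (2 ^ m * 2 ^ n * volume (W m n)) := by
    by_cases hne : (Z m).Nonempty
    · have h := hC f hf (4 * 2 ^ m) (by positivity) (Z m) hne
        (fun z hz => by
          push_cast [ENNReal.coe_zpow (two_ne_zero (α := ℝ≥0))]
          exact hz) (W m n) (hWm m n) J
      push_cast [ENNReal.coe_zpow (two_ne_zero (α := ℝ≥0))] at h
      simp only [hc, if_pos hne]
      refine (mul_le_mul_right h _).trans (le_of_eq ?_)
      calc _ = 16 * C * (((2 ^ m)⁻¹ * 2 ^ m) * 2 ^ m * 2 ^ n * volume (W m n)) := by ring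
        _ = _ := by rw [ENNReal.inv_mul_cancel (h2 m) (h2' m), one_mul]
    · simp only [hc, if_neg hne, zero_mul]
      exact zero_le
  have hW1 (m n : ℤ) (x : T2) : (2 : ℝ≥0∞) ^ m * 2 ^ n * (W m n).indicator 1 x
      = (if 2 ^ m < M x then 2 ^ m else 0) * (if 2 ^ n < V x then 2 ^ n else 0) :=
    mul_mul_indicator_inter _ _ _ _ x
  calc _ ≤ ∑ j ∈ Finset.range J, ∑' m : ℤ, ∑' n : ℤ,
        2 * (c m * 2 ^ n * ∫⁻ x in reg (Z m) (W m n) j, A j x) := by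
        refine Finset.sum_le_sum fun j _ => (lintegral_mono (hpt j)).trans (le_of_eq ?_)
        have hm (m n : ℤ) : Measurable fun x =>
            2 * (c m * 2 ^ n * (reg (Z m) (W m n) j).indicator (A j) x) :=
          (((hAm j).indicator (hRm m n j)).const_mul _).const_mul _
        rw [lintegral_tsum fun m => (Measurable.tsum fun n => hm m n).aemeasurable]
        refine tsum_congr fun m => ?_
        rw [lintegral_tsum fun n => (hm m n).aemeasurable]
        refine tsum_congr fun n => ?_
        rw [lintegral_const_mul _ (((hAm j).indicator (hRm m n j)).const_mul _),
          lintegral_const_mul _ ((hAm j).indicator (hRm m n j)), lintegral_indicator (hRm m n j)]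
    _ = ∑' m : ℤ, ∑' n : ℤ,
        2 * (c m * 2 ^ n * ∑ j ∈ Finset.range J, ∫⁻ x in reg (Z m) (W m n) j, A j x) := by
        simp only [Finset.mul_sum]
        refine (Summable.tsum_finsetSum fun _ _ => ENNReal.summable).symm.trans
          (tsum_congr fun m => ?_)
        exact (Summable.tsum_finsetSum fun _ _ => ENNReal.summable).symm
    _ ≤ ∑' m : ℤ, ∑' n : ℤ, 2 * (16 * C * (2 ^ m * 2 ^ n * volume (W m n))) :=
        ENNReal.tsum_le_tsum fun m => ENNReal.tsum_le_tsum fun n => mul_le_mul_right (hkey m n) _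
    _ = 2 * (16 * C) * ∑' m : ℤ, ∑' n : ℤ, ∫⁻ x, (2 : ℝ≥0∞) ^ m * 2 ^ n * (W m n).indicator 1 x := by
        simp only [← ENNReal.tsum_mul_left]
        refine tsum_congr fun m => tsum_congr fun n => ?_
        rw [lintegral_const_mul _ (measurable_one.indicator (hWm m n)),
          lintegral_indicator_one (hWm m n)]
        ring
    _ = 2 * (16 * C) * ∫⁻ x, ∑' m : ℤ, ∑' n : ℤ,
          (2 : ℝ≥0∞) ^ m * 2 ^ n * (W m n).indicator 1 x := by
        have hm (m n : ℤ) : Measurable fun x => (2 : ℝ≥0∞) ^ m * 2 ^ n * (W m n).indicator 1 x :=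
          (measurable_one.indicator (hWm m n)).const_mul _
        rw [lintegral_tsum fun m => (Measurable.tsum fun n => hm m n).aemeasurable]
        congr 1
        refine tsum_congr fun m => ?_
        rw [lintegral_tsum fun n => (hm m n).aemeasurable]
    _ ≤ 2 * (16 * C) * ∫⁻ x, K ^ 2 * (M x * V x) := by
        refine mul_le_mul_right (lintegral_mono fun x => ?_) _
        simp only [hW1, ENNReal.tsum_mul_left, ENNReal.tsum_mul_right]
        calc _ ≤ K * M x * (K * V x) := mul_le_mul' (hK _) (hK _)
          _ = _ := by ring
    _ = _ := by
        rw [lintegral_const_mul (f := fun x => M x * V x) _ (hMm.mul hV)]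
        push_cast
        ring

/-! ### Dyadic decomposition of the symbol -/

section Symbol

variable {ι : Type*} [Fintype ι]

/-- Smooth truncation of a symbol to frequencies of size at most about `2^l`. -/
def truncSym (l : ℕ) (σ : (ι → ℝ × ℝ) → ℂ) (ξ : ι → ℝ × ℝ) : ℂ :=
  cut ι (((2 : ℝ) ^ l)⁻¹ • ξ) * σ ξ

/-- The part of a symbol on frequencies of size about `2^l`. -/
def pieceSym (l : ℕ) (σ : (ι → ℝ × ℝ) → ℂ) (ξ : ι → ℝ × ℝ) : ℂ :=
  (cut ι (((2 : ℝ) ^ (l + 1))⁻¹ • ξ) - cut ι (((2 : ℝ) ^ l)⁻¹ • ξ)) * σ ξ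

lemma norm_inv_pow_smul (l : ℕ) (ξ : ι → ℝ × ℝ) :
    ‖((2 : ℝ) ^ l)⁻¹ • ξ‖ = (2 ^ l)⁻¹ * ‖ξ‖ := by
  rw [norm_smul, Real.norm_of_nonneg (by positivity)]

lemma cut_inv_pow_eq_one {l : ℕ} {ξ : ι → ℝ × ℝ} (h : ‖ξ‖ ≤ 2 ^ l) :
    cut ι (((2 : ℝ) ^ l)⁻¹ • ξ) = 1 := by
  apply cut_eq_one
  rw [norm_inv_pow_smul, inv_mul_eq_div]
  exact div_le_one_of_le₀ h (by positivity)

lemma cut_inv_pow_eq_zero {l : ℕ} {ξ : ι → ℝ × ℝ} (h : 2 ^ (l + 1) ≤ ‖ξ‖) :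
    cut ι (((2 : ℝ) ^ l)⁻¹ • ξ) = 0 := by
  apply cut_eq_zero
  rw [norm_inv_pow_smul, inv_mul_eq_div, le_div_iff₀ (by positivity), ← pow_succ']
  exact h

lemma truncSym_eq_zero {l : ℕ} {σ : (ι → ℝ × ℝ) → ℂ} {ξ : ι → ℝ × ℝ} (h : 2 ^ (l + 1) ≤ ‖ξ‖) :
    truncSym l σ ξ = 0 := by
  rw [truncSym, cut_inv_pow_eq_zero h, zero_mul]

lemma truncSym_eq_self {l : ℕ} {σ : (ι → ℝ × ℝ) → ℂ} {ξ : ι → ℝ × ℝ} (h : ‖ξ‖ ≤ 2 ^ l) :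
    truncSym l σ ξ = σ ξ := by
  rw [truncSym, cut_inv_pow_eq_one h, one_mul]

lemma norm_truncSym_le (l : ℕ) (σ : (ι → ℝ × ℝ) → ℂ) (ξ : ι → ℝ × ℝ) :
    ‖truncSym l σ ξ‖ ≤ ‖σ ξ‖ := by
  rw [truncSym, norm_mul]
  exact mul_le_of_le_one_left (norm_nonneg _) (norm_cut_le _)

lemma pieceSym_eq_zero_of_ge {l : ℕ} {σ : (ι → ℝ × ℝ) → ℂ} {ξ : ι → ℝ × ℝ}
    (h : 2 ^ (l + 2) ≤ ‖ξ‖) : pieceSym l σ ξ = 0 := by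
  rw [pieceSym, cut_inv_pow_eq_zero h, cut_inv_pow_eq_zero (le_trans _ h), sub_zero, zero_mul]
  exact pow_le_pow_right₀ one_le_two (by lia)

lemma pieceSym_eq_zero_of_le {l : ℕ} {σ : (ι → ℝ × ℝ) → ℂ} {ξ : ι → ℝ × ℝ}
    (h : ‖ξ‖ ≤ 2 ^ l) : pieceSym l σ ξ = 0 := by
  rw [pieceSym, cut_inv_pow_eq_one h, cut_inv_pow_eq_one (h.trans _), sub_self, zero_mul]
  exact pow_le_pow_right₀ one_le_two (by lia)

lemma truncSym_eq_add_sum (c J : ℕ) (σ : (ι → ℝ × ℝ) → ℂ) (ξ : ι → ℝ × ℝ) :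
    truncSym (c + J) σ ξ = truncSym c σ ξ + ∑ j ∈ Finset.range J, pieceSym (c + j) σ ξ := by
  have h := Finset.sum_range_sub (fun j => truncSym (c + j) σ ξ) J
  simp only [add_zero] at h
  rw [eq_comm, ← eq_sub_iff_add_eq', ← h]
  refine Finset.sum_congr rfl fun j _ => ?_
  rw [pieceSym, truncSym, truncSym, sub_mul, add_assoc]

lemma contDiff_cut_smul (c : ℝ) : ContDiff ℝ (⊤ : ℕ∞) fun ξ : ι → ℝ × ℝ => cut ι (c • ξ) :=
  (contDiff_cut ι).comp (contDiff_const_smul c)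

lemma contDiff_truncSym {σ : (ι → ℝ × ℝ) → ℂ} (hσ : ContDiff ℝ (⊤ : ℕ∞) σ) (l : ℕ) :
    ContDiff ℝ (⊤ : ℕ∞) (truncSym l σ) :=
  (contDiff_cut_smul _).mul hσ

lemma contDiff_pieceSym {σ : (ι → ℝ × ℝ) → ℂ} (hσ : ContDiff ℝ (⊤ : ℕ∞) σ) (l : ℕ) :
    ContDiff ℝ (⊤ : ℕ∞) (pieceSym l σ) :=
  ((contDiff_cut_smul _).sub (contDiff_cut_smul _)).mul hσ

lemma norm_iteratedFDeriv_mul_le_of_le {h σ : (ι → ℝ × ℝ) → ℂ} (hh : ContDiff ℝ (⊤ : ℕ∞) h)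
    (hσ : ContDiff ℝ (⊤ : ℕ∞) σ) {A B : ℕ → ℝ} {r : ℝ} {ξ : ι → ℝ × ℝ}
    (hA : ∀ i, ‖iteratedFDeriv ℝ i h ξ‖ ≤ A i * r ^ i)
    (hB : ∀ i, ‖iteratedFDeriv ℝ i σ ξ‖ ≤ B i * r ^ i) (m : ℕ) :
    ‖iteratedFDeriv ℝ m (fun η => h η * σ η) ξ‖
      ≤ (∑ i ∈ Finset.range (m + 1), m.choose i * A i * B (m - i)) * r ^ m := by
  refine (norm_iteratedFDeriv_mul_le hh hσ ξ (by exact_mod_cast le_top)).trans ?_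
  rw [Finset.sum_mul]
  refine Finset.sum_le_sum fun i hi => ?_
  have hi' : i ≤ m := Nat.lt_succ_iff.1 (Finset.mem_range.1 hi)
  have hr : r ^ m = r ^ i * r ^ (m - i) := by rw [← pow_add, Nat.add_sub_cancel' hi']
  calc _ ≤ m.choose i * (A i * r ^ i) * (B (m - i) * r ^ (m - i)) := by
        gcongr
        exacts [mul_nonneg (Nat.cast_nonneg _) ((norm_nonneg _).trans (hA i)), hA i, hB _]
    _ = _ := by rw [hr]; ring

lemma exists_norm_ker_symbol_le {σ : (ι → ℝ × ℝ) → ℂ} (hσ : ContDiff ℝ (⊤ : ℕ∞) σ)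
    (hder : ∀ j : ℕ, ∃ Cj : ℝ, ∀ ξ : ι → ℝ × ℝ,
        ‖iteratedFDeriv ℝ j σ ξ‖ ≤ Cj * (1 + ‖ξ‖) ^ (-(j : ℝ))) (N c : ℕ) :
    ∃ C : ℝ, 0 ≤ C ∧ (∀ y, ‖ker (truncSym c σ) y‖ ≤ C * ∏ i, wt N 0 (y i)) ∧
      ∀ j y, ‖ker (pieceSym (c + j) σ) y‖ ≤ C * ∏ i, wt N j (y i) := by
  choose D hD using hder
  obtain ⟨B, hB0, hB⟩ := exists_norm_iteratedFDeriv_cut_le ι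
  have hD0 (i : ℕ) : 0 ≤ D i := by
    have := (norm_nonneg _).trans (hD i 0)
    simpa using this
  have hle (j i : ℕ) {ξ : ι → ℝ × ℝ} (h : 2 ^ j ≤ 1 + ‖ξ‖) :
      ‖iteratedFDeriv ℝ i σ ξ‖ ≤ D i * ((2 ^ j)⁻¹) ^ i := by
    refine (hD i ξ).trans (mul_le_mul_of_nonneg_left ?_ (hD0 i))
    rw [Real.rpow_neg (by positivity), Real.rpow_natCast, ← inv_pow]
    gcongr
  have hcut (l j i : ℕ) (hl : j ≤ l) (ξ : ι → ℝ × ℝ) :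
      ‖iteratedFDeriv ℝ i (fun η => cut ι (((2 : ℝ) ^ l)⁻¹ • η)) ξ‖ ≤ B i * ((2 ^ j)⁻¹) ^ i := by
    refine (hB i _ ξ).trans (mul_le_mul_of_nonneg_left ?_ (hB0 i))
    rw [abs_of_nonneg (by positivity)]
    gcongr
    exact one_le_two
  obtain ⟨C, hC0, hC⟩ := exists_norm_ker_le_prod_wt ι N (C := 2 ^ (c + 2)) (by positivity)
    fun m => ∑ i ∈ Finset.range (m + 1), m.choose i * (2 * B i) * D (m - i)
  refine ⟨C, hC0, fun y => ?_, fun j y => ?_⟩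
  · refine hC 0 _ (contDiff_truncSym hσ c) (fun ξ h => truncSym_eq_zero (le_trans ?_ h))
      (fun m ξ => ?_) y
    · rw [pow_zero, mul_one]
      exact pow_le_pow_right₀ one_le_two (by lia)
    · refine norm_iteratedFDeriv_mul_le_of_le (contDiff_cut_smul _) hσ (fun i => ?_)
        (fun i => hle 0 i ?_) m
      · refine (hcut c 0 i (by lia) ξ).trans ?_
        gcongr
        linarith [hB0 i]
      · rw [pow_zero]
        linarith [norm_nonneg ξ]
  · refine hC j _ (contDiff_pieceSym hσ _) (fun ξ h => pieceSym_eq_zero_of_ge (le_trans ?_ h))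
      (fun m ξ => ?_) y
    · rw [← pow_add]
      exact pow_le_pow_right₀ one_le_two (by lia)
    · rcases lt_or_ge ‖ξ‖ (2 ^ (c + j)) with h | h
      · have h0 : pieceSym (c + j) σ =ᶠ[nhds ξ] fun _ => 0 := by
          filter_upwards [continuous_norm.continuousAt.eventually_lt_const h] with η hη
          exact pieceSym_eq_zero_of_le hη.le
        rw [h0.iteratedFDeriv ℝ m |>.eq_of_nhds, iteratedFDeriv_fun_zero, Pi.zero_apply, norm_zero]
        refine mul_nonneg (Finset.sum_nonneg fun i _ => ?_) (by positivity)
        have := hB0 i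
        have := hD0 (m - i)
        positivity
      · refine norm_iteratedFDeriv_mul_le_of_le
          ((contDiff_cut_smul _).sub (contDiff_cut_smul _)) hσ (fun i => ?_)
          (fun i => hle j i ?_) m
        · rw [fun_iteratedFDeriv_sub_apply]
          · refine (norm_sub_le _ _).trans ?_
            rw [two_mul, add_mul]
            exact add_le_add (hcut _ j i (by lia) ξ) (hcut _ j i (by lia) ξ)
          all_goals exact ((contDiff_cut_smul _).of_le (by exact_mod_cast le_top)).contDiffAt
        · have : (2 : ℝ) ^ j ≤ 2 ^ (c + j) := pow_le_pow_right₀ one_le_two (by lia)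
          linarith

end Symbol

/-! ### The dual multilinear form -/

section Form

variable {ι : Type*} [Fintype ι]

/-- The multilinear form dual to `multOp s`. -/
def form (s : (ι → ℝ × ℝ) → ℂ) (F : Option ι → T2 → ℂ) : ℂ :=
  ∫ x, multOp s (fun i => F (some i)) x * F none x

/-- Adds the frequency making the sum of all frequencies zero. -/
def close (n : ι → ℤ × ℤ) : Option ι → ℤ × ℤ := fun o => o.elim (-∑ i, n i) n

lemma sum_close (n : ι → ℤ × ℤ) : ∑ o, close n o = 0 := by
  simp [Fintype.sum_option, close]

lemma form_eq_sum {s : (ι → ℝ × ℝ) → ℂ} {R : ℝ} (hs : ∀ ξ, R ≤ ‖ξ‖ → s ξ = 0)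
    {F : Option ι → T2 → ℂ} (hF : BddMeas (F none)) :
    form s F = ∑ n ∈ box ι R, s (lat n) * ∏ o, fCoeff (F o) (close n o) := by
  have h0 (n) (hn : n ∉ box ι R) : s (lat n) = 0 := by
    refine hs _ ?_
    by_contra! h
    exact hn (mem_box h.le)
  have hm (x : T2) : multOp s (fun i => F (some i)) x * F none x = ∑ n ∈ box ι R,
      s (lat n) * (∏ i, fCoeff (F (some i)) (n i)) * (fChar (-(-∑ i, n i)) x * F none x) := by
    rw [multOp, tsum_eq_sum (s := box ι R) (fun n hn => by rw [h0 n hn, zero_mul, zero_mul]),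
      Finset.sum_mul]
    exact Finset.sum_congr rfl fun n _ => by rw [neg_neg, mul_assoc _ (fChar _ x)]
  simp_rw [form, hm]
  rw [integral_finsetSum _ fun n _ => (((bddMeas_fChar _).mul hF).integrable.const_mul _)]
  refine Finset.sum_congr rfl fun n _ => ?_
  rw [integral_const_mul, Fintype.prod_option, mul_assoc, mul_comm (∏ i, _)]
  rfl

lemma form_eq_zero {s : (ι → ℝ × ℝ) → ℂ} {R : ℝ} (hs : ∀ ξ, R ≤ ‖ξ‖ → s ξ = 0)
    {F : Option ι → T2 → ℂ} (hF : BddMeas (F none))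
    (h : ∀ n, s (lat n) ≠ 0 → ∃ o, fCoeff (F o) (close n o) = 0) : form s F = 0 := by
  rw [form_eq_sum hs hF]
  refine Finset.sum_eq_zero fun n _ => ?_
  by_cases hn : s (lat n) = 0
  · rw [hn, zero_mul]
  · obtain ⟨o, ho⟩ := h n hn
    rw [Finset.prod_eq_zero (Finset.mem_univ o) ho, mul_zero]

lemma form_truncSym (c J : ℕ) (σ : (ι → ℝ × ℝ) → ℂ) {F : Option ι → T2 → ℂ}
    (hF : BddMeas (F none)) :
    form (truncSym (c + J) σ) F
      = form (truncSym c σ) F + ∑ j ∈ Finset.range J, form (pieceSym (c + j) σ) F := by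
  have hle {l : ℕ} (h : l ≤ c + J + 1) : (2 : ℝ) ^ l ≤ 2 ^ (c + J + 1) :=
    pow_le_pow_right₀ one_le_two h
  rw [form_eq_sum (R := 2 ^ (c + J + 1)) (fun ξ h => truncSym_eq_zero h) hF,
    form_eq_sum (R := 2 ^ (c + J + 1)) (fun ξ h => truncSym_eq_zero ((hle (by lia)).trans h)) hF,
    Finset.sum_congr rfl fun j hj => form_eq_sum (R := 2 ^ (c + J + 1)) (fun ξ h =>
      pieceSym_eq_zero_of_ge ((hle (by have := Finset.mem_range.1 hj; lia)).trans h)) hF,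
    Finset.sum_comm, ← Finset.sum_add_distrib]
  refine Finset.sum_congr rfl fun n _ => ?_
  rw [truncSym_eq_add_sum, add_mul, Finset.sum_mul]

variable [DecidableEq ι]

/-- High frequency pieces of the functions with index in `S`, low frequency pieces of the
others. -/
def lpPiece (d j : ℕ) (S : Finset (Option ι)) (F : Option ι → T2 → ℂ) (o : Option ι) : T2 → ℂ :=
  mulOp (if o ∈ S then bandSym d j else lowSym j) (F o)

omit [Fintype ι] in
lemma continuous_lpPiece (d j : ℕ) (S : Finset (Option ι)) (F : Option ι → T2 → ℂ)
    (o : Option ι) : Continuous (lpPiece d j S F o) := by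
  rw [lpPiece]
  split_ifs
  exacts [continuous_band _ _ _, continuous_low _ _]

omit [Fintype ι] in
lemma fCoeff_lpPiece (d j : ℕ) (S : Finset (Option ι)) (F : Option ι → T2 → ℂ)
    (o : Option ι) (n : ℤ × ℤ) :
    fCoeff (lpPiece d j S F o) n
      = (if o ∈ S then bandSym d j n else lowSym j n) * fCoeff (F o) n := by
  rw [lpPiece]
  split_ifs
  · exact fCoeff_mulOp (exists_finset_bandSym d j).choose_spec _ _
  · exact fCoeff_mulOp (exists_finset_lowSym j).choose_spec _ _

lemma form_eq_sum_lpPiece {s : (ι → ℝ × ℝ) → ℂ} {R : ℝ} (hs : ∀ ξ, R ≤ ‖ξ‖ → s ξ = 0)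
    {F : Option ι → T2 → ℂ} (hF : BddMeas (F none)) {d j : ℕ}
    (h : ∀ n, s (lat n) ≠ 0 → ∀ o, ‖close n o‖ ≤ 2 ^ (j + d)) :
    form s F = ∑ S, form s (lpPiece d j S F) := by
  rw [form_eq_sum hs hF,
    Finset.sum_congr rfl fun S _ => form_eq_sum hs (.of_continuous (continuous_lpPiece d j S F _)),
    Finset.sum_comm]
  refine Finset.sum_congr rfl fun n _ => ?_
  by_cases hn : s (lat n) = 0
  · simp [hn]
  rw [← Finset.mul_sum]
  congr 1
  have h1 (o : Option ι) : fCoeff (F o) (close n o) = bandSym d j (close n o) *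
      fCoeff (F o) (close n o) + lowSym j (close n o) * fCoeff (F o) (close n o) := by
    rw [bandSym, lowSym_eq_one (h n hn o)]
    ring
  rw [Finset.prod_congr rfl fun o _ => h1 o, Fintype.prod_add]
  refine Finset.sum_congr rfl fun S _ => ?_
  rw [← Finset.prod_mul_prod_compl S fun o => fCoeff (lpPiece d j S F o) (close n o)]
  congr 1
  · exact Finset.prod_congr rfl fun o ho => by rw [fCoeff_lpPiece, if_pos ho]
  · exact Finset.prod_congr rfl fun o ho => by
      rw [fCoeff_lpPiece, if_neg (Finset.mem_compl.1 ho)]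

omit [DecidableEq ι] in
lemma norm_close_le {n : ι → ℤ × ℤ} {r : ℝ} (h : ‖n‖ ≤ r) (o : Option ι) :
    ‖close n o‖ ≤ (Fintype.card ι + 1) * r := by
  have hr : 0 ≤ r := (norm_nonneg _).trans h
  have hi (i : ι) : ‖n i‖ ≤ r := (norm_le_pi_norm n i).trans h
  cases o with
  | none =>
    calc ‖-∑ i, n i‖ ≤ ∑ i, ‖n i‖ := by rw [norm_neg]; exact norm_sum_le _ _
      _ ≤ ∑ _i : ι, r := Finset.sum_le_sum fun i _ => hi i
      _ ≤ _ := by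
        rw [Finset.sum_const, Finset.card_univ, nsmul_eq_mul]
        linarith
  | some i =>
    refine (hi i).trans ?_
    nlinarith [(Nat.cast_nonneg (Fintype.card ι) : (0 : ℝ) ≤ _)]

lemma norm_le_of_norm_close_le {n : ι → ℤ × ℤ} {r : ℝ} (hr : 0 ≤ r) {S : Finset (Option ι)}
    (hS : S.card ≤ 1) (h : ∀ o ∉ S, ‖close n o‖ ≤ r) : ‖n‖ ≤ Fintype.card ι * r := by
  refine (pi_norm_le_iff_of_nonneg (by positivity)).2 fun i => ?_
  by_cases hi : some i ∈ S
  · have h1 : n i = -∑ o ∈ Finset.univ.erase (some i), close n o := by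
      rw [eq_neg_iff_add_eq_zero, ← sum_close n,
        ← Finset.add_sum_erase _ _ (Finset.mem_univ (some i))]
      rfl
    rw [h1, norm_neg]
    refine (norm_sum_le_of_le _ fun o ho => h o fun hoS => ?_).trans_eq (b := ∑ o ∈ Finset.univ.erase (some i), r) ?_
    · exact Finset.ne_of_mem_erase ho (Finset.card_le_one.1 hS o hoS _ hi)
    · rw [Finset.sum_const, Finset.card_erase_of_mem (Finset.mem_univ _), Finset.card_univ,
        Fintype.card_option, Nat.add_sub_cancel, nsmul_eq_mul]
  · refine (h _ hi).trans ?_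
    have : (1 : ℝ) ≤ Fintype.card ι := by exact_mod_cast Fintype.card_pos_iff.2 ⟨i⟩
    nlinarith

lemma form_lpPiece_eq_zero (j d : ℕ) (σ : (ι → ℝ × ℝ) → ℂ) (F : Option ι → T2 → ℂ)
    {S : Finset (Option ι)} (hS : S.card ≤ 1) :
    form (pieceSym (Fintype.card ι + 1 + j) σ) (lpPiece d j S F) = 0 := by
  refine form_eq_zero (fun ξ => pieceSym_eq_zero_of_ge) (.of_continuous
    (continuous_lpPiece d j S F _)) fun n hn => ?_
  by_contra! h
  refine hn (pieceSym_eq_zero_of_le ?_)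
  rw [norm_lat]
  refine (norm_le_of_norm_close_le (r := 2 ^ (j + 1)) (by positivity) hS fun o ho => ?_).trans ?_
  · have := h o
    rw [fCoeff_lpPiece, if_neg ho] at this
    by_contra! h1
    rw [lowSym_eq_zero h1.le, zero_mul] at this
    exact this rfl
  · have h1 : ((Fintype.card ι : ℕ) : ℝ) ≤ 2 ^ Fintype.card ι := by
      exact_mod_cast Nat.lt_two_pow_self.le
    calc (Fintype.card ι : ℝ) * 2 ^ (j + 1) ≤ 2 ^ Fintype.card ι * 2 ^ (j + 1) := by gcongr
      _ = _ := by ring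

lemma form_pieceSym_eq_sum_lpPiece (j : ℕ) (σ : (ι → ℝ × ℝ) → ℂ) {F : Option ι → T2 → ℂ}
    (hF : BddMeas (F none)) :
    form (pieceSym (Fintype.card ι + 1 + j) σ) F
      = ∑ S, form (pieceSym (Fintype.card ι + 1 + j) σ)
          (lpPiece (2 * Fintype.card ι + 4) j S F) := by
  refine form_eq_sum_lpPiece (fun ξ => pieceSym_eq_zero_of_ge) hF fun n hn o => ?_
  have h1 : ‖n‖ ≤ 2 ^ (Fintype.card ι + 1 + j + 2) := by
    by_contra! h
    exact hn (pieceSym_eq_zero_of_ge (by rw [norm_lat]; exact h.le))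
  refine (norm_close_le h1 o).trans ?_
  have h2 : ((Fintype.card ι : ℕ) : ℝ) + 1 ≤ 2 ^ (Fintype.card ι + 1) := by
    exact_mod_cast Nat.lt_two_pow_self.le
  calc ((Fintype.card ι : ℝ) + 1) * 2 ^ (Fintype.card ι + 1 + j + 2)
      ≤ 2 ^ (Fintype.card ι + 1) * 2 ^ (Fintype.card ι + 1 + j + 2) := by gcongr
    _ = _ := by ring

end Form

section Form

variable {ι : Type*} [Fintype ι]

/-- The local infimum of the maximal function. -/
def locMax (j : ℕ) (f : T2 → ℂ) (x : T2) : ℝ≥0∞ := locInf j (maxFn fun y => ‖f y‖ₑ) x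

lemma maxFn_ne_top {f : T2 → ℂ} (hf : BddMeas f) (x : T2) : maxFn (fun y => ‖f y‖ₑ) x ≠ ⊤ := by
  obtain ⟨B, hB⟩ := hf.exists_enorm_le
  exact ne_top_of_le_ne_top (by finiteness) (maxFn_le_of_le hB x)

lemma locMax_ne_top (j : ℕ) {f : T2 → ℂ} (hf : BddMeas f) (x : T2) : locMax j f x ≠ ⊤ :=
  ne_top_of_le_ne_top (maxFn_ne_top hf x) (locInf_le_self j _ x)

lemma locMax_ne_zero (j : ℕ) {f : T2 → ℂ} (hf : ∫⁻ y, ‖f y‖ₑ ≠ 0) (x : T2) :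
    locMax j f x ≠ 0 := by
  have h : ∫⁻ y, ‖f y‖ₑ ≤ locMax j f x := le_iInf₂ fun z _ => lintegral_le_maxFn _ z
  exact fun h0 => hf (le_zero_iff.1 (h0 ▸ h))

lemma mul_le_div_mul_add_div_mul {x y a b : ℝ≥0∞} (ha : a ≠ 0) (ha' : a ≠ ⊤) (hb : b ≠ 0)
    (hb' : b ≠ ⊤) : x * y ≤ x ^ 2 / a * b + y ^ 2 / b * a := by
  rcases le_total (x * b) (y * a) with h | h
  · refine le_trans ?_ le_add_self
    calc x * y = y * (x * b) / b := by
          rw [← mul_assoc, ENNReal.mul_div_cancel_right hb hb', mul_comm]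
      _ ≤ y * (y * a) / b := ENNReal.div_le_div_right (mul_le_mul_right h _) _
      _ = _ := by rw [div_eq_mul_inv, div_eq_mul_inv]; ring
  · refine le_trans ?_ le_self_add
    calc x * y = x * (y * a) / a := by
          rw [← mul_assoc, ENNReal.mul_div_cancel_right ha ha']
      _ ≤ x * (x * b) / a := ENNReal.div_le_div_right (mul_le_mul_right h _) _
      _ = _ := by rw [div_eq_mul_inv, div_eq_mul_inv]; ring

/-- If two of the factors are distinguished, a product is controlled by square functions. -/
lemma prod_le_sum_sq_div {κ : Type*} [Fintype κ] [DecidableEq κ] {u v : κ → ℝ≥0∞} {C : ℝ≥0∞}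
    (hC : 1 ≤ C) (huv : ∀ o, u o ≤ C * v o) (h0 : ∀ o, v o ≠ 0) (ht : ∀ o, v o ≠ ⊤)
    {a b : κ} (hab : a ≠ b) :
    ∏ o, u o ≤ C ^ Fintype.card κ * (u a ^ 2 / v a * ∏ o ∈ Finset.univ.erase a, v o
      + u b ^ 2 / v b * ∏ o ∈ Finset.univ.erase b, v o) := by
  have hb : b ∈ Finset.univ.erase a := by simp [hab.symm]
  have ha : a ∈ Finset.univ.erase b := by simp [hab]
  set T := (Finset.univ.erase a).erase b with hT
  have hT' : (Finset.univ.erase b).erase a = T := Finset.erase_right_comm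
  have hp : ∏ o ∈ T, u o ≤ C ^ Fintype.card κ * ∏ o ∈ T, v o := by
    refine (Finset.prod_le_prod' fun o _ => huv o).trans ?_
    rw [Finset.prod_mul_distrib, Finset.prod_const]
    exact mul_le_mul_left (pow_le_pow_right₀ hC (Finset.card_le_univ _)) _
  rw [← Finset.mul_prod_erase _ _ (Finset.mem_univ a), ← Finset.mul_prod_erase _ u hb,
    ← Finset.mul_prod_erase _ v hb, ← Finset.mul_prod_erase _ v ha, hT', ← hT, ← mul_assoc]
  refine (mul_le_mul' (mul_le_div_mul_add_div_mul (h0 a) (ht a) (h0 b) (ht b)) hp).trans_eq ?_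
  ring

lemma enorm_form_le {s : (ι → ℝ × ℝ) → ℂ} {R : ℝ} (hs : ∀ ξ, R ≤ ‖ξ‖ → s ξ = 0)
    {F : Option ι → T2 → ℂ} (hF : ∀ o, BddMeas (F o)) {N j : ℕ} {C : ℝ} (hC : 0 ≤ C)
    (hker : ∀ y, ‖ker s y‖ ≤ C * ∏ i, wt N j (y i)) :
    ‖form s F‖ₑ ≤ ∫⁻ x, ENNReal.ofReal C *
      (‖F none x‖ₑ * ∏ i, avg N j (fun y => ‖F (some i) y‖ₑ) x) := by
  refine (enorm_integral_le_lintegral_enorm _).trans (lintegral_mono fun x => ?_)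
  rw [enorm_mul, mul_left_comm, mul_comm]
  exact mul_le_mul_right (enorm_multOp_le hs (fun i => hF (some i)) hC hker x) _

variable [DecidableEq ι]

omit [Fintype ι] in
lemma exists_avg_lpPiece_le (d : ℕ) : ∃ C : ℝ≥0, ∀ (j : ℕ) (S : Finset (Option ι))
    (F : Option ι → T2 → ℂ) (o : Option ι), BddMeas (F o) → ∀ x,
    avg 4 j (fun y => ‖lpPiece d j S F o y‖ₑ) x ≤ C * locMax j (F o) x := by
  obtain ⟨C1, hC1⟩ := exists_enorm_band_le d
  obtain ⟨C2, hC2⟩ := exists_enorm_low_le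
  refine ⟨max C1 C2 * (2 ^ 4 * 128) * (3 ^ 4 * 16), fun j S F o hF x => ?_⟩
  have h1 (y : T2) : ‖lpPiece d j S F o y‖ₑ
      ≤ (max C1 C2 : ℝ≥0) * avg 4 j (fun y => ‖F o y‖ₑ) y := by
    rw [lpPiece]
    split_ifs
    · refine (hC1 j _ hF y).trans (mul_le_mul_left ?_ _)
      exact_mod_cast le_max_left _ _
    · refine (hC2 j _ hF y).trans (mul_le_mul_left ?_ _)
      exact_mod_cast le_max_right _ _
  have hm := hF.measurable_enorm
  refine (avg_mono h1 x).trans ?_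
  rw [avg_const_mul (measurable_avg 4 j hm)]
  refine (mul_le_mul_right ((avg_avg_le (by norm_num) j hm x).trans
    (mul_le_mul_right (avg_le_locInf (by norm_num) j hm x) _)) _).trans_eq ?_
  rw [locMax]
  push_cast
  ring

/-- Carleson-type quadratic sums. -/
def quad (d j : ℕ) (F : Option ι → T2 → ℂ) (o : Option ι) : ℝ≥0∞ :=
  ∫⁻ x, avg 4 j (fun y => ‖mulOp (bandSym d j) (F o) y‖ₑ) x ^ 2 / locMax j (F o) x
    * locInf j (fun z => ∏ m ∈ Finset.univ.erase o, maxFn (fun y => ‖F m y‖ₑ) z) x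

lemma exists_sum_quad_le (d : ℕ) : ∃ C : ℝ≥0, ∀ F : Option ι → T2 → ℂ, (∀ o, Continuous (F o)) →
    (∀ o, ∫⁻ y, ‖F o y‖ₑ ≠ 0) → ∀ o J,
    ∑ j ∈ Finset.range J, quad d j F o ≤ C * ∫⁻ x, ∏ m, maxFn (fun y => ‖F m y‖ₑ) x := by
  obtain ⟨C, hC⟩ := exists_sum_lintegral_carleson_le d
  refine ⟨C, fun F hF h0 o J => (hC (F o) (hF o) (h0 o) _ ?_ ?_ J).trans_eq ?_⟩
  · exact Finset.measurable_fun_prod _ fun m _ =>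
      measurable_maxFn (hF m).measurable.enorm
  · exact fun x => ENNReal.prod_ne_top fun m _ => maxFn_ne_top (.of_continuous (hF m)) x
  · congr with x
    exact Finset.mul_prod_erase _ (fun m => maxFn (fun y => ‖F m y‖ₑ) x) (Finset.mem_univ o)

lemma lintegral_prod_avg_lpPiece_le {d : ℕ} {C : ℝ≥0∞} (hC : 1 ≤ C) {j : ℕ}
    {S : Finset (Option ι)} {F : Option ι → T2 → ℂ} (hF : ∀ o, Continuous (F o))
    (h0 : ∀ o, ∫⁻ y, ‖F o y‖ₑ ≠ 0)
    (h : ∀ o x, avg 4 j (fun y => ‖lpPiece d j S F o y‖ₑ) x ≤ C * locMax j (F o) x)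
    (hS : 1 < S.card) :
    ∫⁻ x, ∏ o, avg 4 j (fun y => ‖lpPiece d j S F o y‖ₑ) x
      ≤ C ^ Fintype.card (Option ι) * ∑ o, quad d j F o := by
  obtain ⟨a, ha, b, hb, hab⟩ := Finset.one_lt_card.1 hS
  have hmeas (o : Option ι) : Measurable fun x =>
      avg 4 j (fun y => ‖mulOp (bandSym d j) (F o) y‖ₑ) x ^ 2 / locMax j (F o) x
        * locInf j (fun z => ∏ m ∈ Finset.univ.erase o, maxFn (fun y => ‖F m y‖ₑ) z) x :=
    (((measurable_avg 4 j (continuous_band d j _).measurable.enorm).pow_const 2).div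
      (measurable_locInf j _)).mul (measurable_locInf j _)
  have hle : ∀ x, ∏ o, avg 4 j (fun y => ‖lpPiece d j S F o y‖ₑ) x
      ≤ C ^ Fintype.card (Option ι) * ∑ o ∈ {a, b},
        (avg 4 j (fun y => ‖mulOp (bandSym d j) (F o) y‖ₑ) x ^ 2 / locMax j (F o) x
        * locInf j (fun z => ∏ m ∈ Finset.univ.erase o, maxFn (fun y => ‖F m y‖ₑ) z) x) := by
    intro x
    refine (prod_le_sum_sq_div hC (fun o => h o x) (fun o => locMax_ne_zero j (h0 o) x)
      (fun o => locMax_ne_top j (.of_continuous (hF o)) x) hab).trans ?_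
    rw [Finset.sum_pair hab]
    simp only [lpPiece, if_pos ha, if_pos hb]
    exact mul_le_mul_right (add_le_add (mul_le_mul_right (prod_locInf_le _ j _ x) _)
      (mul_le_mul_right (prod_locInf_le _ j _ x) _)) _
  refine (lintegral_mono hle).trans ?_
  rw [lintegral_const_mul _ (Finset.measurable_fun_sum _ fun o _ => hmeas o),
    lintegral_finsetSum _ fun o _ => hmeas o]
  exact mul_le_mul_right (Finset.sum_le_sum_of_subset (Finset.subset_univ _)) _

end Form

section Form

variable {ι : Type*} [Fintype ι] [DecidableEq ι]

lemma exists_enorm_form_pieceSym_le {σ : (ι → ℝ × ℝ) → ℂ} {K : ℝ} (hK : 0 ≤ K)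
    (hker : ∀ j y, ‖ker (pieceSym (Fintype.card ι + 1 + j) σ) y‖ ≤ K * ∏ i, wt 4 j (y i)) :
    ∃ C : ℝ≥0, ∀ F : Option ι → T2 → ℂ, (∀ o, Continuous (F o)) →
      (∀ o, ∫⁻ y, ‖F o y‖ₑ ≠ 0) → ∀ j,
      ‖form (pieceSym (Fintype.card ι + 1 + j) σ) F‖ₑ
        ≤ C * ∑ o, quad (2 * Fintype.card ι + 4) j F o := by
  set d := 2 * Fintype.card ι + 4 with hd
  obtain ⟨A, hA⟩ := exists_avg_lpPiece_le (ι := ι) d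
  obtain ⟨E, hE⟩ := exists_enorm_mulOp_le_avg (d + 1)
  have hsupp (j : ℕ) (S : Finset (Option ι)) (o : Option ι) (n : ℤ × ℤ)
      (hn : 2 ^ (j + (d + 1)) ≤ ‖n‖) : (if o ∈ S then bandSym d j else lowSym j) n = 0 := by
    split_ifs
    · exact bandSym_eq_zero_of_ge (by rwa [add_assoc])
    · exact lowSym_eq_zero ((pow_le_pow_right₀ one_le_two (by lia)).trans hn)
  set D : ℝ≥0 := K.toNNReal * E * max A 1 ^ Fintype.card (Option ι) with hD
  refine ⟨Fintype.card (Finset (Option ι)) * D, fun F hF h0 j => ?_⟩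
  have hS (S : Finset (Option ι)) :
      ‖form (pieceSym (Fintype.card ι + 1 + j) σ) (lpPiece d j S F)‖ₑ
        ≤ D * ∑ o, quad d j F o := by
    rcases le_or_gt S.card 1 with h | h
    · rw [form_lpPiece_eq_zero j d σ F h, enorm_zero]
      exact zero_le
    refine (enorm_form_le (fun ξ => pieceSym_eq_zero_of_ge)
      (fun o => .of_continuous (continuous_lpPiece d j S F o)) hK (hker j)).trans ?_
    have hle (x : T2) : ENNReal.ofReal K * (‖lpPiece d j S F none x‖ₑ *
        ∏ i, avg 4 j (fun y => ‖lpPiece d j S F (some i) y‖ₑ) x)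
        ≤ ENNReal.ofReal K * E * ∏ o, avg 4 j (fun y => ‖lpPiece d j S F o y‖ₑ) x := by
      rw [Fintype.prod_option, mul_assoc, ← mul_assoc (E : ℝ≥0∞)]
      exact mul_le_mul_right (mul_le_mul_left (hE j _ (hsupp j S none) (F none) x) _) _
    refine (lintegral_mono hle).trans ?_
    rw [lintegral_const_mul _ (Finset.measurable_fun_prod _ fun o _ =>
      measurable_avg 4 j (continuous_lpPiece d j S F o).measurable.enorm)]
    refine (mul_le_mul_right (lintegral_prod_avg_lpPiece_le (C := (max A 1 : ℝ≥0)) ?_ hF h0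
      (fun o x => (hA j S F o (.of_continuous (hF o)) x).trans (mul_le_mul_left ?_ _)) h) _).trans_eq ?_
    · exact_mod_cast le_max_right _ _
    · exact_mod_cast le_max_left _ _
    · rw [hD, ENNReal.ofReal]
      push_cast
      ring
  rw [form_pieceSym_eq_sum_lpPiece j σ (.of_continuous (hF none))]
  refine (enorm_sum_le _ _).trans ((Finset.sum_le_sum fun S _ => hS S).trans_eq ?_)
  rw [Finset.sum_const, Finset.card_univ, nsmul_eq_mul]
  push_cast
  ring

omit [DecidableEq ι] in
lemma enorm_form_truncSym_le {σ : (ι → ℝ × ℝ) → ℂ} {K : ℝ} (hK : 0 ≤ K) {c : ℕ}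
    (hker : ∀ y, ‖ker (truncSym c σ) y‖ ≤ K * ∏ i, wt 4 0 (y i))
    {F : Option ι → T2 → ℂ} (hF : ∀ o, Continuous (F o)) :
    ‖form (truncSym c σ) F‖ₑ ≤ (ENNReal.ofReal K * 16 ^ Fintype.card ι) *
      ∫⁻ x, ∏ m, maxFn (fun y => ‖F m y‖ₑ) x := by
  refine (enorm_form_le (fun ξ => truncSym_eq_zero) (fun o => .of_continuous (hF o)) hK
    hker).trans ?_
  have hle (x : T2) : ENNReal.ofReal K * (‖F none x‖ₑ *
      ∏ i, avg 4 0 (fun y => ‖F (some i) y‖ₑ) x) ≤ (ENNReal.ofReal K * 16 ^ Fintype.card ι) *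
        ∏ m, maxFn (fun y => ‖F m y‖ₑ) x := by
    rw [mul_assoc]
    refine mul_le_mul_right ?_ _
    rw [Fintype.prod_option, mul_left_comm, ← Finset.card_univ, ← Finset.prod_const,
      ← Finset.prod_mul_distrib]
    exact mul_le_mul' (le_maxFn (hF none).enorm x) (Finset.prod_le_prod' fun i _ =>
      avg_le_maxFn (by norm_num) 0 (hF _).measurable.enorm x)
  refine (lintegral_mono hle).trans_eq ?_
  rw [lintegral_const_mul _ (Finset.measurable_fun_prod _ fun o _ =>
    measurable_maxFn (hF o).measurable.enorm)]

lemma exists_enorm_form_le_lintegral_prod_maxFn {σ : (ι → ℝ × ℝ) → ℂ}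
    (hσ : ContDiff ℝ (⊤ : ℕ∞) σ)
    (hder : ∀ j : ℕ, ∃ Cj : ℝ, ∀ ξ : ι → ℝ × ℝ,
        ‖iteratedFDeriv ℝ j σ ξ‖ ≤ Cj * (1 + ‖ξ‖) ^ (-(j : ℝ))) :
    ∃ C : ℝ≥0, ∀ F : Option ι → T2 → ℂ, (∀ o, Continuous (F o)) →
      (∀ o, ∫⁻ y, ‖F o y‖ₑ ≠ 0) → ∀ J,
      ‖form (truncSym (Fintype.card ι + 1 + J) σ) F‖ₑ
        ≤ C * ∫⁻ x, ∏ m, maxFn (fun y => ‖F m y‖ₑ) x := by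
  obtain ⟨K, hK, hK1, hK2⟩ := exists_norm_ker_symbol_le hσ hder 4 (Fintype.card ι + 1)
  obtain ⟨A, hA⟩ := exists_enorm_form_pieceSym_le hK hK2
  obtain ⟨Q, hQ⟩ := exists_sum_quad_le (ι := ι) (2 * Fintype.card ι + 4)
  refine ⟨K.toNNReal * 16 ^ Fintype.card ι + A * (Fintype.card (Option ι) * Q),
    fun F hF h0 J => ?_⟩
  rw [form_truncSym _ _ _ (.of_continuous (hF none))]
  refine (enorm_add_le _ _).trans ?_
  push_cast
  rw [add_mul]
  refine add_le_add (enorm_form_truncSym_le hK hK1 hF) ?_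
  refine (enorm_sum_le _ _).trans ((Finset.sum_le_sum fun j _ => hA F hF h0 j).trans ?_)
  rw [← Finset.mul_sum, Finset.sum_comm, mul_assoc]
  refine mul_le_mul_right ((Finset.sum_le_sum fun o _ => hQ F hF h0 o J).trans_eq ?_) _
  rw [Finset.sum_const, Finset.card_univ, nsmul_eq_mul, mul_assoc]

end Form

/-! ### Duality -/

lemma integral_fChar_mul (n : ℤ × ℤ) (g : T2 → ℂ) :
    ∫ x, fChar n x * g x = fCoeff g (-n) := by
  rw [fCoeff, neg_neg]

lemma exists_integral_mul_low_eq {κ : Type*} {B : Finset κ} {c : κ → ℂ} {ν : κ → ℤ × ℤ}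
    {u : T2 → ℂ} (hu : ∀ x, u x = ∑ n ∈ B, c n * fChar (ν n) x) :
    ∃ L, ∀ g, BddMeas g → ∫ x, u x * mulOp (lowSym L) g x = ∫ x, u x * g x := by
  have hsum (g : T2 → ℂ) (hg : BddMeas g) :
      ∫ x, u x * g x = ∑ n ∈ B, c n * fCoeff g (-ν n) := by
    simp_rw [hu, Finset.sum_mul, mul_assoc]
    rw [integral_finsetSum _ fun n _ => (((bddMeas_fChar _).mul hg).integrable.const_mul _)]
    exact Finset.sum_congr rfl fun n _ => by rw [integral_const_mul, integral_fChar_mul]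
  obtain ⟨L, hL⟩ : ∃ L : ℕ, ∑ n ∈ B, ‖ν n‖ < 2 ^ L := pow_unbounded_of_one_lt _ one_lt_two
  refine ⟨L, fun g hg => ?_⟩
  rw [hsum g hg, hsum _ (.of_continuous (continuous_low L g))]
  refine Finset.sum_congr rfl fun n hn => ?_
  rw [fCoeff_mulOp (exists_finset_lowSym L).choose_spec, lowSym_eq_one, one_mul]
  rw [norm_neg]
  exact (Finset.single_le_sum (f := fun n => ‖ν n‖) (fun _ _ => norm_nonneg _) hn).trans hL.le

/-- The function dual to `u` in `L^p`. -/
def dualFn (p : ℝ) (u : T2 → ℂ) (x : T2) : ℂ :=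
  (starRingEnd ℂ) (u x) * ((‖u x‖ ^ (p - 2) : ℝ) : ℂ)

lemma mul_dualFn {p : ℝ} (hp : 1 ≤ p) (u : T2 → ℂ) (x : T2) :
    u x * dualFn p u x = ((‖u x‖ ^ p : ℝ) : ℂ) := by
  rcases eq_or_ne (u x) 0 with h | h
  · rw [h, zero_mul, norm_zero, Real.zero_rpow (by linarith), Complex.ofReal_zero]
  · rw [dualFn, ← mul_assoc, Complex.mul_conj, Complex.normSq_eq_norm_sq, ← Complex.ofReal_mul,
      ← Real.rpow_natCast, ← Real.rpow_add (norm_pos_iff.2 h)]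
    norm_num

lemma enorm_dualFn_le {p : ℝ} (hp : 1 ≤ p) (u : T2 → ℂ) (x : T2) :
    ‖dualFn p u x‖ₑ ≤ ‖u x‖ₑ ^ (p - 1) := by
  rcases eq_or_ne (u x) 0 with h | h
  · simp [dualFn, h]
  · have h1 : ‖dualFn p u x‖ = ‖u x‖ ^ (p - 1) := by
      rw [dualFn, norm_mul, RCLike.norm_conj, Complex.norm_real, Real.norm_of_nonneg (by positivity),
        mul_comm, ← Real.rpow_add_one (norm_ne_zero_iff.2 h)]
      ring_nf
    rw [← ofReal_norm, h1, ← ENNReal.ofReal_rpow_of_nonneg (norm_nonneg _) (by linarith),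
      ofReal_norm]

lemma bddMeas_dualFn {p : ℝ} (hp : 1 ≤ p) {u : T2 → ℂ} (hu : BddMeas u) :
    BddMeas (dualFn p u) := by
  obtain ⟨B, hB⟩ := hu.exists_enorm_le
  refine ⟨?_, B ^ (p - 1), fun x => ?_⟩
  · have := hu.1
    unfold dualFn
    fun_prop
  · have h := (enorm_dualFn_le hp u x).trans (ENNReal.rpow_le_rpow (hB x) (by linarith))
    rw [← ENNReal.coe_rpow_of_nonneg _ (by linarith), enorm_le_coe] at h
    exact_mod_cast h

lemma exists_dual_test_function {p : ℝ} (hp : 1 ≤ p) : ∃ K : ℝ≥0, ∀ {κ : Type} {B : Finset κ}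
    {c : κ → ℂ} {ν : κ → ℤ × ℤ} {u : T2 → ℂ}, (∀ x, u x = ∑ n ∈ B, c n * fChar (ν n) x) →
    BddMeas u → ∃ g : T2 → ℂ, ∃ H : T2 → ℝ≥0∞, Continuous g ∧ Measurable H ∧
      ‖∫ x, u x * g x‖ₑ = ∫⁻ x, ‖u x‖ₑ ^ p ∧
      (∀ x, maxFn (fun y => ‖g y‖ₑ) x ≤ K * H x ^ (1 - p⁻¹)) ∧
      ∫⁻ x, H x ≤ K * ∫⁻ x, ‖u x‖ₑ ^ p := by
  have hpos : 0 < p := by linarith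
  obtain ⟨C, hC⟩ := exists_enorm_low_le
  have hpair {u : T2 → ℂ} (hb : BddMeas u) :
      ‖∫ x, u x * dualFn p u x‖ₑ = ∫⁻ x, ‖u x‖ₑ ^ p := by
    simp_rw [mul_dualFn hp]
    have hint : Integrable fun x => ‖u x‖ ^ p := by
      have := (hb.mul (bddMeas_dualFn hp hb)).integrable.re
      refine this.congr (ae_of_all _ fun x => ?_)
      simp only [mul_dualFn hp]
      exact Complex.ofReal_re _
    rw [integral_complex_ofReal, ← ofReal_norm, Complex.norm_real,
      Real.norm_of_nonneg (integral_nonneg fun x => by positivity),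
      ofReal_integral_eq_lintegral_ofReal hint (ae_of_all _ fun x => by positivity)]
    congr with x
    rw [← ENNReal.ofReal_rpow_of_nonneg (norm_nonneg _) hpos.le, ofReal_norm]
  rcases hp.eq_or_lt with rfl | hp1
  · refine ⟨4 * (C * 64) + 1, fun {κ B c ν u} hu hb => ?_⟩
    obtain ⟨L, hL⟩ := exists_integral_mul_low_eq hu
    have hg := bddMeas_dualFn le_rfl hb
    refine ⟨mulOp (lowSym L) (dualFn 1 u), fun x => ‖u x‖ₑ, continuous_low _ _,
      hb.measurable_enorm, ?_, fun x => ?_, ?_⟩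
    · rw [hL _ hg, hpair hb]
    · rw [inv_one, sub_self, ENNReal.rpow_zero, mul_one]
      refine (maxFn_le_of_le (B := C * 64) (fun y => ?_) x).trans ?_
      · refine (hC L _ hg y).trans (mul_le_mul_right ?_ _)
        refine (avg_le_of_le (B := 1) (by norm_num) L (fun z => ?_) y).trans_eq (mul_one _)
        simpa using enorm_dualFn_le le_rfl u z
      · push_cast
        exact le_self_add
    · simp_rw [ENNReal.rpow_one]
      exact le_mul_of_one_le_left' (by push_cast; exact le_add_self)
  · have hq : p.HolderConjugate p.conjExponent := Real.HolderConjugate.conjExponent hp1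
    set q := p.conjExponent
    obtain ⟨M, hM⟩ := exists_lintegral_maxFn_rpow_le hq.symm.lt
    refine ⟨M * ((C * 16) ^ q * M) + 1, fun {κ B c ν u} hu hb => ?_⟩
    obtain ⟨L, hL⟩ := exists_integral_mul_low_eq hu
    have hg := bddMeas_dualFn hp hb
    have hc := continuous_low L (dualFn p u)
    have hmg := measurable_maxFn hc.measurable.enorm
    refine ⟨mulOp (lowSym L) (dualFn p u),
      fun x => maxFn (fun y => ‖mulOp (lowSym L) (dualFn p u) y‖ₑ) x ^ q, hc,
      hmg.pow_const _, ?_, fun x => ?_, ?_⟩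
    · rw [hL _ hg, hpair hb]
    · rw [← ENNReal.rpow_mul, hq.one_sub_inv, mul_inv_cancel₀ hq.symm.ne_zero,
        ENNReal.rpow_one]
      exact le_mul_of_one_le_left' (by push_cast; exact le_add_self)
    · have h1 (x : T2) : ‖mulOp (lowSym L) (dualFn p u) x‖ₑ ^ q
          ≤ ((C * 16 : ℝ≥0) : ℝ≥0∞) ^ q * maxFn (fun y => ‖dualFn p u y‖ₑ) x ^ q := by
        rw [← ENNReal.mul_rpow_of_nonneg _ _ hq.symm.nonneg]
        refine ENNReal.rpow_le_rpow ((hC L _ hg x).trans ?_) hq.symm.nonneg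
        push_cast
        rw [mul_assoc]
        exact mul_le_mul_right (avg_le_maxFn (by norm_num) L hg.measurable_enorm x) _
      have h2 (x : T2) : ‖dualFn p u x‖ₑ ^ q ≤ ‖u x‖ₑ ^ p := by
        refine (ENNReal.rpow_le_rpow (enorm_dualFn_le hp u x) hq.symm.nonneg).trans_eq ?_
        rw [← ENNReal.rpow_mul, hq.sub_one_mul_conj]
      refine (hM _ hc.measurable.enorm (BddMeas.of_continuous hc).exists_enorm_le).trans ?_
      refine (mul_le_mul_right (lintegral_mono h1) _).trans ?_
      rw [lintegral_const_mul _ ((measurable_maxFn hg.measurable_enorm).pow_const _)]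
      refine (mul_le_mul_right (mul_le_mul_right ((hM _ hg.measurable_enorm
        hg.exists_enorm_le).trans (mul_le_mul_right (lintegral_mono h2) _)) _) _).trans ?_
      rw [← mul_assoc, ← mul_assoc]
      refine mul_le_mul_left ?_ _
      rw [← ENNReal.coe_rpow_of_nonneg _ hq.symm.nonneg]
      push_cast
      rw [mul_assoc]
      exact le_self_add

/-! ### Bounds for the truncated operators -/

section Trunc

variable {ι : Type} [Fintype ι]

lemma multOp_eq_sum {s : (ι → ℝ × ℝ) → ℂ} {R : ℝ} (hs : ∀ ξ, R ≤ ‖ξ‖ → s ξ = 0)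
    (g : ι → T2 → ℂ) (x : T2) :
    multOp s g x = ∑ n ∈ box ι R,
      (s (lat n) * ∏ i, fCoeff (g i) (n i)) * fChar (∑ i, n i) x := by
  refine tsum_eq_sum fun n hn => ?_
  rw [hs _ (le_of_not_ge fun h => hn (mem_box h)), zero_mul, zero_mul]

lemma bddMeas_multOp {s : (ι → ℝ × ℝ) → ℂ} {R : ℝ} (hs : ∀ ξ, R ≤ ‖ξ‖ → s ξ = 0)
    (g : ι → T2 → ℂ) : BddMeas (multOp s g) := by
  simp_rw [funext (multOp_eq_sum hs g)]
  exact bddMeas_sum _ fun n => (bddMeas_fChar _).const_mul _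

lemma fCoeff_eq_zero {f : T2 → ℂ} (hf : Continuous f) (h : ∫⁻ y, ‖f y‖ₑ = 0) (n : ℤ × ℤ) :
    fCoeff f n = 0 := by
  rw [lintegral_eq_zero_iff hf.measurable.enorm] at h
  refine integral_eq_zero_of_ae ?_
  filter_upwards [h] with x hx
  simp [enorm_eq_zero.1 hx]

lemma lintegral_mul_prod_rpow_le {p : ℝ} {q : ι → ℝ} (hp : 1 ≤ p) (hq : ∀ i, 1 < q i)
    (hpq : ∑ i, (q i)⁻¹ = p⁻¹) {H : T2 → ℝ≥0∞} (hH : Measurable H) {G : ι → T2 → ℝ≥0∞}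
    (hG : ∀ i, Measurable (G i)) :
    ∫⁻ x, H x ^ (1 - p⁻¹) * ∏ i, G i x
      ≤ (∫⁻ x, H x) ^ (1 - p⁻¹) * ∏ i, (∫⁻ x, G i x ^ q i) ^ (q i)⁻¹ := by
  have h := ENNReal.lintegral_prod_norm_pow_le (μ := (volume : Measure T2))
    (Finset.univ : Finset (Option ι)) (f := fun o => o.elim H fun i x => G i x ^ q i)
    (p := fun o => o.elim (1 - p⁻¹) fun i => (q i)⁻¹) ?_ ?_ ?_
  · simp only [Fintype.prod_option, Option.elim_none, Option.elim_some] at h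
    refine le_of_eq_of_le ?_ h
    congr with x
    congr 1
    refine Finset.prod_congr rfl fun i _ => ?_
    rw [← ENNReal.rpow_mul, mul_inv_cancel₀ (by linarith [hq i]), ENNReal.rpow_one]
  · rintro (_ | i) -
    exacts [hH.aemeasurable, ((hG i).pow_const _).aemeasurable]
  · simp [Fintype.sum_option, hpq]
  · rintro (_ | i) -
    · simpa using inv_le_one_of_one_le₀ hp
    · exact inv_nonneg.2 (by linarith [hq i])

lemma exists_multOp_truncSym_le {σ : (ι → ℝ × ℝ) → ℂ} (hσ : ContDiff ℝ (⊤ : ℕ∞) σ)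
    (hder : ∀ j : ℕ, ∃ Cj : ℝ, ∀ ξ : ι → ℝ × ℝ,
        ‖iteratedFDeriv ℝ j σ ξ‖ ≤ Cj * (1 + ‖ξ‖) ^ (-(j : ℝ)))
    {p : ℝ} {q : ι → ℝ} (hp : 1 ≤ p) (hq : ∀ i, 1 < q i) (hpq : ∑ i, (q i)⁻¹ = p⁻¹) :
    ∃ C : ℝ≥0, ∀ f : ι → T2 → ℂ, (∀ i, Continuous (f i)) → ∀ J,
      (∫⁻ x, ‖multOp (truncSym (Fintype.card ι + 1 + J) σ) f x‖ₑ ^ p) ^ p⁻¹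
        ≤ C * ∏ i, (∫⁻ x, ‖f i x‖ₑ ^ q i) ^ (q i)⁻¹ := by
  classical
  have hpos : 0 < p := by linarith
  have hp' : 0 ≤ 1 - p⁻¹ := by simpa using inv_le_one_of_one_le₀ hp
  obtain ⟨A, hA⟩ := exists_enorm_form_le_lintegral_prod_maxFn hσ hder
  obtain ⟨K, hK⟩ := exists_dual_test_function hp
  choose M hM using fun i => exists_lintegral_maxFn_rpow_le (hq i)
  refine ⟨A * K * K ^ (1 - p⁻¹) * ∏ i, M i ^ (q i)⁻¹, fun f hf J => ?_⟩
  have hs (ξ : ι → ℝ × ℝ) (h : 2 ^ (Fintype.card ι + 1 + J + 1) ≤ ‖ξ‖) :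
      truncSym (Fintype.card ι + 1 + J) σ ξ = 0 := truncSym_eq_zero h
  have hb := bddMeas_multOp hs f
  obtain ⟨g, H, hg, hH, hu, hgH, hHu⟩ := hK (multOp_eq_sum hs f) hb
  set u := multOp (truncSym (Fintype.card ι + 1 + J) σ) f with hu_def
  set I := ∫⁻ x, ‖u x‖ₑ ^ p with hI_def
  rcases eq_or_ne I 0 with hI | hI
  · rw [hI, ENNReal.zero_rpow_of_pos (inv_pos.2 hpos)]
    exact zero_le
  have hI' : I ≠ ⊤ := by
    obtain ⟨B, hB⟩ := hb.exists_enorm_le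
    refine ne_top_of_le_ne_top (b := ∫⁻ _ : T2, (B : ℝ≥0∞) ^ p) ?_
      (lintegral_mono fun x => ENNReal.rpow_le_rpow (hB x) hpos.le)
    simp [hpos.le]
  have hg0 : ∫⁻ y, ‖g y‖ₑ ≠ 0 := by
    intro h0
    rw [lintegral_eq_zero_iff hg.measurable.enorm] at h0
    refine hI ?_
    rw [← hu, integral_eq_zero_of_ae, enorm_zero]
    filter_upwards [h0] with x hx
    simp [enorm_eq_zero.1 hx]
  have hf0 (i : ι) : ∫⁻ y, ‖f i y‖ₑ ≠ 0 := by
    intro h0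
    refine hI ?_
    have hzero (x : T2) : u x = 0 := by
      rw [hu_def, multOp]
      refine (tsum_congr fun n => ?_).trans tsum_zero
      rw [Finset.prod_eq_zero (Finset.mem_univ i) (fCoeff_eq_zero (hf i) h0 _), mul_zero, zero_mul]
    simp [hI_def, hzero, hpos]
  have hmax (i : ι) : Measurable (maxFn fun y => ‖f i y‖ₑ) :=
    measurable_maxFn (hf i).measurable.enorm
  have hform := hA (fun o => o.elim g f) (by rintro (_ | i); exacts [hg, hf i])
    (by rintro (_ | i); exacts [hg0, hf0 i]) J
  have hform' : form (truncSym (Fintype.card ι + 1 + J) σ) (fun o => o.elim g f)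
      = ∫ x, u x * g x := rfl
  rw [hform', hu] at hform
  simp only [Fintype.prod_option, Option.elim_none, Option.elim_some] at hform
  have hmaxle (i : ι) : (∫⁻ x, maxFn (fun y => ‖f i y‖ₑ) x ^ q i) ^ (q i)⁻¹
      ≤ (M i : ℝ≥0∞) ^ (q i)⁻¹ * (∫⁻ x, ‖f i x‖ₑ ^ q i) ^ (q i)⁻¹ := by
    have hqi : 0 ≤ (q i)⁻¹ := inv_nonneg.2 (by linarith [hq i])
    rw [← ENNReal.mul_rpow_of_nonneg _ _ hqi]
    exact ENNReal.rpow_le_rpow (hM i _ (hf i).measurable.enorm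
      (BddMeas.of_continuous (hf i)).exists_enorm_le) hqi
  have key : I ^ p⁻¹ * I ^ (1 - p⁻¹)
      ≤ (A * K * K ^ (1 - p⁻¹) * ∏ i, ((M i : ℝ≥0∞) ^ (q i)⁻¹)) *
        (∏ i, (∫⁻ x, ‖f i x‖ₑ ^ q i) ^ (q i)⁻¹) * I ^ (1 - p⁻¹) := by
    calc I ^ p⁻¹ * I ^ (1 - p⁻¹) = I := by
          rw [← ENNReal.rpow_add _ _ hI hI', add_sub_cancel, ENNReal.rpow_one]
      _ ≤ A * ∫⁻ x, K * (H x ^ (1 - p⁻¹) * ∏ i, maxFn (fun y => ‖f i y‖ₑ) x) := by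
          refine hform.trans (mul_le_mul_right (lintegral_mono fun x => ?_) _)
          rw [← mul_assoc]
          exact mul_le_mul_left (hgH x) _
      _ ≤ A * (K * ((K * I) ^ (1 - p⁻¹) * ∏ i, ((M i : ℝ≥0∞) ^ (q i)⁻¹ *
            (∫⁻ x, ‖f i x‖ₑ ^ q i) ^ (q i)⁻¹))) := by
          refine mul_le_mul_right ?_ _
          have hprod : Measurable fun x =>
              H x ^ (1 - p⁻¹) * ∏ i, maxFn (fun y => ‖f i y‖ₑ) x :=
            (hH.pow_const _).mul (Finset.measurable_fun_prod _ fun i _ => hmax i)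
          rw [lintegral_const_mul _ hprod]
          refine mul_le_mul_right ((lintegral_mul_prod_rpow_le hp hq hpq hH hmax).trans ?_) _
          exact mul_le_mul' (ENNReal.rpow_le_rpow hHu hp')
            (Finset.prod_le_prod' fun i _ => hmaxle i)
      _ = _ := by
          rw [ENNReal.mul_rpow_of_nonneg _ _ hp', Finset.prod_mul_distrib]
          ring
  have hcancel := (ENNReal.mul_le_mul_iff_left
    (by rw [Ne, ENNReal.rpow_eq_zero_iff]; simp [hI, hI'])
    (ENNReal.rpow_ne_top_of_nonneg hp' hI')).1 key
  refine hcancel.trans_eq ?_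
  push_cast
  rw [ENNReal.coe_rpow_of_nonneg _ hp']
  congr 2
  exact Finset.prod_congr rfl fun i _ =>
    (ENNReal.coe_rpow_of_nonneg _ (inv_nonneg.2 (by linarith [hq i]))).symm

end Trunc

/-! ### Passing to the limit -/

lemma SmoothT2.continuous {f : T2 → ℂ} (hf : SmoothT2 f) : Continuous f := by
  obtain ⟨F, hF, h⟩ := hf
  have hq : IsOpenQuotientMap (Prod.map ((↑) : ℝ → AddCircle (1 : ℝ)) ((↑) : ℝ → AddCircle (1 : ℝ))) :=
    QuotientAddGroup.isOpenQuotientMap_mk.prodMap QuotientAddGroup.isOpenQuotientMap_mk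
  rw [hq.isQuotientMap.continuous_iff]
  exact hF.continuous.congr fun x => (h x.1 x.2).symm

section Limit

variable {ι : Type} [Fintype ι]

lemma tendsto_truncSym (c : ℕ) (σ : (ι → ℝ × ℝ) → ℂ) (ξ : ι → ℝ × ℝ) :
    Filter.Tendsto (fun J => truncSym (c + J) σ ξ) Filter.atTop (nhds (σ ξ)) := by
  obtain ⟨L, hL⟩ : ∃ L : ℕ, ‖ξ‖ < 2 ^ L := pow_unbounded_of_one_lt _ one_lt_two
  refine tendsto_const_nhds.congr' ?_
  filter_upwards [Filter.eventually_ge_atTop L] with J hJ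
  exact (truncSym_eq_self (hL.le.trans (pow_le_pow_right₀ one_le_two (by lia)))).symm

lemma eLpNorm_multOp_le {σ : (ι → ℝ × ℝ) → ℂ} {c : ℕ} {f : ι → T2 → ℂ} {p B : ℝ≥0∞}
    (h : ∀ J, eLpNorm (multOp (truncSym (c + J) σ) f) p volume ≤ B) :
    eLpNorm (multOp σ f) p volume ≤ B := by
  by_cases hs : Summable fun n : ι → ℤ × ℤ => ‖σ (lat n) * ∏ i, fCoeff (f i) (n i)‖
  · refine (Lp.eLpNorm_lim_le_liminf_eLpNorm (fun J => ?_) _ (ae_of_all _ fun x => ?_)).trans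
      (Filter.liminf_le_of_frequently_le' (Filter.Frequently.of_forall h))
    · exact (bddMeas_multOp (fun ξ => truncSym_eq_zero) f).1.aestronglyMeasurable
    · refine tendsto_tsum_of_dominated_convergence hs (fun n => ?_)
        (Filter.Eventually.of_forall fun J n => ?_)
      · exact ((tendsto_truncSym c σ _).mul_const _).mul_const _
      · rw [norm_mul, norm_fChar, mul_one, norm_mul, norm_mul]
        exact mul_le_mul_of_nonneg_right (norm_truncSym_le _ _ _) (norm_nonneg _)
  · have h0 : multOp σ f = 0 := by
      funext x
      refine tsum_eq_zero_of_not_summable fun hx => hs ?_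
      simpa only [norm_mul, norm_fChar, mul_one] using hx.norm
    rw [h0, eLpNorm_zero]
    exact zero_le

end Limit

end CoifmanMeyer

open CoifmanMeyer

/-- Coifman–Meyer multiplier theorem transferred to the torus: if
`σ : ℝ^{2k} → ℂ` is infinitely differentiable with `|∂^β σ(ξ)| ≲_β (1+|ξ|)^{-|β|}`, then the
periodic multilinear operator `Λ̃(f₁,…,f_k)(x) = Σ_n σ(n₁,…,n_k) f̂₁(n₁)⋯f̂_k(n_k)
e^{2πi(n₁+⋯+n_k)·x}` satisfies `‖Λ̃(f₁,…,f_k)‖_{L^p} ≲ ∏ᵢ ‖fᵢ‖_{L^{pᵢ}}` whenever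
`pᵢ ∈ (1,∞)` and `1/p = Σᵢ 1/pᵢ ≤ 1`. -/
theorem coifman_meyer_torus
    (k : ℕ) (σ : (Fin k → ℝ × ℝ) → ℂ)
    (hσ : ContDiff ℝ (⊤ : ℕ∞) σ)
    (hder : ∀ j : ℕ, ∃ Cj : ℝ, ∀ ξ : Fin k → ℝ × ℝ,
        ‖iteratedFDeriv ℝ j σ ξ‖ ≤ Cj * (1 + ‖ξ‖) ^ (-(j : ℝ)))
    (p : ℝ≥0∞) (pv : Fin k → ℝ≥0∞)
    (hpv : ∀ i, 1 < pv i ∧ pv i ≠ ⊤)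
    (hp : 1 / p = ∑ i, 1 / pv i) (hp1 : (∑ i, 1 / pv i) ≤ 1) :
    ∃ Cst : ℝ, 0 < Cst ∧
      ∀ f : Fin k → T2 → ℂ, (∀ i, SmoothT2 (f i)) →
        eLpNorm
          (fun x : T2 => ∑' nv : Fin k → ℤ × ℤ,
            σ (fun i => (((nv i).1 : ℝ), ((nv i).2 : ℝ)))
              * (∏ i, fCoeff (f i) (nv i)) * fChar (∑ i, nv i) x)
          p volume
        ≤ ENNReal.ofReal Cst * ∏ i, eLpNorm (f i) (pv i) volume := by
  rcases Nat.eq_zero_or_pos k with rfl | hk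
  · refine ⟨‖σ 0‖ + 1, by positivity, fun f _ => ?_⟩
    refine (eLpNorm_le_of_ae_bound (C := ‖σ 0‖ + 1) (ae_of_all _ fun x => ?_)).trans ?_
    · have h0 (ξ : Fin 0 → ℝ × ℝ) : σ ξ = σ 0 := by rw [Subsingleton.elim ξ 0]
      rw [tsum_fintype, Fintype.sum_unique, norm_mul, norm_fChar, mul_one,
        Finset.univ_eq_empty, Finset.prod_empty, mul_one, h0]
      linarith
    · simp
  have hreal (i : Fin k) : 1 < (pv i).toReal :=
    (ENNReal.toReal_one ▸ (ENNReal.toReal_lt_toReal ENNReal.one_ne_top (hpv i).2).2 (hpv i).1)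
  have hp_top : p ≠ ⊤ := by
    rintro rfl
    rw [ENNReal.div_top, eq_comm, Finset.sum_eq_zero_iff] at hp
    have := hp ⟨0, hk⟩ (Finset.mem_univ _)
    simp [(hpv ⟨0, hk⟩).2] at this
  have hp_one : 1 ≤ p := by
    rw [← hp, one_div, ENNReal.inv_le_one] at hp1
    exact hp1
  have hp_real : 1 ≤ p.toReal :=
    ENNReal.toReal_one ▸ (ENNReal.toReal_le_toReal ENNReal.one_ne_top hp_top).2 hp_one
  have hsum : ∑ i, ((pv i).toReal)⁻¹ = (p.toReal)⁻¹ := by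
    simp_rw [one_div] at hp
    rw [← ENNReal.toReal_inv p, hp, ENNReal.toReal_sum fun i _ =>
      ENNReal.inv_ne_top.2 (zero_lt_one.trans (hpv i).1).ne']
    simp_rw [ENNReal.toReal_inv]
  obtain ⟨C, hC⟩ := exists_multOp_truncSym_le hσ hder hp_real hreal hsum
  refine ⟨C + 1, by positivity, fun f hf => ?_⟩
  refine eLpNorm_multOp_le (c := Fintype.card (Fin k) + 1) fun J => ?_
  rw [eLpNorm_eq_lintegral_rpow_enorm_toReal (zero_lt_one.trans_le hp_one).ne' hp_top, one_div]
  refine (hC f (fun i => (hf i).continuous) J).trans (mul_le_mul' ?_ (le_of_eq ?_))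
  · rw [← ENNReal.ofReal_coe_nnreal]
    exact ENNReal.ofReal_le_ofReal (by linarith)
  · refine Finset.prod_congr rfl fun i _ => ?_
    rw [eLpNorm_eq_lintegral_rpow_enorm_toReal (zero_lt_one.trans (hpv i).1).ne' (hpv i).2,
      one_div]

end
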